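/- arXiv:1305.4616 — 2 statements merged into one kernel-verified Lean document; each statement's English description precedes it below -/
import Mathlib

section
/- Let 1<p<∞ and 0<s<1 be such that 0<sp≤1. Then there exists an open set G ⊂ ℝ² whose boundary ∂G is (s,p)-uniformly fat, but G does not admit the (s,p)-Hardy inequality. -/
open MeasureTheory Metric Set
open scoped ENNReal NNReal Topology

noncomputable section

/-- Euclidean space `ℝⁿ`. -/
abbrev Euc (n : ℕ) := EuclideanSpace ℝ (Fin n)

/-- The `λ`-Hausdorff content of a set `E ⊆ ℝⁿ`:
`H^λ_∞(E) = inf { Σ_i r_i^λ : E ⊆ ⋃_i B(x_i, r_i), r_i > 0 }`. -/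
def hContent (n : ℕ) (lam : ℝ) (E : Set (Euc n)) : ℝ≥0∞ :=
  ⨅ (c : ℕ → Euc n × ℝ) (_ : ∀ i, 0 < (c i).2)
    (_ : E ⊆ ⋃ i, Metric.ball (c i).1 (c i).2),
    ∑' i, ENNReal.ofReal ((c i).2 ^ lam)

/-- The Riesz `(s,p)`-capacity of a set `E ⊆ ℝⁿ`:
`R_{s,p}(E) = inf { ‖f‖_p^p : f ≥ 0, I_s f ≥ 1 on E }`, where
`I_s f (x) = ∫ f(y) |x-y|^{s-n} dy`. -/
def rieszCap (n : ℕ) (s p : ℝ) (E : Set (Euc n)) : ℝ≥0∞ :=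
  ⨅ (f : Euc n → ℝ) (_ : Measurable f) (_ : ∀ x, 0 ≤ f x)
    (_ : ∀ x ∈ E, 1 ≤ ∫⁻ y, ENNReal.ofReal (f y) * ENNReal.ofReal (dist x y ^ (s - (n : ℝ)))),
    ∫⁻ x, ENNReal.ofReal (f x ^ p)

/-- A set `E ⊆ ℝⁿ` is `(s,p)`-uniformly fat:
`R_{s,p}(B(x,r) ∩ E) ≥ σ r^{n-sp}` for all `x ∈ E`, `r > 0`. -/
def UniformlyFat (n : ℕ) (s p : ℝ) (E : Set (Euc n)) : Prop :=
  ∃ σ : ℝ, 0 < σ ∧ ∀ x ∈ E, ∀ r : ℝ, 0 < r →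
    ENNReal.ofReal (σ * r ^ ((n : ℝ) - s * p)) ≤ rieszCap n s p (Metric.ball x r ∩ E)

/-- A set `E ⊆ ℝⁿ` is locally `(s,p)`-uniformly fat:
`R_{s,p}(B(x,r) ∩ E) ≥ σ r^{n-sp}` for all `x ∈ E`, `0 < r < r₀`. -/
def LocallyUniformlyFat (n : ℕ) (s p : ℝ) (E : Set (Euc n)) : Prop :=
  ∃ σ r₀ : ℝ, 0 < σ ∧ 0 < r₀ ∧ ∀ x ∈ E, ∀ r : ℝ, 0 < r → r < r₀ →
    ENNReal.ofReal (σ * r ^ ((n : ℝ) - s * p)) ≤ rieszCap n s p (Metric.ball x r ∩ E)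

/-- An open set `G ⊆ ℝⁿ` admits the `(s,p)`-Hardy inequality:
`∫_G |u|^p dist(x,∂G)^{-sp} dx ≤ c ∫_G ∫_G |u(x)-u(y)|^p |x-y|^{-(n+sp)} dy dx`
for every `u ∈ C_c^∞(G)`. -/
def AdmitsHardy (n : ℕ) (s p : ℝ) (G : Set (Euc n)) : Prop :=
  ∃ c : ℝ, 0 < c ∧ ∀ u : Euc n → ℝ,
    ContDiff ℝ (⊤ : ℕ∞) u → HasCompactSupport u → tsupport u ⊆ G →
    (∫⁻ x in G, ENNReal.ofReal (|u x| ^ p / Metric.infDist x (frontier G) ^ (s * p))) ≤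
      ENNReal.ofReal c *
        ∫⁻ x in G, ∫⁻ y in G, ENNReal.ofReal (|u x - u y| ^ p / dist x y ^ ((n : ℝ) + s * p))

/-- `U` is a `c`-John domain with center point `x₀`: every `x ∈ U` is joined to `x₀`
by an arc-length-parameterized (here: 1-Lipschitz) curve `γ : [0,ℓ] → U` with
`dist(γ(t), ∂U) ≥ t/c`. -/
def IsJohnDomain (n : ℕ) (c : ℝ) (U : Set (Euc n)) (x₀ : Euc n) : Prop :=
  IsOpen U ∧ IsConnected U ∧ x₀ ∈ U ∧
  ∀ x ∈ U, ∃ ℓ : ℝ, 0 ≤ ℓ ∧ ∃ γ : ℝ → Euc n,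
    LipschitzOnWith 1 γ (Set.Icc 0 ℓ) ∧ γ 0 = x ∧ γ ℓ = x₀ ∧
    ∀ t ∈ Set.Icc 0 ℓ, γ t ∈ U ∧ t / c ≤ Metric.infDist (γ t) (frontier U)

/-- `G_{x,c}`: the union of all `c`-John subdomains of `G` with center point `x`. -/
def johnPart (n : ℕ) (c : ℝ) (G : Set (Euc n)) (x : Euc n) : Set (Euc n) :=
  ⋃₀ {U : Set (Euc n) | U ⊆ G ∧ IsJohnDomain n c U x}

/-- The `c`-visual boundary of `G` near `x`: `∂^vis_{x,c} G = ∂G ∩ ∂G_{x,c}`. -/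
def visualBoundary (n : ℕ) (c : ℝ) (G : Set (Euc n)) (x : Euc n) : Set (Euc n) :=
  frontier G ∩ frontier (johnPart n c G x)

/-- `G` is a uniform domain with constant `C`. -/
def IsUniformDomain (n : ℕ) (C : ℝ) (G : Set (Euc n)) : Prop :=
  IsOpen G ∧ IsConnected G ∧
  ∀ x ∈ G, ∀ y ∈ G, ∃ ℓ : ℝ, 0 ≤ ℓ ∧ ℓ ≤ C * dist x y ∧
    ∃ γ : ℝ → Euc n, LipschitzOnWith 1 γ (Set.Icc 0 ℓ) ∧ γ 0 = x ∧ γ ℓ = y ∧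
      ∀ t ∈ Set.Icc 0 ℓ, γ t ∈ G ∧
        min (dist (γ t) x) (dist (γ t) y) / C ≤ Metric.infDist (γ t) (frontier G)

/-- The closed axis-parallel cube with center `z` and side length `ℓ`. -/
def cube (n : ℕ) (z : Euc n) (ℓ : ℝ) : Set (Euc n) := {y | ∀ i, |y i - z i| ≤ ℓ / 2}

/-- Distance between two sets. -/
def setSetDist (n : ℕ) (A B : Set (Euc n)) : ℝ := sInf (Set.image2 dist A B)

/-- `Q = cube z ℓ` is a Whitney cube of the open set `G`:
`Q ⊆ G` and `diam Q ≤ dist(Q, ∂G) ≤ 4 diam Q`. -/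
def IsWhitneyCube (n : ℕ) (G : Set (Euc n)) (z : Euc n) (ℓ : ℝ) : Prop :=
  0 < ℓ ∧ cube n z ℓ ⊆ G ∧
    Metric.diam (cube n z ℓ) ≤ setSetDist n (cube n z ℓ) (frontier G) ∧
    setSetDist n (cube n z ℓ) (frontier G) ≤ 4 * Metric.diam (cube n z ℓ)

/-- The `p`-th power of the Gagliardo `(s,p)`-seminorm of `u` on `A`:
`|u|_{W^{s,p}(A)}^p = ∫_A ∫_A |u(x)-u(y)|^p |x-y|^{-(n+sp)} dy dx`. -/
def gagliardoP (n : ℕ) (s p : ℝ) (A : Set (Euc n)) (u : Euc n → ℝ) : ℝ≥0∞ :=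
  ∫⁻ x in A, ∫⁻ y in A, ENNReal.ofReal (|u x - u y| ^ p / dist x y ^ ((n : ℝ) + s * p))

/-- `E` is an Ahlfors `λ`-regular set: `E` is closed and
`C⁻¹ r^λ ≤ H^λ(B(x,r) ∩ E) ≤ C r^λ` for `x ∈ E`, `0 < r < diam E`. -/
def AhlforsRegular (n : ℕ) (lam : ℝ) (E : Set (Euc n)) : Prop :=
  IsClosed E ∧ ∃ C : ℝ, 1 < C ∧ ∀ x ∈ E, ∀ r : ℝ, 0 < r →
    ENNReal.ofReal r < EMetric.diam E →
      ENNReal.ofReal (C⁻¹ * r ^ lam) ≤ μH[lam] (Metric.ball x r ∩ E) ∧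
      μH[lam] (Metric.ball x r ∩ E) ≤ ENNReal.ofReal (C * r ^ lam)

/-- The strictly increasing function `t ↦ t + ∑ₘ 4⁻ᵐ ⌈2ᵐ t⌉`, which jumps at every dyadic
rational. The closure of its range is a fat Cantor set. -/
def dyadicJump (t : ℝ) : ℝ := t + ∑' m : ℕ, (1 / 4 : ℝ) ^ m * ⌈(2 : ℝ) ^ m * t⌉

theorem four_two_pow (m : ℕ) : (1 / 4 : ℝ) ^ m * 2 ^ m = (1 / 2) ^ m := by
  rw [← mul_pow]; norm_num

theorem summable_dyadicJump (t : ℝ) :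
    Summable fun m : ℕ => (1 / 4 : ℝ) ^ m * ⌈(2 : ℝ) ^ m * t⌉ := by
  have h1 : Summable fun m : ℕ => (1 / 2 : ℝ) ^ m * |t| + (1 / 4 : ℝ) ^ m :=
    ((summable_geometric_of_lt_one (by norm_num) (by norm_num)).mul_right _).add
      (summable_geometric_of_lt_one (by norm_num) (by norm_num))
  refine Summable.of_norm_bounded h1 fun m => ?_
  have h2 : |(⌈(2 : ℝ) ^ m * t⌉ : ℝ)| ≤ 2 ^ m * |t| + 1 := by
    have a := Int.le_ceil ((2 : ℝ) ^ m * t)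
    have b := Int.ceil_lt_add_one ((2 : ℝ) ^ m * t)
    have c : |(2 : ℝ) ^ m * t| = 2 ^ m * |t| := by rw [abs_mul, abs_of_pos (by positivity)]
    rw [← c, abs_le]
    constructor
    · linarith [neg_abs_le ((2 : ℝ) ^ m * t)]
    · linarith [le_abs_self ((2 : ℝ) ^ m * t)]
  rw [Real.norm_eq_abs, abs_mul, abs_of_pos (by positivity : (0 : ℝ) < (1 / 4) ^ m),
    ← four_two_pow m]
  nlinarith [(by positivity : (0 : ℝ) < (1 / 4) ^ m)]

theorem dyadicJump_sub (a b : ℝ) :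
    dyadicJump b - dyadicJump a =
      (b - a) + ∑' m : ℕ, (1 / 4 : ℝ) ^ m * (⌈(2 : ℝ) ^ m * b⌉ - ⌈(2 : ℝ) ^ m * a⌉ : ℝ) := by
  simp only [mul_sub]
  rw [(summable_dyadicJump b).tsum_sub (summable_dyadicJump a), dyadicJump, dyadicJump]
  ring

theorem summable_dyadicJump_sub (a b : ℝ) :
    Summable fun m : ℕ => (1 / 4 : ℝ) ^ m * (⌈(2 : ℝ) ^ m * b⌉ - ⌈(2 : ℝ) ^ m * a⌉ : ℝ) := by
  simp only [mul_sub]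
  exact (summable_dyadicJump b).sub (summable_dyadicJump a)

theorem ceil_two_pow_mono {a b : ℝ} (h : a ≤ b) (m : ℕ) :
    (⌈(2 : ℝ) ^ m * a⌉ : ℝ) ≤ ⌈(2 : ℝ) ^ m * b⌉ := by
  exact_mod_cast Int.ceil_mono (mul_le_mul_of_nonneg_left h (by positivity))

theorem ceil_two_pow_sub_le (a b : ℝ) (m : ℕ) :
    (⌈(2 : ℝ) ^ m * b⌉ - ⌈(2 : ℝ) ^ m * a⌉ : ℝ) ≤ 2 ^ m * (b - a) + 1 := by
  have := Int.le_ceil ((2 : ℝ) ^ m * a)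
  have := Int.ceil_lt_add_one ((2 : ℝ) ^ m * b)
  linarith

theorem sub_le_dyadicJump_sub {a b : ℝ} (h : a ≤ b) :
    b - a ≤ dyadicJump b - dyadicJump a := by
  rw [dyadicJump_sub]
  have : 0 ≤ ∑' m : ℕ, (1 / 4 : ℝ) ^ m * (⌈(2 : ℝ) ^ m * b⌉ - ⌈(2 : ℝ) ^ m * a⌉ : ℝ) :=
    tsum_nonneg fun m => mul_nonneg (by positivity) (sub_nonneg.2 (ceil_two_pow_mono h m))
  linarith

theorem dyadicJump_mono : Monotone dyadicJump := fun a b h => by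
  linarith [sub_le_dyadicJump_sub h]

theorem antilipschitz_dyadicJump : AntilipschitzWith 1 dyadicJump := by
  refine AntilipschitzWith.of_le_mul_dist fun a b => ?_
  rw [NNReal.coe_one, one_mul, Real.dist_eq, Real.dist_eq]
  rcases le_total a b with h | h
  · rw [abs_sub_comm, abs_of_nonneg (sub_nonneg.2 h), abs_sub_comm,
      abs_of_nonneg (sub_nonneg.2 (dyadicJump_mono h))]
    exact sub_le_dyadicJump_sub h
  · rw [abs_of_nonneg (sub_nonneg.2 h), abs_of_nonneg (sub_nonneg.2 (dyadicJump_mono h))]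
    exact sub_le_dyadicJump_sub h

theorem le_volume_image_dyadicJump (a b : ℝ) :
    ENNReal.ofReal (b - a) ≤ volume (dyadicJump '' Icc a b) := by
  have := antilipschitz_dyadicJump.le_hausdorffMeasure_image (d := 1) zero_le_one (Icc a b)
  rw [hausdorffMeasure_real] at this
  simpa using this

/-- On at least one side of every point, `dyadicJump` grows at most linearly at scale `ρ`. -/
theorem dyadicJump_one_sided (t : ℝ) {ρ : ℝ} (hρ : 0 < ρ) :
    dyadicJump (t + ρ) - dyadicJump t ≤ 11 * ρ ∨ dyadicJump t - dyadicJump (t - ρ) ≤ 11 * ρ := by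
  have key : ∀ a : ℝ, (∀ m : ℕ, 2 ^ m * ρ < 1 / 4 → ⌈(2 : ℝ) ^ m * (a + ρ)⌉ ≤ ⌈(2 : ℝ) ^ m * a⌉) →
      dyadicJump (a + ρ) - dyadicJump a ≤ 11 * ρ := by
    intro a ha
    rw [dyadicJump_sub]
    have h1 : ∑' m : ℕ, (1 / 4 : ℝ) ^ m * (⌈(2 : ℝ) ^ m * (a + ρ)⌉ - ⌈(2 : ℝ) ^ m * a⌉ : ℝ) ≤
        ∑' m : ℕ, (1 / 2 : ℝ) ^ m * (5 * ρ) := by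
      refine (summable_dyadicJump_sub _ _).tsum_le_tsum (fun m => ?_)
        ((summable_geometric_of_lt_one (by norm_num) (by norm_num)).mul_right _)
      rw [← four_two_pow, mul_assoc]
      refine mul_le_mul_of_nonneg_left ?_ (by positivity)
      by_cases hm : 2 ^ m * ρ < 1 / 4
      · have h2 : (⌈(2 : ℝ) ^ m * (a + ρ)⌉ : ℝ) ≤ ⌈(2 : ℝ) ^ m * a⌉ := by exact_mod_cast ha m hm
        have : 0 ≤ (2 : ℝ) ^ m * (5 * ρ) := by positivity
        linarith
      · have := ceil_two_pow_sub_le a (a + ρ) m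
        push Not at hm
        linarith
    rw [tsum_mul_right, tsum_geometric_of_lt_one (by norm_num) (by norm_num)] at h1
    linarith
  by_cases h : ∀ m : ℕ, 2 ^ m * ρ < 1 / 4 → ⌈(2 : ℝ) ^ m * (t + ρ)⌉ ≤ ⌈(2 : ℝ) ^ m * t⌉
  · exact Or.inl (key t h)
  · right
    push Not at h
    obtain ⟨m, hm, hlt⟩ := h
    have := key (t - ρ) ?_
    · simpa using this
    intro n hn
    by_contra! hlt'
    rw [sub_add_cancel] at hlt'
    rw [Int.lt_ceil] at hlt hlt'
    have e1 := Int.le_ceil ((2 : ℝ) ^ m * t)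
    have e2 := Int.le_ceil ((2 : ℝ) ^ n * (t - ρ))
    generalize ⌈(2 : ℝ) ^ m * t⌉ = i at *
    generalize ⌈(2 : ℝ) ^ n * (t - ρ)⌉ = j at *
    rcases le_total n m with hnm | hnm
    · obtain ⟨d, rfl⟩ := Nat.exists_eq_add_of_le hnm
      have p1 : (0 : ℝ) < 2 ^ d := by positivity
      have h1 : (2 : ℝ) ^ d * j < i := by
        have := mul_lt_mul_of_pos_left hlt' p1
        calc (2 : ℝ) ^ d * j < 2 ^ d * (2 ^ n * t) := this
          _ = 2 ^ (n + d) * t := by ring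
          _ ≤ i := e1
      have h2 : (i : ℝ) < 2 ^ d * j + 1 := by
        have := mul_le_mul_of_nonneg_left e2 p1.le
        have e : (2 : ℝ) ^ d * (2 ^ n * (t - ρ)) = 2 ^ (n + d) * (t - ρ) := by ring
        rw [e] at this
        linarith
      have h1' : 2 ^ d * j < i := by exact_mod_cast h1
      have h2' : i < 2 ^ d * j + 1 := by exact_mod_cast h2
      omega
    · obtain ⟨d, rfl⟩ := Nat.exists_eq_add_of_le hnm
      have p1 : (0 : ℝ) < 2 ^ d := by positivity
      have h1 : (j : ℝ) < 2 ^ d * i := by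
        have := mul_le_mul_of_nonneg_left e1 p1.le
        calc (j : ℝ) < 2 ^ (m + d) * t := hlt'
          _ = 2 ^ d * (2 ^ m * t) := by ring
          _ ≤ 2 ^ d * i := this
      have h2 : (2 : ℝ) ^ d * i < j + 1 := by
        have := mul_lt_mul_of_pos_left hlt p1
        have e : (2 : ℝ) ^ d * (2 ^ m * (t + ρ)) = 2 ^ (m + d) * (t + ρ) := by ring
        rw [e] at this
        linarith
      have h1' : j < 2 ^ d * i := by exact_mod_cast h1
      have h2' : 2 ^ d * i < j + 1 := by exact_mod_cast h2
      omega

theorem tsum_quarter_tail (k : ℕ) (n : ℕ → ℝ) (hn : ∀ m, m < k → n m = 0) (hk : ∀ m, k ≤ m → n m = 1) :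
    HasSum (fun m => (1 / 4 : ℝ) ^ m * n m) ((1 / 4) ^ k * (4 / 3)) := by
  rw [← hasSum_nat_add_iff' k, Finset.sum_eq_zero (fun m hm => by
    rw [hn m (Finset.mem_range.1 hm), mul_zero]), sub_zero]
  have : (fun m => (1 / 4 : ℝ) ^ (m + k) * n (m + k)) = fun m => (1 / 4) ^ k * (1 / 4) ^ m := by
    ext m; rw [hk _ (Nat.le_add_left _ _), mul_one, pow_add, mul_comm]
  rw [this]
  refine HasSum.mul_left _ ?_
  have := hasSum_geometric_of_lt_one (r := (1 / 4 : ℝ)) (by norm_num) (by norm_num)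
  norm_num at this ⊢
  exact this

theorem dyadicJump_gap (k : ℕ) (j : ℤ) {q t : ℝ} (hq : 2 ^ k * q = j) (ht : q < t) :
    dyadicJump q + (1 / 4) ^ k * (4 / 3) ≤ dyadicJump t := by
  have h0 := dyadicJump_sub q t
  have h1 := (tsum_quarter_tail k (fun m => if m < k then 0 else 1) (fun m hm => if_pos hm)
    (fun m hm => if_neg (by omega)))
  have h2 := h1.summable.tsum_le_tsum (fun m => ?_) (summable_dyadicJump_sub q t)
  · rw [h1.tsum_eq] at h2
    linarith
  refine mul_le_mul_of_nonneg_left ?_ (by positivity)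
  split_ifs with hm
  · exact sub_nonneg.2 (ceil_two_pow_mono ht.le m)
  · obtain ⟨d, rfl⟩ := Nat.exists_eq_add_of_le (not_lt.1 hm)
    have e : (2 : ℝ) ^ (k + d) * q = ((2 ^ d * j : ℤ) : ℝ) := by
      push_cast; rw [← hq]; ring
    have h3 : ⌈(2 : ℝ) ^ (k + d) * q⌉ < ⌈(2 : ℝ) ^ (k + d) * t⌉ := by
      rw [e, Int.ceil_intCast, Int.lt_ceil, ← e]
      exact mul_lt_mul_of_pos_left ht (by positivity)
    have h4 : ⌈(2 : ℝ) ^ (k + d) * q⌉ + 1 ≤ ⌈(2 : ℝ) ^ (k + d) * t⌉ := h3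
    have h5 : (⌈(2 : ℝ) ^ (k + d) * q⌉ : ℝ) + 1 ≤ ⌈(2 : ℝ) ^ (k + d) * t⌉ := by exact_mod_cast h4
    linarith

theorem disjoint_gap (k : ℕ) (j : ℤ) {q : ℝ} (hq : 2 ^ k * q = j) :
    Ioo (dyadicJump q) (dyadicJump q + (1 / 4) ^ k * (4 / 3)) ⊆ (closure (range dyadicJump))ᶜ := by
  rw [← disjoint_compl_right_iff_subset, compl_compl]
  refine Disjoint.closure_right ?_ isOpen_Ioo
  rw [Set.disjoint_left]
  rintro _ ⟨h1, h2⟩ ⟨t, rfl⟩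
  rcases le_or_gt t q with h | h
  · exact absurd (dyadicJump_mono h) (not_le.2 h1)
  · exact absurd (dyadicJump_gap k j hq h) (not_le.2 h2)

theorem dense_gaps : Dense (closure (range dyadicJump))ᶜ := by
  rw [← interior_eq_empty_iff_dense_compl, Set.eq_empty_iff_forall_notMem]
  intro x hx
  have hop : IsOpen (interior (closure (range dyadicJump))) := isOpen_interior
  obtain ⟨δ, hδ, hball⟩ := Metric.isOpen_iff.1 hop x hx
  have sub : Ioo (x - δ) (x + δ) ⊆ closure (range dyadicJump) := by
    rw [← Real.ball_eq_Ioo]; exact hball.trans interior_subset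
  have pick : ∀ y ε : ℝ, 0 < ε → Ioo (y - ε) (y + ε) ⊆ Ioo (x - δ) (x + δ) →
      ∃ t, dyadicJump t ∈ Ioo (y - ε) (y + ε) := by
    intro y ε hε hs
    have hy : y ∈ closure (range dyadicJump) := sub (hs ⟨by linarith, by linarith⟩)
    obtain ⟨_, ⟨t, rfl⟩, ht⟩ := Metric.mem_closure_iff.1 hy ε hε
    rw [Real.dist_eq, abs_lt] at ht
    exact ⟨t, by constructor <;> linarith⟩
  obtain ⟨t, ht⟩ := pick (x - δ / 2) (δ / 2) (by linarith) (Ioo_subset_Ioo (by linarith) (by linarith))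
  obtain ⟨t', ht'⟩ := pick (x + δ / 2) (δ / 2) (by linarith) (Ioo_subset_Ioo (by linarith) (by linarith))
  have htt : t < t' := by
    by_contra! h
    have := dyadicJump_mono h
    linarith [ht.2, ht'.1]
  obtain ⟨k, hk⟩ := exists_pow_lt_of_lt_one (sub_pos.2 htt) (by norm_num : (1 / 2 : ℝ) < 1)
  have pk : (0 : ℝ) < 2 ^ k := by positivity
  have hk' : 1 < 2 ^ k * (t' - t) := by
    have := mul_lt_mul_of_pos_left hk pk
    rwa [← mul_pow, show (2 * (1 / 2) : ℝ) = 1 by norm_num, one_pow] at this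
  set j : ℤ := ⌊(2 : ℝ) ^ k * t⌋ + 1
  set q : ℝ := j / 2 ^ k
  have hq : 2 ^ k * q = j := by simp only [q]; field_simp
  have hjq : t < q ∧ q < t' := by
    have e1 := Int.lt_floor_add_one ((2 : ℝ) ^ k * t)
    have e2 := Int.floor_le ((2 : ℝ) ^ k * t)
    have e3 : (2 : ℝ) ^ k * q = ⌊(2 : ℝ) ^ k * t⌋ + 1 := by rw [hq]; push_cast [j]; rfl
    constructor
    · refine lt_of_mul_lt_mul_left ?_ pk.le
      linarith
    · refine lt_of_mul_lt_mul_left ?_ pk.le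
      linarith
  have g1 := dyadicJump_mono hjq.1.le
  have g2 := dyadicJump_gap k j hq hjq.2
  have pg : (0 : ℝ) < (1 / 4) ^ k * (4 / 3) := by positivity
  have mem : dyadicJump q + (1 / 4) ^ k * (4 / 3) / 2 ∈
      Ioo (dyadicJump q) (dyadicJump q + (1 / 4) ^ k * (4 / 3)) := by constructor <;> linarith
  refine disjoint_gap k j hq mem (sub ?_)
  constructor
  · linarith [ht.1]
  · linarith [ht'.2]

theorem dyadicJump_window (k : ℕ) {ρ : ℝ} (hk : 2 ^ k * ρ < 1) :
    dyadicJump ((1 / 2) ^ k + ρ) - dyadicJump ((1 / 2) ^ k - ρ) ≤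
      2 * ρ + (1 / 4) ^ k * (4 / 3) + 4 * ρ * (1 / 2) ^ k := by
  rw [dyadicJump_sub]
  have h1 := (tsum_quarter_tail k (fun m => if m < k then 0 else 1) (fun m hm => if_pos hm)
    (fun m hm => if_neg (by omega)))
  have h3 : HasSum (fun m : ℕ => if m < k then (0 : ℝ) else 2 * ρ * (1 / 2) ^ m)
      (4 * ρ * (1 / 2) ^ k) := by
    rw [← hasSum_nat_add_iff' k, Finset.sum_eq_zero (fun m hm => by
      rw [if_pos (Finset.mem_range.1 hm)]), sub_zero]
    have : (fun m => if m + k < k then (0 : ℝ) else 2 * ρ * (1 / 2) ^ (m + k)) =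
        fun m => (2 * ρ * (1 / 2) ^ k) * (1 / 2) ^ m := by
      ext m; rw [if_neg (by omega), pow_add]; ring
    rw [this, show 4 * ρ * (1 / 2 : ℝ) ^ k = (2 * ρ * (1 / 2) ^ k) * 2 by ring]
    exact hasSum_geometric_two.mul_left _
  have h2 := (summable_dyadicJump_sub ((1 / 2) ^ k - ρ) ((1 / 2) ^ k + ρ)).tsum_le_tsum
    (fun m => ?_) (h1.add h3).summable
  · rw [(h1.add h3).tsum_eq] at h2
    linarith
  have hone : (2 : ℝ) ^ k * (1 / 2) ^ k = 1 := by rw [← mul_pow]; norm_num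
  split_ifs with hm
  · obtain ⟨d, rfl⟩ := Nat.exists_eq_add_of_lt hm
    have pd : (1 : ℝ) ≤ 2 ^ d := one_le_pow₀ (by norm_num)
    have hx : (2 : ℝ) ^ (m + d + 1) * ((1 / 2) ^ (m + d + 1) + ρ) < 2 := by
      rw [mul_add, hone]; linarith
    have hy : 0 < (2 : ℝ) ^ (m + d + 1) * ((1 / 2) ^ (m + d + 1) - ρ) := by
      rw [mul_sub, hone]; linarith
    have pm : (0 : ℝ) < 2 ^ m := by positivity
    have c1 : ⌈(2 : ℝ) ^ m * ((1 / 2) ^ (m + d + 1) + ρ)⌉ ≤ 1 := by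
      rw [Int.ceil_le]
      set z := (1 / 2 : ℝ) ^ (m + d + 1) + ρ
      have : (2 : ℝ) ^ (m + d + 1) * z = 2 ^ d * (2 * (2 ^ m * z)) := by ring
      rw [this] at hx
      push_cast
      by_contra! hc
      nlinarith
    have c2 : 0 < ⌈(2 : ℝ) ^ m * ((1 / 2) ^ (m + d + 1) - ρ)⌉ := by
      rw [Int.ceil_pos]
      exact mul_pos pm (pos_of_mul_pos_right hy (by positivity))
    have c3 : ⌈(2 : ℝ) ^ m * ((1 / 2) ^ (m + d + 1) + ρ)⌉ ≤
      ⌈(2 : ℝ) ^ m * ((1 / 2) ^ (m + d + 1) - ρ)⌉ := by omega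
    have c4 : (⌈(2 : ℝ) ^ m * ((1 / 2) ^ (m + d + 1) + ρ)⌉ : ℝ) ≤
      ⌈(2 : ℝ) ^ m * ((1 / 2) ^ (m + d + 1) - ρ)⌉ := by exact_mod_cast c3
    rw [mul_zero, add_zero]
    exact mul_nonpos_of_nonneg_of_nonpos (by positivity) (by linarith)
  · have := ceil_two_pow_sub_le ((1 / 2) ^ k - ρ) ((1 / 2) ^ k + ρ) m
    rw [← four_two_pow m]
    have := mul_le_mul_of_nonneg_left this (by positivity : (0 : ℝ) ≤ (1 / 4) ^ m)
    linarith

/-- An open dense subset of the line whose complement has positive density at all of its points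
and all scales, and which has components that are almost isolated from the rest of the set. -/
theorem exists_fat_complement_isolated_gaps : ∃ U : Set ℝ, IsOpen U ∧ Dense U ∧ Uᶜ.Nonempty ∧
    (∃ c : ℝ, 0 < c ∧ ∀ x ∉ U, ∀ r : ℝ, 0 < r →
      ENNReal.ofReal (c * r) ≤ volume (Uᶜ ∩ Ioo (x - r) (x + r))) ∧
    ∀ R : ℝ, 0 < R → ∀ δ : ℝ, 0 < δ → ∃ a l : ℝ, 0 < l ∧ Ioo a (a + l) ⊆ U ∧ a ∉ U ∧
      volume ((U \ Ioo a (a + l)) ∩ Icc (a - R * l) (a + l + R * l)) ≤ ENNReal.ofReal (δ * l) := by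
  refine ⟨(closure (range dyadicJump))ᶜ, isClosed_closure.isOpen_compl, dense_gaps, ?_,
    ⟨1 / 44, by norm_num, ?_⟩, ?_⟩
  · rw [compl_compl]; exact (range_nonempty _).closure
  · intro x hx r hr
    rw [notMem_compl_iff] at hx
    rw [compl_compl]
    obtain ⟨_, ⟨t, rfl⟩, ht⟩ := Metric.mem_closure_iff.1 hx (r / 2) (by linarith)
    rw [Real.dist_eq, abs_lt] at ht
    have hρ : 0 < r / 44 := by positivity
    have main : ∀ a b : ℝ, b - a = r / 44 → x - r < dyadicJump a → dyadicJump b < x + r →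
        ENNReal.ofReal (1 / 44 * r) ≤
          volume (closure (range dyadicJump) ∩ Ioo (x - r) (x + r)) := by
      intro a b hab ha hb
      rw [show 1 / 44 * r = b - a by linarith]
      refine (le_volume_image_dyadicJump a b).trans (measure_mono ?_)
      rintro _ ⟨u, hu, rfl⟩
      exact ⟨subset_closure (mem_range_self u), ha.trans_le (dyadicJump_mono hu.1),
        (dyadicJump_mono hu.2).trans_lt hb⟩
    rcases dyadicJump_one_sided t hρ with h | h
    · exact main t (t + r / 44) (by ring) (by linarith) (by linarith)
    · exact main (t - r / 44) t (by ring) (by linarith) (by linarith)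
  · intro R hR δ hδ
    obtain ⟨k, hk⟩ := exists_pow_lt_of_lt_one
      (show 0 < min (1 / (2 * R)) (δ / (4 * R)) by positivity) (by norm_num : (1 / 2 : ℝ) < 1)
    have hk1 := hk.trans_le (min_le_left _ _)
    have hk2 := hk.trans_le (min_le_right _ _)
    rw [lt_div_iff₀ (by positivity)] at hk1 hk2
    have hone : (2 : ℝ) ^ k * (1 / 2) ^ k = 1 := by rw [← mul_pow]; norm_num
    set q : ℝ := (1 / 2) ^ k with hqdef
    set l : ℝ := (1 / 4) ^ k * (4 / 3) with hl
    have lpos : 0 < l := by positivity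
    have hl2 : 2 ^ k * l = q * (4 / 3) := by
      rw [hl, hqdef, ← four_two_pow]; ring
    have gap := disjoint_gap k 1 (q := q) (by rw [hone]; norm_num)
    refine ⟨dyadicJump q, l, lpos, gap, fun h => h (subset_closure (mem_range_self q)), ?_⟩
    have hw := dyadicJump_window k (ρ := R * l) (by
      rw [show (2 : ℝ) ^ k * (R * l) = R * (2 ^ k * l) by ring, hl2]; linarith)
    rw [← hqdef, ← hl] at hw
    set F := closure (range dyadicJump)
    set A := dyadicJump (q - R * l)
    set B := dyadicJump (q + R * l)
    have hA : A ≤ dyadicJump q - R * l := by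
      have := sub_le_dyadicJump_sub (show q - R * l ≤ q by nlinarith)
      linarith
    have hB : dyadicJump q + l + R * l ≤ B := by
      by_contra! hcon
      have h1 : ∀ t, q < t → t ≤ q + R * l → dyadicJump q + l ≤ dyadicJump t :=
        fun t ht _ => dyadicJump_gap k 1 (by rw [hone]; norm_num) ht
      set η := dyadicJump q + l + R * l - B with hη
      have hηp : 0 < η := by simp only [hη]; linarith
      set t := q + min (η / 2) (R * l)
      have ht1 : q < t := by
        have : 0 < min (η / 2) (R * l) := lt_min (by linarith) (by positivity)
        simp only [t]; linarith
      have ht2 : t ≤ q + R * l := by have := min_le_right (η / 2) (R * l); simp only [t]; linarith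
      have ht3 : t ≤ q + η / 2 := by have := min_le_left (η / 2) (R * l); simp only [t]; linarith
      have h2 := h1 t ht1 ht2
      have h3 := sub_le_dyadicJump_sub ht2
      linarith
    have hsub : (Fᶜ \ Ioo (dyadicJump q) (dyadicJump q + l)) ∩
        Icc (dyadicJump q - R * l) (dyadicJump q + l + R * l) ⊆
        Icc A B \ ((F ∩ Icc A B) ∪ Ioo (dyadicJump q) (dyadicJump q + l)) := by
      rintro x ⟨⟨h1, h2⟩, h3, h4⟩
      refine ⟨⟨by linarith, by linarith⟩, ?_⟩
      rintro (h | h)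
      · exact h1 h.1
      · exact h2 h
    have hFm : MeasurableSet (F ∩ Icc A B) := isClosed_closure.measurableSet.inter measurableSet_Icc
    have hFv : ENNReal.ofReal (2 * (R * l)) ≤ volume (F ∩ Icc A B) := by
      rw [show 2 * (R * l) = (q + R * l) - (q - R * l) by ring]
      refine (le_volume_image_dyadicJump _ _).trans (measure_mono ?_)
      rintro _ ⟨u, hu, rfl⟩
      exact ⟨subset_closure (mem_range_self u), dyadicJump_mono hu.1, dyadicJump_mono hu.2⟩
    have hRl : 0 < R * l := by positivity
    have hdis : Disjoint (F ∩ Icc A B) (Ioo (dyadicJump q) (dyadicJump q + l)) :=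
      Set.disjoint_left.2 fun x hx hx' => gap hx' hx.1
    have hun : ENNReal.ofReal (2 * (R * l) + l) ≤
        volume ((F ∩ Icc A B) ∪ Ioo (dyadicJump q) (dyadicJump q + l)) := by
      rw [measure_union hdis measurableSet_Ioo, Real.volume_Ioo, add_sub_cancel_left,
        ENNReal.ofReal_add (by positivity) lpos.le]
      gcongr
    have hunsub : (F ∩ Icc A B) ∪ Ioo (dyadicJump q) (dyadicJump q + l) ⊆ Icc A B := by
      refine union_subset inter_subset_right fun x hx => ⟨?_, ?_⟩ <;> linarith [hx.1, hx.2]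
    refine (measure_mono hsub).trans ?_
    rw [measure_sdiff hunsub (hFm.union measurableSet_Ioo).nullMeasurableSet
      (measure_ne_top_of_subset hunsub (by simp)), Real.volume_Icc]
    refine (tsub_le_tsub_left hun _).trans ?_
    rw [← ENNReal.ofReal_sub _ (by positivity)]
    refine ENNReal.ofReal_le_ofReal ?_
    nlinarith

theorem lintegral_comp_add_smul {E : Type*} [NormedAddCommGroup E] [NormedSpace ℝ E]
    [MeasurableSpace E] [BorelSpace E] [FiniteDimensional ℝ E] (μ : Measure E)
    [μ.IsAddHaarMeasure] (f : E → ℝ≥0∞) (x₀ : E) {r : ℝ} (hr : 0 < r) :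
    ∫⁻ z, f (x₀ + r • z) ∂μ = ENNReal.ofReal ((r ^ Module.finrank ℝ E)⁻¹) * ∫⁻ x, f x ∂μ := by
  have h1 := (Homeomorph.smulOfNeZero r hr.ne' : E ≃ₜ E).measurableEmbedding.lintegral_map
    (μ := μ) (fun x => f (x₀ + x))
  have h2 : Measure.map (Homeomorph.smulOfNeZero r hr.ne' : E ≃ₜ E) μ =
      ENNReal.ofReal |(r ^ Module.finrank ℝ E)⁻¹| • μ := Measure.map_addHaar_smul μ hr.ne'
  rw [h2, lintegral_smul_measure, abs_of_pos (by positivity)] at h1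
  rw [lintegral_add_left_eq_self (μ := μ) f x₀] at h1
  simpa using h1.symm

theorem lintegral_eq_comp_add_smul {E : Type*} [NormedAddCommGroup E] [NormedSpace ℝ E]
    [MeasurableSpace E] [BorelSpace E] [FiniteDimensional ℝ E] (μ : Measure E)
    [μ.IsAddHaarMeasure] (f : E → ℝ≥0∞) (x₀ : E) {r : ℝ} (hr : 0 < r) :
    ∫⁻ x, f x ∂μ = ENNReal.ofReal (r ^ Module.finrank ℝ E) * ∫⁻ z, f (x₀ + r • z) ∂μ := by
  rw [lintegral_comp_add_smul μ f x₀ hr, ← mul_assoc, ← ENNReal.ofReal_mul (by positivity),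
    mul_inv_cancel₀ (by positivity), ENNReal.ofReal_one, one_mul]

/-- The Riesz potential of the indicator function of the ball `B(x₀,r)`. -/
def ballPotential (s : ℝ) (x₀ : Euc 2) (r : ℝ) (y : Euc 2) : ℝ≥0∞ :=
  ∫⁻ x in ball x₀ r, ENNReal.ofReal (dist x y ^ (s - 2))

theorem ballPotential_scale {s : ℝ} (x₀ : Euc 2) {r : ℝ} (hr : 0 < r) (z : Euc 2) :
    ballPotential s x₀ r (x₀ + r • z) = ENNReal.ofReal (r ^ s) * ballPotential s 0 1 z := by
  unfold ballPotential
  rw [← lintegral_indicator measurableSet_ball, ← lintegral_indicator measurableSet_ball,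
    lintegral_eq_comp_add_smul volume _ x₀ hr, ← lintegral_const_mul' _ _ ENNReal.ofReal_ne_top,
    ← lintegral_const_mul' _ _ ENNReal.ofReal_ne_top]
  refine lintegral_congr fun w => ?_
  have hmem : x₀ + r • w ∈ ball x₀ r ↔ w ∈ ball (0 : Euc 2) 1 := by
    rw [mem_ball, mem_ball, dist_eq_norm, dist_eq_norm, add_sub_cancel_left, sub_zero, norm_smul,
      Real.norm_of_nonneg hr.le]
    constructor <;> intro h <;> nlinarith
  have hd : dist (x₀ + r • w) (x₀ + r • z) = r * dist w z := by
    rw [dist_add_left, dist_smul₀, Real.norm_of_nonneg hr.le]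
  by_cases h : w ∈ ball (0 : Euc 2) 1
  · rw [indicator_of_mem h, indicator_of_mem (hmem.2 h), hd, ← ENNReal.ofReal_mul (by positivity),
      ← ENNReal.ofReal_mul (by positivity), Real.mul_rpow hr.le dist_nonneg, ← mul_assoc]
    congr 2
    rw [finrank_euclideanSpace_fin, ← Real.rpow_natCast, ← Real.rpow_add hr]
    congr 1
    push_cast; ring
  · rw [indicator_of_notMem h, indicator_of_notMem (mt hmem.1 h), mul_zero, mul_zero]

theorem ballPotential_le {s : ℝ} (hs0 : 0 < s) (hs1 : s < 1) : ∃ C : ℝ≥0∞, C ≠ ⊤ ∧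
    ∀ z, ballPotential s 0 1 z ≤ C * ENNReal.ofReal ((1 + ‖z‖) ^ (s - 2)) := by
  set M : ℝ≥0∞ := ∫⁻ w in ball (0 : Euc 2) 3, ENNReal.ofReal (‖w‖ ^ (s - 2)) with hM
  have hMfin : M ≠ ⊤ := by
    have : IntegrableOn (fun w : Euc 2 => ‖w‖ ^ (s - 2)) (ball 0 3) volume := by
      refine integrableOn_ball_of_norm_le_rpow (C := 1) (α := 2 - s) ?_ ?_ ?_ ?_
      · rw [finrank_euclideanSpace_fin]; norm_num
      · rw [finrank_euclideanSpace_fin]; push_cast; linarith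
      · refine Filter.Eventually.of_forall fun x => ?_
        rw [Real.norm_of_nonneg (by positivity), one_mul, neg_sub]
      · exact (measurable_norm.pow_const _).aestronglyMeasurable
    exact this.lintegral_lt_top.ne
  refine ⟨ENNReal.ofReal (3 ^ (2 - s)) * (M + volume (ball (0 : Euc 2) 1)),
    ENNReal.mul_ne_top ENNReal.ofReal_ne_top (ENNReal.add_ne_top.2 ⟨hMfin, measure_ball_lt_top.ne⟩),
    fun z => ?_⟩
  rcases le_or_gt ‖z‖ 2 with hz | hz
  · have h1 : ballPotential s 0 1 z ≤ M := by
      unfold ballPotential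
      calc ∫⁻ x in ball (0 : Euc 2) 1, ENNReal.ofReal (dist x z ^ (s - 2))
          ≤ ∫⁻ x in ball z 3, ENNReal.ofReal (dist x z ^ (s - 2)) := by
            refine lintegral_mono_set fun x hx => ?_
            rw [mem_ball_zero_iff] at hx
            rw [mem_ball, dist_eq_norm]
            linarith [norm_sub_le x z]
        _ = M := by
            rw [hM, ← lintegral_indicator measurableSet_ball, ← lintegral_indicator measurableSet_ball,
              ← lintegral_add_left_eq_self _ z]
            refine lintegral_congr fun w => ?_
            have : z + w ∈ ball z 3 ↔ w ∈ ball (0 : Euc 2) 3 := by simp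
            by_cases h : w ∈ ball (0 : Euc 2) 3
            · rw [indicator_of_mem h, indicator_of_mem (this.2 h), dist_eq_norm, add_sub_cancel_left]
            · rw [indicator_of_notMem h, indicator_of_notMem (mt this.1 h)]
    have h2 : (1 : ℝ≥0∞) ≤ ENNReal.ofReal (3 ^ (2 - s)) * ENNReal.ofReal ((1 + ‖z‖) ^ (s - 2)) := by
      rw [← ENNReal.ofReal_mul (by positivity), ENNReal.one_le_ofReal,
        show s - 2 = -(2 - s) by ring, Real.rpow_neg (by positivity), ← div_eq_mul_inv,
        one_le_div (by positivity)]
      exact Real.rpow_le_rpow (by positivity) (by linarith) (by linarith)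
    calc ballPotential s 0 1 z ≤ M := h1
      _ ≤ (M + volume (ball (0 : Euc 2) 1)) * 1 := by rw [mul_one]; exact le_self_add
      _ ≤ (M + volume (ball (0 : Euc 2) 1)) *
          (ENNReal.ofReal (3 ^ (2 - s)) * ENNReal.ofReal ((1 + ‖z‖) ^ (s - 2))) := by gcongr
      _ = _ := by ring
  · have h1 : ballPotential s 0 1 z ≤ ENNReal.ofReal (3 ^ (2 - s) * (1 + ‖z‖) ^ (s - 2)) *
        volume (ball (0 : Euc 2) 1) := by
      unfold ballPotential
      rw [← setLIntegral_const]
      refine setLIntegral_mono' measurableSet_ball fun x hx => ENNReal.ofReal_le_ofReal ?_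
      rw [mem_ball_zero_iff] at hx
      have hd : (1 + ‖z‖) / 3 ≤ dist x z := by
        rw [dist_comm, dist_eq_norm]
        linarith [norm_sub_norm_le z x]
      calc dist x z ^ (s - 2) ≤ ((1 + ‖z‖) / 3) ^ (s - 2) :=
            Real.rpow_le_rpow_of_nonpos (by positivity) hd (by linarith)
        _ = _ := by
            rw [Real.div_rpow (by positivity) (by norm_num), show s - 2 = -(2 - s) by ring,
              Real.rpow_neg (by norm_num : (0 : ℝ) ≤ 3), div_inv_eq_mul, mul_comm]
    refine h1.trans ?_
    rw [ENNReal.ofReal_mul (by positivity)]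
    calc _ = ENNReal.ofReal (3 ^ (2 - s)) * volume (ball (0 : Euc 2) 1) *
          ENNReal.ofReal ((1 + ‖z‖) ^ (s - 2)) := by ring
      _ ≤ _ := by gcongr; exact le_add_self

theorem measurable_ballPotential (s : ℝ) (x₀ : Euc 2) (r : ℝ) :
    Measurable (ballPotential s x₀ r) := by
  unfold ballPotential
  refine Measurable.lintegral_prod_left' (f := fun z : Euc 2 × Euc 2 =>
    ENNReal.ofReal (dist z.1 z.2 ^ (s - 2))) ?_
  fun_prop

theorem lintegral_ballPotential_rpow_ne_top {s q : ℝ} (hs0 : 0 < s) (hs1 : s < 1) (hq0 : 0 < q)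
    (hq : 2 < (2 - s) * q) : ∫⁻ z, ballPotential s 0 1 z ^ q ≠ ⊤ := by
  obtain ⟨C, hC, h⟩ := ballPotential_le hs0 hs1
  have h1 : ∫⁻ z, ballPotential s 0 1 z ^ q ≤
      ∫⁻ z : Euc 2, C ^ q * ENNReal.ofReal ((1 + ‖z‖) ^ (-((2 - s) * q))) := by
    refine lintegral_mono fun z => ?_
    calc ballPotential s 0 1 z ^ q ≤ (C * ENNReal.ofReal ((1 + ‖z‖) ^ (s - 2))) ^ q :=
          ENNReal.rpow_le_rpow (h z) hq0.le
      _ = _ := by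
        rw [ENNReal.mul_rpow_of_nonneg _ _ hq0.le, ENNReal.ofReal_rpow_of_nonneg (by positivity) hq0.le,
          ← Real.rpow_mul (by positivity)]
        congr 4
        ring
  refine ne_top_of_le_ne_top ?_ h1
  rw [lintegral_const_mul' _ _ (ENNReal.rpow_ne_top_of_nonneg hq0.le hC)]
  refine ENNReal.mul_ne_top (ENNReal.rpow_ne_top_of_nonneg hq0.le hC) ?_
  refine (finite_integral_one_add_norm (μ := (volume : Measure (Euc 2))) ?_).ne
  rw [finrank_euclideanSpace_fin]
  exact_mod_cast hq

theorem lintegral_ballPotential_scale {s q : ℝ} (hq0 : 0 < q) (x₀ : Euc 2) {r : ℝ} (hr : 0 < r) :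
    ∫⁻ y, ballPotential s x₀ r y ^ q =
      ENNReal.ofReal (r ^ (2 + s * q)) * ∫⁻ z, ballPotential s 0 1 z ^ q := by
  rw [lintegral_eq_comp_add_smul volume _ x₀ hr]
  simp only [ballPotential_scale x₀ hr, ENNReal.mul_rpow_of_nonneg _ _ hq0.le]
  rw [lintegral_const_mul' _ _ (ENNReal.rpow_ne_top_of_nonneg hq0.le ENNReal.ofReal_ne_top),
    ← mul_assoc, ENNReal.ofReal_rpow_of_nonneg (by positivity) hq0.le, ← Real.rpow_mul hr.le,
    ← ENNReal.ofReal_mul (by positivity), finrank_euclideanSpace_fin, ← Real.rpow_natCast,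
    ← Real.rpow_add hr]
  norm_num

/-- A measurable planar set with positive Lebesgue density at all of its points and scales is
uniformly fat. -/
theorem uniformlyFat_of_volume {s p : ℝ} (hp1 : 1 < p) (hs0 : 0 < s) (hs1 : s < 1)
    (hsp : s * p < 2) {E : Set (Euc 2)} (hE : MeasurableSet E) {c : ℝ} (hc : 0 < c)
    (h : ∀ x ∈ E, ∀ r : ℝ, 0 < r → ENNReal.ofReal (c * r ^ 2) ≤ volume (ball x r ∩ E)) :
    UniformlyFat 2 s p E := by
  have hpq : p.HolderConjugate (p / (p - 1)) := Real.HolderConjugate.conjExponent hp1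
  set q := p / (p - 1) with hqdef
  have hp1' : 0 < p - 1 := by linarith
  have hq0 : 0 < q := hpq.symm.pos
  have hqp : q * (p - 1) = p := by rw [hqdef]; field_simp
  set κ := ∫⁻ z, ballPotential s 0 1 z ^ q with hκ
  have hκfin : κ ≠ ⊤ := by
    refine lintegral_ballPotential_rpow_ne_top hs0 hs1 hq0 ?_
    rw [hqdef, ← mul_div_assoc, lt_div_iff₀ hp1']
    nlinarith
  set k := κ.toReal + 1
  have hk : 0 < k := by positivity
  have hκk : κ ≤ ENNReal.ofReal k := by
    rw [← ENNReal.ofReal_toReal hκfin]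
    exact ENNReal.ofReal_le_ofReal (by simp only [k]; linarith)
  refine ⟨c ^ p / k ^ (p - 1), by positivity, fun x hx r hr => ?_⟩
  refine le_iInf fun f => le_iInf fun hf => le_iInf fun hf0 => le_iInf fun hf1 => ?_
  set N := ∫⁻ x, ENNReal.ofReal (f x ^ p) with hN
  have hN' : ∫⁻ x, ENNReal.ofReal (f x) ^ p = N := lintegral_congr fun x => by
    rw [ENNReal.ofReal_rpow_of_nonneg (hf0 x) (by linarith)]
  have hmeas : MeasurableSet (ball x r ∩ E) := measurableSet_ball.inter hE
  have h1 : ENNReal.ofReal (c * r ^ 2) ≤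
      N ^ (1 / p) * (ENNReal.ofReal (r ^ (2 + s * q)) * κ) ^ (1 / q) := by
    calc ENNReal.ofReal (c * r ^ 2) ≤ volume (ball x r ∩ E) := h x hx r hr
      _ = ∫⁻ z in ball x r ∩ E, 1 := by simp
      _ ≤ ∫⁻ z in ball x r ∩ E, ∫⁻ y, ENNReal.ofReal (f y) *
            ENNReal.ofReal (dist z y ^ (s - 2)) :=
          setLIntegral_mono' hmeas fun z hz => by exact_mod_cast hf1 z hz
      _ ≤ ∫⁻ z in ball x r, ∫⁻ y, ENNReal.ofReal (f y) * ENNReal.ofReal (dist z y ^ (s - 2)) :=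
          lintegral_mono_set inter_subset_left
      _ = ∫⁻ y, ∫⁻ z in ball x r, ENNReal.ofReal (f y) * ENNReal.ofReal (dist z y ^ (s - 2)) := by
          refine lintegral_lintegral_swap (Measurable.aemeasurable ?_)
          unfold Function.uncurry
          fun_prop
      _ = ∫⁻ y, ((fun y => ENNReal.ofReal (f y)) * ballPotential s x r) y := by
          refine lintegral_congr fun y => ?_
          rw [lintegral_const_mul' _ _ ENNReal.ofReal_ne_top]
          rfl
      _ ≤ _ := by
          refine (ENNReal.lintegral_mul_le_Lp_mul_Lq volume hpq hf.ennreal_ofReal.aemeasurable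
            (measurable_ballPotential s x r).aemeasurable).trans_eq ?_
          rw [hN', lintegral_ballPotential_scale hq0 x hr]
  have h2 : ENNReal.ofReal ((c * r ^ 2) ^ p) ≤
      N * ENNReal.ofReal ((r ^ (2 + s * q) * k) ^ (p - 1)) := by
    have := ENNReal.rpow_le_rpow h1 (by linarith : 0 ≤ p)
    rw [ENNReal.ofReal_rpow_of_nonneg (by positivity) (by linarith),
      ENNReal.mul_rpow_of_nonneg _ _ (by linarith), ← ENNReal.rpow_mul, ← ENNReal.rpow_mul,
      one_div_mul_cancel (by linarith), ENNReal.rpow_one,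
      show 1 / q * p = p - 1 by rw [one_div_mul_eq_div, div_eq_iff hq0.ne']; linarith] at this
    refine this.trans (mul_le_mul_right ?_ N)
    rw [← ENNReal.ofReal_rpow_of_nonneg (by positivity) hp1'.le, ENNReal.ofReal_mul (by positivity)]
    gcongr
  have hpos : 0 < (r ^ (2 + s * q) * k) ^ (p - 1) := by positivity
  refine (ENNReal.mul_le_mul_iff_left (ENNReal.ofReal_pos.2 hpos).ne'
    ENNReal.ofReal_ne_top).1 (le_trans (le_of_eq ?_) h2)
  rw [← ENNReal.ofReal_mul (by positivity)]
  congr 1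
  rw [Real.mul_rpow (by positivity) hk.le, Real.mul_rpow hc.le (by positivity),
    ← Real.rpow_mul hr.le, ← Real.rpow_natCast r 2, ← Real.rpow_mul hr.le]
  have : (2 + s * q) * (p - 1) = 2 * (p - 1) + s * p := by rw [add_mul, mul_assoc, hqp]
  rw [this]
  calc c ^ p / k ^ (p - 1) * r ^ (((2 : ℕ) : ℝ) - s * p) * (r ^ (2 * (p - 1) + s * p) * k ^ (p - 1))
      = c ^ p * (k ^ (p - 1) / k ^ (p - 1)) *
        (r ^ (((2 : ℕ) : ℝ) - s * p) * r ^ (2 * (p - 1) + s * p)) := by ring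
    _ = c ^ p * r ^ (((2 : ℕ) : ℝ) * p) := by
        rw [div_self (by positivity), mul_one, ← Real.rpow_add hr]
        congr 2
        push_cast; ring

theorem lintegral_real_scale (f : ℝ → ℝ≥0∞) (t : ℝ) {r : ℝ} (hr : 0 < r) :
    ∫⁻ x, f x = ENNReal.ofReal r * ∫⁻ z, f (t + r * z) := by
  simpa using lintegral_eq_comp_add_smul volume f t hr

/-- Integrals of functions that are dominated by a rescaled copy of a fixed integrable function
are controlled by the corresponding power of the scale. -/
theorem exists_bound_of_scaling {g : ℝ → ℝ≥0∞} (hg : ∫⁻ z, g z ≠ ⊤) (β : ℝ) :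
    ∃ m : ℝ, 0 < m ∧ ∀ (f : ℝ → ℝ≥0∞) (t r : ℝ), 0 < r →
      (∀ z, f (t + r * z) ≤ ENNReal.ofReal (r ^ β) * g z) →
      ∫⁻ x, f x ≤ ENNReal.ofReal (m * r ^ (1 + β)) := by
  refine ⟨(∫⁻ z, g z).toReal + 1, by positivity, fun f t r hr h => ?_⟩
  rw [lintegral_real_scale f t hr]
  calc ENNReal.ofReal r * ∫⁻ z, f (t + r * z)
      ≤ ENNReal.ofReal r * ∫⁻ z, ENNReal.ofReal (r ^ β) * g z := by gcongr with z; exact h z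
    _ = ENNReal.ofReal (r ^ (1 + β)) * ENNReal.ofReal (∫⁻ z, g z).toReal := by
        rw [lintegral_const_mul' _ _ ENNReal.ofReal_ne_top, ← mul_assoc,
          ← ENNReal.ofReal_mul hr.le, ENNReal.ofReal_toReal hg, Real.rpow_add hr, Real.rpow_one]
    _ ≤ _ := by
        rw [← ENNReal.ofReal_mul (by positivity)]
        refine ENNReal.ofReal_le_ofReal ?_
        rw [mul_comm]
        have : 0 ≤ r ^ (1 + β) := by positivity
        nlinarith

theorem lintegral_tail_ne_top {α : ℝ} (hα : 0 < α) :
    ∫⁻ z : ℝ, ENNReal.ofReal (2 ^ (1 + α) * (1 + |z|) ^ (-(1 + α))) ≠ ⊤ := by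
  have h := (finite_integral_one_add_norm (μ := (volume : Measure ℝ)) (r := 1 + α)
    (by simp; linarith)).ne
  simp_rw [ENNReal.ofReal_mul (by positivity : (0 : ℝ) ≤ 2 ^ (1 + α))]
  rw [lintegral_const_mul' _ _ ENNReal.ofReal_ne_top]
  exact ENNReal.mul_ne_top ENNReal.ofReal_ne_top h

theorem one_div_rpow_le_tail {α : ℝ} (hα : 0 < α) {z : ℝ} (hz : 1 ≤ |z|) :
    1 / |z| ^ (1 + α) ≤ 2 ^ (1 + α) * (1 + |z|) ^ (-(1 + α)) := by
  have e : 1 / |z| ^ (1 + α) = (1 / |z|) ^ (1 + α) := by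
    rw [Real.div_rpow zero_le_one (abs_nonneg _), Real.one_rpow]
  rw [e, Real.rpow_neg (by positivity), ← div_eq_mul_inv,
    ← Real.div_rpow (by norm_num) (by positivity)]
  refine Real.rpow_le_rpow (by positivity) ?_ (by linarith)
  rw [div_le_div_iff₀ (by positivity) (by positivity)]
  linarith

theorem abs_sub_add_mul (t z : ℝ) {r : ℝ} (hr : 0 < r) : |t - (t + r * z)| = r * |z| := by
  rw [sub_add_cancel_left, abs_neg, abs_mul, abs_of_pos hr]

theorem exists_far_bound {α : ℝ} (hα : 0 < α) : ∃ m : ℝ, 0 < m ∧ ∀ D : ℝ, 0 < D → ∀ t : ℝ,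
    ∫⁻ τ in {τ | D ≤ |t - τ|}, ENNReal.ofReal (1 / |t - τ| ^ (1 + α)) ≤
      ENNReal.ofReal (m * D ^ (-α)) := by
  obtain ⟨m, hm, h⟩ := exists_bound_of_scaling (lintegral_tail_ne_top hα) (-(1 + α))
  refine ⟨m, hm, fun D hD t => ?_⟩
  have hms : MeasurableSet {τ : ℝ | D ≤ |t - τ|} := measurableSet_le (by fun_prop) (by fun_prop)
  rw [← lintegral_indicator hms, show -α = 1 + -(1 + α) by ring]
  refine h _ t D hD fun z => ?_
  by_cases hz : t + D * z ∈ {τ : ℝ | D ≤ |t - τ|}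
  · rw [indicator_of_mem hz]
    rw [mem_ofPred_eq, abs_sub_add_mul t z hD] at hz
    have hz1 : 1 ≤ |z| := by nlinarith
    rw [abs_sub_add_mul t z hD, ← ENNReal.ofReal_mul (by positivity)]
    refine ENNReal.ofReal_le_ofReal ?_
    rw [Real.mul_rpow hD.le (abs_nonneg z), one_div, mul_inv, ← Real.rpow_neg hD.le]
    gcongr
    rw [← one_div]
    exact one_div_rpow_le_tail hα hz1
  · rw [indicator_of_notMem hz]
    exact zero_le

theorem exists_lipschitz_bound {α p : ℝ} (hα : 0 < α) (hαp : α < p) :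
    ∃ m : ℝ, 0 < m ∧ ∀ L : ℝ, 0 < L → ∀ t : ℝ,
    ∫⁻ τ, ENNReal.ofReal (min 1 (L * |t - τ|) ^ p / |t - τ| ^ (1 + α)) ≤
      ENNReal.ofReal (m * L ^ α) := by
  have hfin : ∫⁻ z : ℝ, ENNReal.ofReal (min 1 |z| ^ p / |z| ^ (1 + α)) ≠ ⊤ := by
    rw [← lintegral_add_compl _ (measurableSet_ball : MeasurableSet (ball (0 : ℝ) 1))]
    refine ENNReal.add_ne_top.2 ⟨?_, ?_⟩
    · have : IntegrableOn (fun z : ℝ => min 1 |z| ^ p / |z| ^ (1 + α)) (ball 0 1) volume := by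
        refine integrableOn_ball_of_norm_le_rpow (C := 1) (α := 1 + α - p) ?_ ?_ ?_ ?_
        · simp
        · simp; linarith
        · refine (ae_restrict_iff' measurableSet_ball).2 (Filter.Eventually.of_forall fun x hx => ?_)
          rw [mem_ball_zero_iff, Real.norm_eq_abs] at hx
          rw [Real.norm_of_nonneg (by positivity), min_eq_right hx.le, one_mul, Real.norm_eq_abs,
            neg_sub]
          rcases eq_or_ne x 0 with rfl | h0
          · rw [abs_zero, Real.zero_rpow (by linarith), zero_div]
            positivity
          · rw [← Real.rpow_sub (abs_pos.2 h0)]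
        · exact Measurable.aestronglyMeasurable (by fun_prop)
      exact this.lintegral_lt_top.ne
    · refine ne_top_of_le_ne_top (lintegral_tail_ne_top hα) ?_
      refine le_trans ?_ (setLIntegral_le_lintegral (ball (0 : ℝ) 1)ᶜ _)
      refine setLIntegral_mono' measurableSet_ball.compl fun z hz => ENNReal.ofReal_le_ofReal ?_
      rw [mem_compl_iff, mem_ball_zero_iff, Real.norm_eq_abs, not_lt] at hz
      rw [min_eq_left hz, Real.one_rpow]
      exact one_div_rpow_le_tail hα hz
  obtain ⟨m, hm, h⟩ := exists_bound_of_scaling hfin (-(1 + α))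
  refine ⟨m, hm, fun L hL t => ?_⟩
  have e : L ^ α = (L⁻¹) ^ (1 + -(1 + α)) := by
    rw [Real.inv_rpow hL.le, ← Real.rpow_neg hL.le]; congr 1; ring
  rw [e]
  refine h _ t L⁻¹ (by positivity) fun z => ?_
  rw [abs_sub_add_mul t z (by positivity), ← ENNReal.ofReal_mul (by positivity)]
  refine ENNReal.ofReal_le_ofReal (le_of_eq ?_)
  rw [mul_inv_cancel_left₀ hL.ne', Real.mul_rpow (by positivity) (abs_nonneg z),
    Real.rpow_neg (by positivity)]
  rw [div_eq_mul_inv, div_eq_mul_inv, mul_inv]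
  ring

theorem exists_line_bound {α : ℝ} (hα : 0 < α) : ∃ m : ℝ, 0 < m ∧ ∀ A : ℝ, 0 < A → ∀ t : ℝ,
    ∫⁻ b, ENNReal.ofReal (1 / √(A ^ 2 + (t - b) ^ 2) ^ (2 + α)) ≤
      ENNReal.ofReal (m * (1 / A ^ (1 + α))) := by
  have hfin : ∫⁻ z : ℝ, ENNReal.ofReal ((1 + ‖z‖ ^ 2) ^ (-(2 + α) / 2)) ≠ ⊤ :=
    (integrable_rpow_neg_one_add_norm_sq (μ := (volume : Measure ℝ)) (r := 2 + α)
      (by simp; linarith)).lintegral_lt_top.ne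
  obtain ⟨m, hm, h⟩ := exists_bound_of_scaling hfin (-(2 + α))
  refine ⟨m, hm, fun A hA t => ?_⟩
  have e : 1 / A ^ (1 + α) = A ^ (1 + -(2 + α)) := by
    rw [one_div, ← Real.rpow_neg hA.le]; congr 1; ring
  rw [e]
  refine h _ t A hA fun z => ?_
  rw [← ENNReal.ofReal_mul (by positivity)]
  refine ENNReal.ofReal_le_ofReal (le_of_eq ?_)
  have : A ^ 2 + (t - (t + A * z)) ^ 2 = A ^ 2 * (1 + ‖z‖ ^ 2) := by
    rw [Real.norm_eq_abs, sq_abs]; ring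
  rw [this, Real.sqrt_mul (by positivity), Real.sqrt_sq hA.le,
    Real.mul_rpow hA.le (Real.sqrt_nonneg _), one_div, mul_inv, ← Real.rpow_neg hA.le,
    ← Real.rpow_neg (Real.sqrt_nonneg _), Real.sqrt_eq_rpow, ← Real.rpow_mul (by positivity)]
  congr 2
  ring

theorem exists_lipschitzWith_smoothTransition : ∃ K : ℝ, 0 < K ∧ ∀ x y : ℝ,
    |Real.smoothTransition x - Real.smoothTransition y| ≤ K * |x - y| := by
  obtain ⟨K, hK⟩ := (Real.smoothTransition.contDiff (n := 1)).locallyLipschitz.locallyLipschitzOn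
    (s := Icc (0 : ℝ) 1) |>.exists_lipschitzOnWith_of_compact isCompact_Icc
  refine ⟨K + 1, by positivity, fun x y => ?_⟩
  rw [← Real.smoothTransition.projIcc (x := x), ← Real.smoothTransition.projIcc (x := y)]
  have h1 := hK.dist_le_mul _ (projIcc (0 : ℝ) 1 zero_le_one x).2 _
    (projIcc (0 : ℝ) 1 zero_le_one y).2
  have h2 := (LipschitzWith.projIcc (zero_le_one : (0 : ℝ) ≤ 1)).dist_le_mul x y
  rw [Subtype.dist_eq, NNReal.coe_one, one_mul, Real.dist_eq x y] at h2
  rw [Real.dist_eq] at h1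
  refine h1.trans ?_
  have := mul_le_mul_of_nonneg_left h2 K.2
  have := abs_nonneg (x - y)
  simp only [NNReal.val_eq_coe] at *
  linarith

/-- A smooth cutoff function that is supported in `(a, a + l)` and equal to one at distance at
least `ε * l` from the endpoints. -/
def cutoff (ε a l t : ℝ) : ℝ :=
  Real.smoothTransition (2 * (t - a) / (ε * l) - 1) *
    Real.smoothTransition (2 * (a + l - t) / (ε * l) - 1)

theorem contDiff_cutoff (ε a l : ℝ) : ContDiff ℝ (⊤ : ℕ∞) (cutoff ε a l) := by
  unfold cutoff
  refine ContDiff.mul ?_ ?_ <;> refine Real.smoothTransition.contDiff.comp ?_ <;> fun_prop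

theorem cutoff_nonneg (ε a l t : ℝ) : 0 ≤ cutoff ε a l t :=
  mul_nonneg (Real.smoothTransition.nonneg _) (Real.smoothTransition.nonneg _)

theorem cutoff_le_one (ε a l t : ℝ) : cutoff ε a l t ≤ 1 :=
  mul_le_one₀ (Real.smoothTransition.le_one _) (Real.smoothTransition.nonneg _)
    (Real.smoothTransition.le_one _)

theorem mem_of_cutoff_ne_zero {ε a l t : ℝ} (hε : 0 < ε) (hl : 0 < l) (h : cutoff ε a l t ≠ 0) :
    t ∈ Icc (a + ε * l / 2) (a + l - ε * l / 2) := by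
  have h' : 0 < ε * l := by positivity
  by_contra hn
  rw [mem_Icc, not_and_or, not_le, not_le] at hn
  refine h ?_
  unfold cutoff
  rcases hn with hn | hn
  · rw [Real.smoothTransition.zero_of_nonpos, zero_mul]
    rw [sub_nonpos, div_le_one h']; linarith
  · rw [mul_comm, Real.smoothTransition.zero_of_nonpos, zero_mul]
    rw [sub_nonpos, div_le_one h']; linarith

theorem cutoff_eq_one {ε a l t : ℝ} (hε : 0 < ε) (hl : 0 < l)
    (h : t ∈ Icc (a + ε * l) (a + l - ε * l)) : cutoff ε a l t = 1 := by
  have h' : 0 < ε * l := by positivity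
  unfold cutoff
  rw [Real.smoothTransition.one_of_one_le, Real.smoothTransition.one_of_one_le, one_mul]
  · rw [le_sub_iff_add_le, le_div_iff₀ h']; linarith [h.2]
  · rw [le_sub_iff_add_le, le_div_iff₀ h']; linarith [h.1]

theorem exists_cutoff_lipschitz : ∃ K : ℝ, 0 < K ∧ ∀ ε a l : ℝ, 0 < ε → 0 < l → ∀ t τ : ℝ,
    |cutoff ε a l t - cutoff ε a l τ| ≤ K / (ε * l) * |t - τ| := by
  obtain ⟨K, hK, h⟩ := exists_lipschitzWith_smoothTransition
  refine ⟨4 * K, by positivity, fun ε a l hε hl t τ => ?_⟩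
  have h' : 0 < ε * l := by positivity
  unfold cutoff
  have h1 := h (2 * (t - a) / (ε * l) - 1) (2 * (τ - a) / (ε * l) - 1)
  have h2 := h (2 * (a + l - t) / (ε * l) - 1) (2 * (a + l - τ) / (ε * l) - 1)
  have e1 : 2 * (t - a) / (ε * l) - 1 - (2 * (τ - a) / (ε * l) - 1) = 2 / (ε * l) * (t - τ) := by
    ring
  have e2 : 2 * (a + l - t) / (ε * l) - 1 - (2 * (a + l - τ) / (ε * l) - 1) =
      -(2 / (ε * l) * (t - τ)) := by ring
  rw [e1, abs_mul, abs_of_pos (by positivity : (0 : ℝ) < 2 / (ε * l))] at h1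
  rw [e2, abs_neg, abs_mul, abs_of_pos (by positivity : (0 : ℝ) < 2 / (ε * l))] at h2
  have n1 := Real.smoothTransition.nonneg (2 * (a + l - t) / (ε * l) - 1)
  have m1 := Real.smoothTransition.le_one (2 * (a + l - t) / (ε * l) - 1)
  have n2 := Real.smoothTransition.nonneg (2 * (τ - a) / (ε * l) - 1)
  have m2 := Real.smoothTransition.le_one (2 * (τ - a) / (ε * l) - 1)
  generalize Real.smoothTransition (2 * (t - a) / (ε * l) - 1) = A at *
  generalize Real.smoothTransition (2 * (a + l - t) / (ε * l) - 1) = B at *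
  generalize Real.smoothTransition (2 * (τ - a) / (ε * l) - 1) = A' at *
  generalize Real.smoothTransition (2 * (a + l - τ) / (ε * l) - 1) = B' at *
  calc |A * B - A' * B'| = |(A - A') * B + A' * (B - B')| := by congr 1; ring
    _ ≤ |A - A'| * B + A' * |B - B'| := by
      refine (abs_add_le _ _).trans_eq ?_
      rw [abs_mul, abs_mul, abs_of_nonneg n1, abs_of_nonneg n2]
    _ ≤ |A - A'| * 1 + 1 * |B - B'| := by gcongr
    _ ≤ 4 * K / (ε * l) * |t - τ| := by
      have : 4 * K / (ε * l) * |t - τ| = 2 * (K * (2 / (ε * l) * |t - τ|)) := by ring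
      linarith

/-- A majorant of (half of) the Gagliardo kernel of a function that is `L`-Lipschitz, varies only
on `N`, is supported in `S` and is equal to one on `S \ N`; the set `V` plays the role of the
part of the domain where the function vanishes. -/
def majorant (p α L : ℝ) (N S V : Set ℝ) (t τ : ℝ) : ℝ≥0∞ :=
  N.indicator 1 t * ENNReal.ofReal (min 1 (L * |t - τ|) ^ p / |t - τ| ^ (1 + α)) +
    S.indicator 1 t * V.indicator (fun τ => ENNReal.ofReal (1 / |t - τ| ^ (1 + α))) τ

theorem measurable_majorant {p α L : ℝ} {N S V : Set ℝ} (hN : MeasurableSet N)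
    (hS : MeasurableSet S) (hV : MeasurableSet V) :
    Measurable (Function.uncurry (majorant p α L N S V)) := by
  refine Measurable.add (Measurable.mul ?_ ?_) (Measurable.mul ?_ ?_)
  · exact (measurable_one.indicator hN).comp measurable_fst
  · fun_prop
  · exact (measurable_one.indicator hS).comp measurable_fst
  · exact Measurable.indicator (f := fun x : ℝ × ℝ => ENNReal.ofReal (1 / |x.1 - x.2| ^ (1 + α)))
      (by fun_prop) (measurable_snd hV)

theorem lintegral_lintegral_majorant {p α L : ℝ} {N S V : Set ℝ} (hN : MeasurableSet N)
    (hS : MeasurableSet S) (hV : MeasurableSet V) {b₁ b₂ : ℝ≥0∞}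
    (h₁ : ∀ t ∈ N, ∫⁻ τ, ENNReal.ofReal (min 1 (L * |t - τ|) ^ p / |t - τ| ^ (1 + α)) ≤ b₁)
    (h₂ : ∀ t ∈ S, ∫⁻ τ in V, ENNReal.ofReal (1 / |t - τ| ^ (1 + α)) ≤ b₂) :
    ∫⁻ t, ∫⁻ τ, majorant p α L N S V t τ ≤ volume N * b₁ + volume S * b₂ := by
  have key (t : ℝ) : ∫⁻ τ, majorant p α L N S V t τ ≤
      N.indicator (fun _ => b₁) t + S.indicator (fun _ => b₂) t := by
    unfold majorant
    rw [lintegral_add_left (by fun_prop)]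
    gcongr
    · by_cases ht : t ∈ N
      · simpa [ht] using h₁ t ht
      · simp [ht]
    · by_cases ht : t ∈ S
      · rw [indicator_of_mem ht, indicator_of_mem ht]
        simpa [lintegral_indicator hV] using h₂ t ht
      · simp [ht]
  refine (lintegral_mono key).trans_eq ?_
  rw [lintegral_add_left (measurable_const.indicator hN), lintegral_indicator_const hN,
    lintegral_indicator_const hS, mul_comm, mul_comm b₂]

theorem lintegral_lintegral_le_of_symm {f h : ℝ → ℝ → ℝ≥0∞} {U : Set ℝ} (hU : MeasurableSet U)
    (hh : Measurable (Function.uncurry h))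
    (hf : ∀ t ∈ U, ∀ τ ∈ U, f t τ ≤ h t τ + h τ t) :
    ∫⁻ t in U, ∫⁻ τ in U, f t τ ≤ 2 * ∫⁻ t, ∫⁻ τ, h t τ := by
  calc ∫⁻ t in U, ∫⁻ τ in U, f t τ ≤ ∫⁻ t in U, ∫⁻ τ in U, (h t τ + h τ t) :=
        setLIntegral_mono' hU fun t ht => setLIntegral_mono' hU fun τ hτ => hf t ht τ hτ
    _ ≤ ∫⁻ t, ∫⁻ τ, (h t τ + h τ t) :=
        (setLIntegral_le_lintegral _ _).trans
          (lintegral_mono fun t => setLIntegral_le_lintegral _ _)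
    _ = ∫⁻ t, ((∫⁻ τ, h t τ) + ∫⁻ τ, h τ t) :=
        lintegral_congr fun t => lintegral_add_left (hh.comp measurable_prodMk_left) _
    _ = (∫⁻ t, ∫⁻ τ, h t τ) + ∫⁻ t, ∫⁻ τ, h τ t :=
        lintegral_add_left hh.lintegral_prod_right _
    _ = _ := by
        rw [lintegral_lintegral_swap (f := fun t τ => h τ t) (hh.comp measurable_swap).aemeasurable,
          two_mul]

theorem kernel_le_majorant {p α ε a l L : ℝ} (hp : 0 < p) (hε : 0 < ε) (hl : 0 < l)
    (hL : ∀ t τ, |cutoff ε a l t - cutoff ε a l τ| ≤ L * |t - τ|) {U : Set ℝ} {t τ : ℝ}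
    (ht : t ∈ U) (hτ : τ ∈ U) :
    ENNReal.ofReal (|cutoff ε a l t - cutoff ε a l τ| ^ p / |t - τ| ^ (1 + α)) ≤
      majorant p α L (Icc a (a + ε * l) ∪ Icc (a + l - ε * l) (a + l))
        (Icc (a + ε * l / 2) (a + l - ε * l / 2)) (U \ Ioo a (a + l)) t τ +
      majorant p α L (Icc a (a + ε * l) ∪ Icc (a + l - ε * l) (a + l))
        (Icc (a + ε * l / 2) (a + l - ε * l / 2)) (U \ Ioo a (a + l)) τ t := by
  wlog hle : cutoff ε a l τ ≤ cutoff ε a l t generalizing t τ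
  · rw [abs_sub_comm (cutoff ε a l t), abs_sub_comm t, add_comm (majorant _ _ _ _ _ _ _ _)]
    exact this hτ ht (not_le.1 hle).le
  have hεl : 0 < ε * l := by positivity
  have h1 : |cutoff ε a l t - cutoff ε a l τ| ≤ 1 := by
    have := cutoff_nonneg ε a l τ
    have := cutoff_le_one ε a l t
    rw [abs_le]; constructor <;> linarith
  have hnum (x : ℝ) : |cutoff ε a l t - cutoff ε a l τ| ^ p / |x| ^ (1 + α) ≤
      min 1 (L * |t - τ|) ^ p / |x| ^ (1 + α) := by
    gcongr
    exact le_min h1 (hL t τ)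
  rcases hle.eq_or_lt with heq | hlt
  · rw [heq, sub_self, abs_zero, Real.zero_rpow hp.ne', zero_div, ENNReal.ofReal_zero]
    exact zero_le
  set N := Icc a (a + ε * l) ∪ Icc (a + l - ε * l) (a + l) with hN
  have htS := mem_of_cutoff_ne_zero hε hl ((cutoff_nonneg ε a l τ).trans_lt hlt).ne'
  by_cases htN : t ∈ N
  · refine le_trans ?_ le_self_add
    refine le_trans ?_ le_self_add
    rw [indicator_of_mem htN, Pi.one_apply, one_mul]
    exact ENNReal.ofReal_le_ofReal (hnum _)
  by_cases hτN : τ ∈ N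
  · refine le_trans ?_ le_add_self
    refine le_trans ?_ le_self_add
    rw [indicator_of_mem hτN, Pi.one_apply, one_mul, abs_sub_comm τ t]
    exact ENNReal.ofReal_le_ofReal (hnum _)
  have hτI : τ ∉ Ioo a (a + l) := fun hτI => by
    have : cutoff ε a l τ = 1 := by
      refine cutoff_eq_one hε hl ?_
      simp only [hN, mem_union, mem_Icc, not_or, not_and, not_le] at hτN
      refine ⟨(hτN.1 hτI.1.le).le, ?_⟩
      by_contra hc
      exact absurd (hτN.2 (not_le.1 hc).le) (not_lt.2 hτI.2.le)
    linarith [cutoff_le_one ε a l t]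
  refine le_trans ?_ le_self_add
  refine le_trans ?_ le_add_self
  rw [indicator_of_mem htS, Pi.one_apply, one_mul,
    indicator_of_mem (show τ ∈ U \ Ioo a (a + l) from ⟨hτ, hτI⟩)]
  refine ENNReal.ofReal_le_ofReal ?_
  gcongr
  exact Real.rpow_le_one (abs_nonneg _) h1 hp.le

theorem tail_bound {α : ℝ} (hα : 0 < α) {m : ℝ} (hm : ∀ D : ℝ, 0 < D → ∀ t : ℝ,
      ∫⁻ τ in {τ | D ≤ |t - τ|}, ENNReal.ofReal (1 / |t - τ| ^ (1 + α)) ≤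
      ENNReal.ofReal (m * D ^ (-α)))
    {U : Set ℝ} {a l ε R δ : ℝ} (hl : 0 < l) (hε : 0 < ε) (hR : 0 < R)
    (hU : MeasurableSet U)
    (hδ : volume ((U \ Ioo a (a + l)) ∩ Icc (a - R * l) (a + l + R * l)) ≤ ENNReal.ofReal (δ * l))
    {t : ℝ} (ht : t ∈ Icc (a + ε * l / 2) (a + l - ε * l / 2)) :
    ∫⁻ τ in U \ Ioo a (a + l), ENNReal.ofReal (1 / |t - τ| ^ (1 + α)) ≤
      ENNReal.ofReal (1 / (ε * l / 2) ^ (1 + α)) * ENNReal.ofReal (δ * l) +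
        ENNReal.ofReal (m * (R * l) ^ (-α)) := by
  have hεl : 0 < ε * l := by positivity
  have hRl : 0 < R * l := by positivity
  have hsub : U \ Ioo a (a + l) ⊆ ((U \ Ioo a (a + l)) ∩ Icc (a - R * l) (a + l + R * l)) ∪
      {τ | R * l ≤ |t - τ|} := fun τ hτ => by
    by_cases h : τ ∈ Icc (a - R * l) (a + l + R * l)
    · exact Or.inl ⟨hτ, h⟩
    · right
      rw [mem_Icc, not_and_or, not_le, not_le] at h
      rw [mem_ofPred_eq, le_abs]
      rcases h with h | h
      · left; linarith [ht.1]
      · right; linarith [ht.2]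
  refine (lintegral_mono_set hsub).trans ((lintegral_union_le _ _ _).trans ?_)
  refine add_le_add ?_ (hm _ hRl t)
  refine le_trans ?_ (mul_le_mul_right hδ _)
  rw [← setLIntegral_const]
  refine setLIntegral_mono' ((hU.diff measurableSet_Ioo).inter measurableSet_Icc) fun τ hτ => ?_
  refine ENNReal.ofReal_le_ofReal ?_
  gcongr
  have h := hτ.1.2
  rw [mem_Ioo, not_and_or, not_lt, not_lt] at h
  rw [le_abs]
  rcases h with h | h
  · left; linarith [ht.1]
  · right; linarith [ht.2]

/-- The one-dimensional Gagliardo energy of the cutoff function of a component of `U` that is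
almost isolated in `U`. -/
theorem exists_energy_bound {p α : ℝ} (hα : 0 < α) (hαp : α < p) :
    ∃ C : ℝ, 0 < C ∧ ∀ ε : ℝ, 0 < ε → ∃ R : ℝ, 0 < R ∧ ∃ δ : ℝ, 0 < δ ∧
      ∀ (U : Set ℝ) (a l : ℝ), MeasurableSet U → 0 < l →
        volume ((U \ Ioo a (a + l)) ∩ Icc (a - R * l) (a + l + R * l)) ≤ ENNReal.ofReal (δ * l) →
        ∫⁻ t in U, ∫⁻ τ in U,
          ENNReal.ofReal (|cutoff ε a l t - cutoff ε a l τ| ^ p / |t - τ| ^ (1 + α)) ≤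
          ENNReal.ofReal (C * (ε * l) ^ (1 - α)) := by
  obtain ⟨K, hK, hLip⟩ := exists_cutoff_lipschitz
  obtain ⟨m₁, hm₁, hb₁⟩ := exists_lipschitz_bound hα hαp
  obtain ⟨m₂, hm₂, hb₂⟩ := exists_far_bound hα
  refine ⟨2 * (2 * (m₁ * K ^ α) + 2), by positivity, fun ε hε => ?_⟩
  refine ⟨(ε ^ (1 - α) / m₂) ^ (-(1 / α)), by positivity,
    ε ^ (1 - α) * (ε / 2) ^ (1 + α), by positivity, fun U a l hU hl hvol => ?_⟩
  set R := (ε ^ (1 - α) / m₂) ^ (-(1 / α)) with hR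
  set δ := ε ^ (1 - α) * (ε / 2) ^ (1 + α) with hδ
  have hRpos : 0 < R := by positivity
  have hεl : 0 < ε * l := by positivity
  have hN : MeasurableSet (Icc a (a + ε * l) ∪ Icc (a + l - ε * l) (a + l)) :=
    measurableSet_Icc.union measurableSet_Icc
  have hV : MeasurableSet (U \ Ioo a (a + l)) := hU.diff measurableSet_Ioo
  have e1 : 1 / (ε * l / 2) ^ (1 + α) * (δ * l) = ε ^ (1 - α) * l ^ (-α) := by
    rw [hδ, show ε * l / 2 = ε / 2 * l by ring, Real.mul_rpow (by positivity) hl.le,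
      Real.rpow_neg hl.le, Real.rpow_add hl 1 α, Real.rpow_one]
    field_simp
  have e2 : m₂ * (R * l) ^ (-α) = ε ^ (1 - α) * l ^ (-α) := by
    rw [Real.mul_rpow hRpos.le hl.le, hR, ← Real.rpow_mul (by positivity),
      show -(1 / α) * -α = 1 by field_simp, Real.rpow_one]
    field_simp
  refine (lintegral_lintegral_le_of_symm hU (measurable_majorant hN measurableSet_Icc hV)
    fun t ht τ hτ => kernel_le_majorant (hα.trans hαp) hε hl (hLip ε a l hε hl) ht hτ).trans ?_
  refine (mul_le_mul_right (lintegral_lintegral_majorant hN measurableSet_Icc hV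
    (fun t _ => hb₁ (K / (ε * l)) (by positivity) t)
    (fun t ht => tail_bound hα hb₂ hl hε hRpos hU hvol ht)) _).trans ?_
  have hvN : volume (Icc a (a + ε * l) ∪ Icc (a + l - ε * l) (a + l)) ≤
      ENNReal.ofReal (2 * (ε * l)) := by
    refine (measure_union_le _ _).trans_eq ?_
    rw [Real.volume_Icc, Real.volume_Icc, ← ENNReal.ofReal_add (by linarith) (by linarith)]
    congr 1; ring
  have hvS : volume (Icc (a + ε * l / 2) (a + l - ε * l / 2)) ≤ ENNReal.ofReal l := by
    rw [Real.volume_Icc]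
    exact ENNReal.ofReal_le_ofReal (by linarith)
  calc _ ≤ 2 * (ENNReal.ofReal (2 * (ε * l)) * ENNReal.ofReal (m₁ * (K / (ε * l)) ^ α) +
        ENNReal.ofReal l * (ENNReal.ofReal (1 / (ε * l / 2) ^ (1 + α)) * ENNReal.ofReal (δ * l) +
        ENNReal.ofReal (m₂ * (R * l) ^ (-α)))) := by gcongr
    _ = _ := by
      rw [← ENNReal.ofReal_mul (by positivity), ← ENNReal.ofReal_mul (by positivity),
        e1, e2, ← ENNReal.ofReal_add (by positivity) (by positivity),
        ← ENNReal.ofReal_mul (by positivity), ← ENNReal.ofReal_add (by positivity) (by positivity),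
        show (2 : ℝ≥0∞) = ENNReal.ofReal 2 by simp, ← ENNReal.ofReal_mul (by positivity)]
      congr 1
      have e3 : ε * l * (K / (ε * l)) ^ α = K ^ α * (ε * l) ^ (1 - α) := by
        rw [Real.div_rpow hK.le hεl.le, Real.rpow_sub hεl, Real.rpow_one]
        ring
      have e4 : l * (ε ^ (1 - α) * l ^ (-α)) = (ε * l) ^ (1 - α) := by
        rw [Real.mul_rpow hε.le hl.le, sub_eq_add_neg 1 α, Real.rpow_add hl, Real.rpow_one]
        ring
      linear_combination 4 * m₁ * e3 + 4 * e4

theorem lintegral_euc_two {i j : Fin 2} (hij : i ≠ j) {f : ℝ → ℝ → ℝ≥0∞}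
    (hf : Measurable (Function.uncurry f)) :
    ∫⁻ x : Euc 2, f (x i) (x j) = ∫⁻ a, ∫⁻ b, f a b := by
  have key (g : ℝ → ℝ → ℝ≥0∞) (hg : Measurable (Function.uncurry g)) :
      ∫⁻ x : Euc 2, g (x 0) (x 1) = ∫⁻ a, ∫⁻ b, g a b := by
    have h1 := (PiLp.volume_preserving_ofLp (Fin 2)).lintegral_comp_emb
      (MeasurableEquiv.toLp 2 (Fin 2 → ℝ)).symm.measurableEmbedding (fun x => g (x 0) (x 1))
    have h2 := (volume_preserving_finTwoArrow ℝ).lintegral_comp_emb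
      (MeasurableEquiv.finTwoArrow (α := ℝ)).measurableEmbedding (Function.uncurry g)
    rw [Measure.volume_eq_prod, lintegral_prod _ hg.aemeasurable] at h2
    exact h1.trans h2
  have hij' : (i = 0 ∧ j = 1) ∨ (i = 1 ∧ j = 0) := by omega
  rcases hij' with ⟨rfl, rfl⟩ | ⟨rfl, rfl⟩
  · exact key f hf
  · rw [key (fun a b => f b a) (hf.comp measurable_swap)]
    exact lintegral_lintegral_swap (f := fun a b => f b a) (hf.comp measurable_swap).aemeasurable

theorem setLIntegral_euc_two {i j : Fin 2} (hij : i ≠ j) {A B : Set ℝ} (hA : MeasurableSet A)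
    (hB : MeasurableSet B) {f : ℝ → ℝ → ℝ≥0∞} (hf : Measurable (Function.uncurry f)) :
    ∫⁻ x in {x : Euc 2 | x i ∈ A ∧ x j ∈ B}, f (x i) (x j) = ∫⁻ a in A, ∫⁻ b in B, f a b := by
  have hm : MeasurableSet {x : Euc 2 | x i ∈ A ∧ x j ∈ B} :=
    (hA.preimage (by fun_prop : Measurable fun x : Euc 2 => x i)).inter
      (hB.preimage (by fun_prop : Measurable fun x : Euc 2 => x j))
  have hF : Measurable (Function.uncurry fun a b => A.indicator 1 a * B.indicator (f a) b) := by
    refine Measurable.mul ((measurable_one.indicator hA).comp measurable_fst) ?_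
    exact Measurable.indicator (f := Function.uncurry f) hf (measurable_snd hB)
  rw [← lintegral_indicator hm, ← lintegral_indicator hA]
  calc _ = ∫⁻ x : Euc 2, A.indicator 1 (x i) * B.indicator (f (x i)) (x j) := by
        refine lintegral_congr fun x => ?_
        by_cases h1 : x i ∈ A <;> by_cases h2 : x j ∈ B <;> simp [indicator, h1, h2]
    _ = _ := by
        rw [lintegral_euc_two hij hF]
        refine lintegral_congr fun a => ?_
        by_cases h1 : a ∈ A <;> simp [h1, lintegral_indicator hB]

theorem volume_euc_two {i j : Fin 2} (hij : i ≠ j) {A B : Set ℝ} (hA : MeasurableSet A)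
    (hB : MeasurableSet B) :
    volume {x : Euc 2 | x i ∈ A ∧ x j ∈ B} = volume A * volume B := by
  have := setLIntegral_euc_two hij hA hB (f := fun _ _ => 1) (by unfold Function.uncurry; fun_prop)
  simpa [mul_comm] using this

theorem dist_euc_two {i j : Fin 2} (hij : i ≠ j) (x y : Euc 2) :
    dist x y = √((x i - y i) ^ 2 + (x j - y j) ^ 2) := by
  rw [EuclideanSpace.dist_eq]
  have hij' : (i = 0 ∧ j = 1) ∨ (i = 1 ∧ j = 0) := by omega
  rcases hij' with ⟨rfl, rfl⟩ | ⟨rfl, rfl⟩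
  · simp [Real.dist_eq, sq_abs]
  · simp [Real.dist_eq, sq_abs, add_comm]

/-- The Cartesian square of a subset of the line, as a subset of the Euclidean plane. -/
def square (U : Set ℝ) : Set (Euc 2) := {x | ∀ i, x i ∈ U}

theorem square_eq {i j : Fin 2} (hij : i ≠ j) (U : Set ℝ) :
    square U = {x | x i ∈ U ∧ x j ∈ U} := by
  ext x
  have hij' : (i = 0 ∧ j = 1) ∨ (i = 1 ∧ j = 0) := by omega
  rcases hij' with ⟨rfl, rfl⟩ | ⟨rfl, rfl⟩
  · simp [square, Fin.forall_fin_two]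
  · simp [square, Fin.forall_fin_two, and_comm]

section Energy

variable {α p m : ℝ} {φ : ℝ → ℝ} {U J : Set ℝ}

theorem lintegral_kernel_coord_le (hm : ∀ A : ℝ, 0 < A → ∀ t : ℝ,
      ∫⁻ b, ENNReal.ofReal (1 / √(A ^ 2 + (t - b) ^ 2) ^ (2 + α)) ≤
      ENNReal.ofReal (m * (1 / A ^ (1 + α)))) (hm0 : 0 < m) (hp : 0 < p) (hφ : Continuous φ)
    (hU : MeasurableSet U) (i : Fin 2) (x : Euc 2) :
    ∫⁻ y in square U, ENNReal.ofReal (|φ (x i) - φ (y i)| ^ p / dist x y ^ (2 + α)) ≤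
      ENNReal.ofReal m *
        ∫⁻ τ in U, ENNReal.ofReal (|φ (x i) - φ τ| ^ p / |x i - τ| ^ (1 + α)) := by
  obtain ⟨j, hij⟩ := exists_ne i
  have hφm := hφ.measurable
  have h1 : ∫⁻ y in square U, ENNReal.ofReal (|φ (x i) - φ (y i)| ^ p / dist x y ^ (2 + α)) ≤
      ∫⁻ y in {y : Euc 2 | y i ∈ U ∧ y j ∈ univ}, ENNReal.ofReal (|φ (x i) - φ (y i)| ^ p /
        √((x i - y i) ^ 2 + (x j - y j) ^ 2) ^ (2 + α)) := by
    simp_rw [dist_euc_two hij.symm]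
    refine lintegral_mono_set fun y hy => ⟨hy i, mem_univ _⟩
  refine h1.trans ?_
  rw [setLIntegral_euc_two hij.symm hU MeasurableSet.univ (f := fun τ b =>
    ENNReal.ofReal (|φ (x i) - φ τ| ^ p / √((x i - τ) ^ 2 + (x j - b) ^ 2) ^ (2 + α)))
    (by unfold Function.uncurry; fun_prop), ← lintegral_const_mul' _ _ ENNReal.ofReal_ne_top]
  refine lintegral_mono fun τ => ?_
  rw [setLIntegral_univ]
  rcases eq_or_ne (x i) τ with rfl | hne
  · simp [Real.zero_rpow hp.ne']
  · have hA : 0 < |x i - τ| := abs_pos.2 (sub_ne_zero.2 hne)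
    simp_rw [div_eq_mul_one_div (|φ (x i) - φ τ| ^ p),
      ENNReal.ofReal_mul (by positivity : 0 ≤ |φ (x i) - φ τ| ^ p)]
    rw [lintegral_const_mul' _ _ ENNReal.ofReal_ne_top, mul_left_comm]
    gcongr
    have := hm _ hA (x j)
    rwa [sq_abs, ENNReal.ofReal_mul hm0.le] at this

theorem lintegral_lintegral_kernel_coord_le (hm : ∀ A : ℝ, 0 < A → ∀ t : ℝ,
      ∫⁻ b, ENNReal.ofReal (1 / √(A ^ 2 + (t - b) ^ 2) ^ (2 + α)) ≤
      ENNReal.ofReal (m * (1 / A ^ (1 + α)))) (hm0 : 0 < m) (hp : 0 < p) (hφ : Continuous φ)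
    (hU : MeasurableSet U) (hJ : MeasurableSet J) {i j : Fin 2} (hij : i ≠ j) :
    ∫⁻ x in square U, ∫⁻ y in square U, J.indicator 1 (x j) *
        ENNReal.ofReal (|φ (x i) - φ (y i)| ^ p / dist x y ^ (2 + α)) ≤
      ENNReal.ofReal m * volume J *
        ∫⁻ t in U, ∫⁻ τ in U, ENNReal.ofReal (|φ t - φ τ| ^ p / |t - τ| ^ (1 + α)) := by
  have hφm := hφ.measurable
  set g : ℝ → ℝ≥0∞ := fun t => ∫⁻ τ in U, ENNReal.ofReal (|φ t - φ τ| ^ p / |t - τ| ^ (1 + α))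
    with hg
  have hgm : Measurable g := by
    refine Measurable.lintegral_prod_right' (f := fun z : ℝ × ℝ =>
      ENNReal.ofReal (|φ z.1 - φ z.2| ^ p / |z.1 - z.2| ^ (1 + α))) ?_
    fun_prop
  have h1J : Measurable (J.indicator (1 : ℝ → ℝ≥0∞)) := measurable_one.indicator hJ
  have hne (t : ℝ) : J.indicator (1 : ℝ → ℝ≥0∞) t ≠ ⊤ := by
    by_cases h : t ∈ J <;> simp [h]
  calc _ ≤ ∫⁻ x in square U, J.indicator 1 (x j) * (ENNReal.ofReal m * g (x i)) := by
        refine lintegral_mono fun x => ?_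
        rw [lintegral_const_mul' _ _ (hne _)]
        gcongr
        exact lintegral_kernel_coord_le hm hm0 hp hφ hU i x
    _ = ∫⁻ t in U, ∫⁻ b in U, J.indicator 1 b * (ENNReal.ofReal m * g t) := by
        rw [square_eq hij]
        refine setLIntegral_euc_two hij hU hU
          (f := fun t b => J.indicator 1 b * (ENNReal.ofReal m * g t)) ?_
        unfold Function.uncurry
        fun_prop
    _ = ∫⁻ t in U, (∫⁻ b in U, J.indicator 1 b) * (ENNReal.ofReal m * g t) :=
        lintegral_congr fun t => lintegral_mul_const _ h1J
    _ ≤ ∫⁻ t in U, volume J * (ENNReal.ofReal m * g t) := by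
        gcongr
        refine (setLIntegral_le_lintegral _ _).trans_eq ?_
        rw [lintegral_indicator_one hJ]
    _ = _ := by
        rw [lintegral_const_mul _ (hgm.const_mul _), lintegral_const_mul _ hgm]
        ring

theorem energy_square_le (hm : ∀ A : ℝ, 0 < A → ∀ t : ℝ,
      ∫⁻ b, ENNReal.ofReal (1 / √(A ^ 2 + (t - b) ^ 2) ^ (2 + α)) ≤
      ENNReal.ofReal (m * (1 / A ^ (1 + α)))) (hm0 : 0 < m) (hp : 0 < p) (hφ : Continuous φ)
    (hφ0 : ∀ t, 0 ≤ φ t) (hφ1 : ∀ t, φ t ≤ 1) (hφJ : ∀ t, φ t ≠ 0 → t ∈ J)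
    (hU : MeasurableSet U) (hJ : MeasurableSet J) :
    ∫⁻ x in square U, ∫⁻ y in square U,
        ENNReal.ofReal (|φ (x 0) * φ (x 1) - φ (y 0) * φ (y 1)| ^ p / dist x y ^ (2 + α)) ≤
      ENNReal.ofReal (2 ^ p * (2 * m)) * volume J *
        ∫⁻ t in U, ∫⁻ τ in U, ENNReal.ofReal (|φ t - φ τ| ^ p / |t - τ| ^ (1 + α)) := by
  have hφm := hφ.measurable
  have h1J : Measurable (J.indicator (1 : ℝ → ℝ≥0∞)) := measurable_one.indicator hJ
  set k : Fin 2 → Euc 2 → Euc 2 → ℝ≥0∞ := fun i x y =>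
    ENNReal.ofReal (|φ (x i) - φ (y i)| ^ p / dist x y ^ (2 + α)) with hk
  have hkm (i : Fin 2) : Measurable fun z : Euc 2 × Euc 2 => k i z.1 z.2 := by
    simp only [hk]; fun_prop
  have hksymm (i : Fin 2) (x y : Euc 2) : k i x y = k i y x := by
    simp only [hk]; rw [abs_sub_comm, dist_comm]
  have hind (t : ℝ) (d w : ℝ) (hd : 0 ≤ d) (hw : 0 ≤ w) : ENNReal.ofReal ((φ t * d) ^ p / w) ≤
      J.indicator 1 t * ENNReal.ofReal (d ^ p / w) := by
    by_cases h : φ t = 0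
    · rw [h, zero_mul, Real.zero_rpow hp.ne', zero_div, ENNReal.ofReal_zero]
      exact zero_le
    · rw [indicator_of_mem (hφJ t h), Pi.one_apply, one_mul]
      refine ENNReal.ofReal_le_ofReal ?_
      have := hφ0 t
      gcongr
      exact mul_le_of_le_one_left hd (hφ1 t)
  have hpt (x y : Euc 2) :
      ENNReal.ofReal (|φ (x 0) * φ (x 1) - φ (y 0) * φ (y 1)| ^ p / dist x y ^ (2 + α)) ≤
      ENNReal.ofReal (2 ^ p) * (J.indicator 1 (x 1) * k 0 x y + J.indicator 1 (y 0) * k 1 x y) := by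
    have hw : 0 ≤ dist x y ^ (2 + α) := by positivity
    set w := dist x y ^ (2 + α)
    set A := φ (x 1) * |φ (x 0) - φ (y 0)| with hA
    set B := φ (y 0) * |φ (x 1) - φ (y 1)| with hB
    have hA0 : 0 ≤ A := mul_nonneg (hφ0 _) (abs_nonneg _)
    have hB0 : 0 ≤ B := mul_nonneg (hφ0 _) (abs_nonneg _)
    have h1 : |φ (x 0) * φ (x 1) - φ (y 0) * φ (y 1)| ≤ A + B := by
      calc _ = |φ (x 1) * (φ (x 0) - φ (y 0)) + φ (y 0) * (φ (x 1) - φ (y 1))| := by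
            congr 1; ring
        _ ≤ _ := (abs_add_le _ _).trans_eq (by
            rw [abs_mul, abs_mul, abs_of_nonneg (hφ0 _), abs_of_nonneg (hφ0 _)])
    have h2 : (A + B) ^ p ≤ 2 ^ p * (A ^ p + B ^ p) := by
      calc (A + B) ^ p ≤ (2 * max A B) ^ p := by
            gcongr
            linarith [le_max_left A B, le_max_right A B]
        _ = 2 ^ p * (max A B) ^ p := Real.mul_rpow (by norm_num) (hA0.trans (le_max_left _ _))
        _ ≤ _ := by
            gcongr
            rcases max_choice A B with h | h <;> rw [h] <;>
              linarith [Real.rpow_nonneg hA0 p, Real.rpow_nonneg hB0 p]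
    calc _ ≤ ENNReal.ofReal (2 ^ p * (A ^ p / w + B ^ p / w)) := by
          refine ENNReal.ofReal_le_ofReal ?_
          rw [← add_div, ← mul_div_assoc]
          gcongr
          exact (Real.rpow_le_rpow (abs_nonneg _) h1 hp.le).trans h2
      _ = ENNReal.ofReal (2 ^ p) * (ENNReal.ofReal (A ^ p / w) + ENNReal.ofReal (B ^ p / w)) := by
          rw [ENNReal.ofReal_mul (by positivity), ENNReal.ofReal_add (by positivity) (by positivity)]
      _ ≤ _ := by
          gcongr
          · exact hind _ _ _ (abs_nonneg _) hw
          · exact hind _ _ _ (abs_nonneg _) hw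
  have hm1 : Measurable fun z : Euc 2 × Euc 2 => J.indicator 1 (z.1 1) * k 0 z.1 z.2 :=
    (h1J.comp (by fun_prop : Measurable fun z : Euc 2 × Euc 2 => z.1 1)).mul (hkm 0)
  have hm2 : Measurable fun z : Euc 2 × Euc 2 => J.indicator 1 (z.2 0) * k 1 z.1 z.2 :=
    (h1J.comp (by fun_prop : Measurable fun z : Euc 2 × Euc 2 => z.2 0)).mul (hkm 1)
  have b1 := lintegral_lintegral_kernel_coord_le hm hm0 hp hφ hU hJ (zero_ne_one : (0 : Fin 2) ≠ 1)
  have b2 := lintegral_lintegral_kernel_coord_le hm hm0 hp hφ hU hJ (one_ne_zero : (1 : Fin 2) ≠ 0)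
  have hswap : ∫⁻ x in square U, ∫⁻ y in square U, J.indicator 1 (y 0) * k 1 x y =
      ∫⁻ x in square U, ∫⁻ y in square U, J.indicator 1 (x 0) * k 1 x y := by
    rw [lintegral_lintegral_swap hm2.aemeasurable]
    simp_rw [hksymm 1]
  calc _ ≤ ∫⁻ x in square U, ∫⁻ y in square U, ENNReal.ofReal (2 ^ p) *
        (J.indicator 1 (x 1) * k 0 x y + J.indicator 1 (y 0) * k 1 x y) :=
        lintegral_mono fun x => lintegral_mono fun y => hpt x y
    _ = ENNReal.ofReal (2 ^ p) *
        ((∫⁻ x in square U, ∫⁻ y in square U, J.indicator 1 (x 1) * k 0 x y) +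
        ∫⁻ x in square U, ∫⁻ y in square U, J.indicator 1 (y 0) * k 1 x y) := by
        simp_rw [lintegral_const_mul' _ _ ENNReal.ofReal_ne_top]
        congr 1
        rw [← lintegral_add_left hm1.lintegral_prod_right']
        exact lintegral_congr fun x => lintegral_add_left (hm1.comp measurable_prodMk_left) _
    _ ≤ _ := by
        rw [hswap]
        refine (mul_le_mul_right (add_le_add b1 b2) _).trans_eq ?_
        rw [ENNReal.ofReal_mul (by positivity), ENNReal.ofReal_mul (by norm_num)]
        simp only [ENNReal.ofReal_ofNat]
        ring

end Energy

theorem square_eq_preimage (U : Set ℝ) :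
    square U = (EuclideanSpace.equiv (Fin 2) ℝ).toHomeomorph ⁻¹' univ.pi fun _ => U := by
  ext x
  simp [square]

theorem isOpen_square {U : Set ℝ} (hU : IsOpen U) : IsOpen (square U) := by
  rw [square_eq_preimage]
  exact (isOpen_set_pi finite_univ fun _ _ => hU).preimage (Homeomorph.continuous _)

theorem isCompact_square {K : Set ℝ} (hK : IsCompact K) : IsCompact (square K) := by
  rw [square_eq_preimage, Homeomorph.isCompact_preimage]
  exact isCompact_univ_pi fun _ => hK

theorem dense_square {U : Set ℝ} (hU : Dense U) : Dense (square U) := by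
  rw [square_eq_preimage]
  exact (dense_pi univ fun _ _ => hU).preimage (Homeomorph.isOpenMap _)

theorem frontier_square {U : Set ℝ} (hU : IsOpen U) (hd : Dense U) :
    frontier (square U) = (square U)ᶜ := by
  rw [(isOpen_square hU).frontier_eq, (dense_square hd).closure_eq, compl_eq_univ_sdiff]

theorem le_volume_ball_inter_compl_square {U : Set ℝ} (hU : MeasurableSet U) {c : ℝ} (hc : 0 < c)
    (h : ∀ x ∉ U, ∀ r : ℝ, 0 < r →
      ENNReal.ofReal (c * r) ≤ volume (Uᶜ ∩ Ioo (x - r) (x + r)))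
    {x : Euc 2} (hx : x ∈ (square U)ᶜ) {r : ℝ} (hr : 0 < r) :
    ENNReal.ofReal (c / 2 * r ^ 2) ≤ volume (ball x r ∩ (square U)ᶜ) := by
  obtain ⟨i, hi⟩ : ∃ i, x i ∉ U := by
    simpa only [square, mem_compl_iff, mem_ofPred_eq, not_forall] using hx
  obtain ⟨j, hij⟩ := exists_ne i
  calc ENNReal.ofReal (c / 2 * r ^ 2)
      = ENNReal.ofReal (c * (r / 2)) * ENNReal.ofReal r := by
        rw [← ENNReal.ofReal_mul (by positivity)]; congr 1; ring
    _ ≤ volume (Uᶜ ∩ Ioo (x i - r / 2) (x i + r / 2)) *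
          volume (Ioo (x j - r / 2) (x j + r / 2)) := by
        gcongr
        · exact h _ hi _ (by positivity)
        · rw [Real.volume_Ioo]
          exact ENNReal.ofReal_le_ofReal (by linarith)
    _ = _ := (volume_euc_two hij.symm (hU.compl.inter measurableSet_Ioo) measurableSet_Ioo).symm
    _ ≤ _ := by
        refine measure_mono fun y hy => ⟨?_, fun hyU => hy.1.1 (hyU i)⟩
        rw [mem_ball, dist_comm, dist_euc_two hij.symm, Real.sqrt_lt' hr]
        have h1 : (x i - y i) ^ 2 < (r / 2) ^ 2 :=
          sq_lt_sq' (by linarith [hy.1.2.2]) (by linarith [hy.1.2.1])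
        have h2 : (x j - y j) ^ 2 < (r / 2) ^ 2 :=
          sq_lt_sq' (by linarith [hy.2.2]) (by linarith [hy.2.1])
        nlinarith

theorem uniformlyFat_frontier_square {s p : ℝ} (hp1 : 1 < p) (hs0 : 0 < s) (hs1 : s < 1)
    (hsp : s * p < 2) {U : Set ℝ} (hU : IsOpen U) (hd : Dense U) {c : ℝ} (hc : 0 < c)
    (h : ∀ x ∉ U, ∀ r : ℝ, 0 < r →
      ENNReal.ofReal (c * r) ≤ volume (Uᶜ ∩ Ioo (x - r) (x + r))) :
    UniformlyFat 2 s p (frontier (square U)) := by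
  rw [frontier_square hU hd]
  exact uniformlyFat_of_volume hp1 hs0 hs1 hsp (isOpen_square hU).measurableSet.compl
    (half_pos hc) fun x hx r hr => le_volume_ball_inter_compl_square hU.measurableSet hc h hx hr

theorem ofReal_log_le_lintegral_inv {a b c : ℝ} (hb : 0 < b) (hbc : b ≤ c) :
    ENNReal.ofReal (Real.log (c / b)) ≤ ∫⁻ t in Icc (a + b) (a + c), ENNReal.ofReal (t - a)⁻¹ := by
  have hcont : ContinuousOn (fun t : ℝ => (t - a)⁻¹) (Icc (a + b) (a + c)) :=
    ContinuousOn.inv₀ (by fun_prop) fun t ht => by linarith [ht.1]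
  rw [← ofReal_integral_eq_lintegral_ofReal (hcont.integrableOn_Icc), integral_Icc_eq_integral_Ioc,
    ← intervalIntegral.integral_of_le (by linarith),
    intervalIntegral.integral_comp_sub_right (fun t => t⁻¹), add_sub_cancel_left,
    add_sub_cancel_left, integral_inv_of_pos hb (hb.trans_le hbc)]
  refine (ae_restrict_iff' measurableSet_Icc).2 (Filter.Eventually.of_forall fun t ht => ?_)
  exact inv_nonneg.2 (by linarith [ht.1])

section Test

variable {U : Set ℝ} {a l ε : ℝ}

/-- The test function on the plane obtained from the cutoff function of an interval. -/
def testFun (ε a l : ℝ) (x : Euc 2) : ℝ := cutoff ε a l (x 0) * cutoff ε a l (x 1)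

theorem contDiff_testFun (ε a l : ℝ) : ContDiff ℝ (⊤ : ℕ∞) (testFun ε a l) := by
  have h := contDiff_cutoff ε a l
  exact (h.comp (by fun_prop : ContDiff ℝ (⊤ : ℕ∞) fun x : Euc 2 => x 0)).mul
    (h.comp (by fun_prop : ContDiff ℝ (⊤ : ℕ∞) fun x : Euc 2 => x 1))

theorem tsupport_testFun_subset (hε : 0 < ε) (hl : 0 < l) :
    tsupport (testFun ε a l) ⊆ square (Icc (a + ε * l / 2) (a + l - ε * l / 2)) := by
  refine closure_minimal (fun x hx => ?_) (isCompact_square isCompact_Icc).isClosed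
  rw [square_eq zero_ne_one]
  exact ⟨mem_of_cutoff_ne_zero hε hl (left_ne_zero_of_mul hx),
    mem_of_cutoff_ne_zero hε hl (right_ne_zero_of_mul hx)⟩

theorem le_hardy_lhs {α : ℝ} (hα : 0 < α) (hα1 : α ≤ 1) (p : ℝ) (hU : IsOpen U) (hd : Dense U)
    (hl : 0 < l) (hIU : Ioo a (a + l) ⊆ U) (ha : a ∉ U) (hε : 0 < ε) (hε' : ε ≤ 1 / 4) :
    ENNReal.ofReal (l / 2 * ((ε * l) ^ (1 - α) * Real.log (1 / (2 * ε)))) ≤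
      ∫⁻ x in square U,
        ENNReal.ofReal (|testFun ε a l x| ^ p / infDist x (frontier (square U)) ^ α) := by
  have hεl : 0 < ε * l := by positivity
  have hεl' : ε * l ≤ l / 4 := by nlinarith
  set A := Icc (a + ε * l) (a + l / 2)
  set B := Icc (a + l / 4) (a + l * (3 / 4))
  have hsub : {x : Euc 2 | x 0 ∈ A ∧ x 1 ∈ B} ⊆ square U := fun x hx => by
    rw [square_eq zero_ne_one]
    exact ⟨hIU ⟨by linarith [hx.1.1], by linarith [hx.1.2]⟩,
      hIU ⟨by linarith [hx.2.1], by linarith [hx.2.2]⟩⟩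
  have hAB : MeasurableSet {x : Euc 2 | x 0 ∈ A ∧ x 1 ∈ B} :=
    (measurableSet_Icc.preimage (by fun_prop : Measurable fun x : Euc 2 => x 0)).inter
      (measurableSet_Icc.preimage (by fun_prop : Measurable fun x : Euc 2 => x 1))
  refine le_trans ?_ (lintegral_mono_set hsub)
  calc ENNReal.ofReal (l / 2 * ((ε * l) ^ (1 - α) * Real.log (1 / (2 * ε))))
      = ENNReal.ofReal (l / 2) * (ENNReal.ofReal ((ε * l) ^ (1 - α)) *
          ENNReal.ofReal (Real.log (l / 2 / (ε * l)))) := by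
        rw [← ENNReal.ofReal_mul (by positivity), ← ENNReal.ofReal_mul (by positivity)]
        congr 4
        field_simp
    _ ≤ ENNReal.ofReal (l / 2) *
          (ENNReal.ofReal ((ε * l) ^ (1 - α)) * ∫⁻ t in A, ENNReal.ofReal (t - a)⁻¹) := by
        gcongr
        exact ofReal_log_le_lintegral_inv hεl (by linarith)
    _ ≤ ENNReal.ofReal (l / 2) * ∫⁻ t in A, ENNReal.ofReal (1 / (t - a) ^ α) := by
        rw [← lintegral_const_mul' _ _ ENNReal.ofReal_ne_top]
        refine mul_le_mul_right (setLIntegral_mono' measurableSet_Icc fun t ht => ?_) _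
        have hta : 0 < t - a := by linarith [ht.1]
        rw [← ENNReal.ofReal_mul (by positivity)]
        refine ENNReal.ofReal_le_ofReal ?_
        calc (ε * l) ^ (1 - α) * (t - a)⁻¹ ≤ (t - a) ^ (1 - α) * (t - a)⁻¹ := by
              gcongr
              exact le_sub_iff_add_le'.2 ht.1
          _ = _ := by
              rw [Real.rpow_sub hta, Real.rpow_one]
              field_simp
    _ = ∫⁻ x in {x : Euc 2 | x 0 ∈ A ∧ x 1 ∈ B}, ENNReal.ofReal (1 / (x 0 - a) ^ α) := by
        rw [setLIntegral_euc_two zero_ne_one measurableSet_Icc measurableSet_Icc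
          (f := fun t _ => ENNReal.ofReal (1 / (t - a) ^ α)) (by unfold Function.uncurry; fun_prop)]
        simp_rw [setLIntegral_const]
        rw [lintegral_mul_const' _ _ (by rw [Real.volume_Icc]; exact ENNReal.ofReal_ne_top),
          mul_comm, Real.volume_Icc]
        congr 2
        ring
    _ ≤ _ := by
        refine setLIntegral_mono' hAB fun x hx => ENNReal.ofReal_le_ofReal ?_
        have hx0 : 0 < x 0 - a := by linarith [hx.1.1]
        have hu : testFun ε a l x = 1 := by
          unfold testFun
          rw [cutoff_eq_one hε hl ⟨hx.1.1, by linarith [hx.1.2]⟩,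
            cutoff_eq_one hε hl ⟨by linarith [hx.2.1], by linarith [hx.2.2]⟩, one_mul]
        have hmem : !₂[a, x 1] ∈ frontier (square U) := by
          rw [frontier_square hU hd]
          exact fun h => ha (by simpa using h 0)
        have hle : infDist x (frontier (square U)) ≤ x 0 - a := by
          refine (infDist_le_dist_of_mem hmem).trans_eq ?_
          rw [dist_euc_two zero_ne_one]
          simp [Real.sqrt_sq hx0.le]
        have hpos : 0 < infDist x (frontier (square U)) := by
          refine (isClosed_frontier.notMem_iff_infDist_pos ⟨_, hmem⟩).1 ?_
          rw [frontier_square hU hd]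
          exact fun h => h (hsub hx)
        rw [hu, abs_one, Real.one_rpow]
        gcongr

end Test

theorem not_admitsHardy_square {s p : ℝ} (hp1 : 1 < p) (hs1 : s < 1)
    (hsp0 : 0 < s * p) (hsp1 : s * p ≤ 1) {U : Set ℝ} (hU : IsOpen U) (hd : Dense U)
    (h : ∀ R : ℝ, 0 < R → ∀ δ : ℝ, 0 < δ → ∃ a l : ℝ, 0 < l ∧ Ioo a (a + l) ⊆ U ∧ a ∉ U ∧
      volume ((U \ Ioo a (a + l)) ∩ Icc (a - R * l) (a + l + R * l)) ≤ ENNReal.ofReal (δ * l)) :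
    ¬ AdmitsHardy 2 s p (square U) := by
  rintro ⟨c, hc, hardy⟩
  have hp0 : 0 < p := by linarith
  obtain ⟨C, hC, hen⟩ := exists_energy_bound hsp0 (mul_lt_of_lt_one_left hp0 hs1)
  obtain ⟨m, hm0, hm⟩ := exists_line_bound hsp0
  set Q := c * (2 ^ p * (2 * m)) * C * 2 with hQ
  have hQ0 : 0 < Q := by positivity
  set ε := Real.exp (-(Q + 1)) / 2 with hε_def
  have hε : 0 < ε := by positivity
  have hε4 : ε ≤ 1 / 4 := by
    have h1 : Q + 1 + 1 ≤ Real.exp (Q + 1) := Real.add_one_le_exp _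
    have h2 : Real.exp (-(Q + 1)) ≤ 2⁻¹ := by
      rw [Real.exp_neg]
      exact inv_anti₀ (by norm_num) (by linarith)
    rw [hε_def]; linarith
  have hlog : Real.log (1 / (2 * ε)) = Q + 1 := by
    rw [hε_def, mul_div_cancel₀ _ (two_ne_zero), one_div, ← Real.exp_neg, neg_neg, Real.log_exp]
  obtain ⟨R, hR, δ, hδ, hE⟩ := hen ε hε
  obtain ⟨a, l, hl, hIU, ha, hvol⟩ := h R hR δ hδ
  have hεl : 0 < ε * l := by positivity
  have hts := tsupport_testFun_subset (a := a) hε hl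
  have hsq : tsupport (testFun ε a l) ⊆ square U := fun x hx i =>
    hIU ⟨by linarith [(hts hx i).1], by linarith [(hts hx i).2]⟩
  have hH := hardy (testFun ε a l) (contDiff_testFun ε a l)
    ((isCompact_square isCompact_Icc).of_isClosed_subset (isClosed_tsupport _) hts) hsq
  have hL := (le_hardy_lhs hsp0 hsp1 p hU hd hl hIU ha hε hε4).trans hH
  have hJ (t : ℝ) (ht : cutoff ε a l t ≠ 0) : t ∈ Icc a (a + l) := by
    have := mem_of_cutoff_ne_zero hε hl ht
    exact ⟨by linarith [this.1], by linarith [this.2]⟩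
  have hS := energy_square_le hm hm0 hp0 (contDiff_cutoff ε a l).continuous (cutoff_nonneg ε a l)
    (cutoff_le_one ε a l) hJ hU.measurableSet measurableSet_Icc
  have hfin := hL.trans (mul_le_mul_right
    (hS.trans (mul_le_mul_right (hE U a l hU.measurableSet hl hvol) _)) _)
  rw [Real.volume_Icc, add_sub_cancel_left, ← ENNReal.ofReal_mul (by positivity),
    ← ENNReal.ofReal_mul (by positivity), ← ENNReal.ofReal_mul (by positivity),
    ENNReal.ofReal_le_ofReal_iff (by positivity), hlog] at hfin
  have hY : 0 < l * (ε * l) ^ (1 - s * p) := by positivity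
  nlinarith

/-- For `1<p<∞`, `0<s<1` with `0<sp≤1`, there is an open set `G ⊆ ℝ²` whose
boundary is `(s,p)`-uniformly fat but which does not admit the `(s,p)`-Hardy inequality. -/
theorem statement12 (s p : ℝ) (hp1 : 1 < p) (hs0 : 0 < s) (hs1 : s < 1)
    (hsp0 : 0 < s * p) (hsp1 : s * p ≤ 1) :
    ∃ G : Set (Euc 2), IsOpen G ∧ G ≠ Set.univ ∧
      UniformlyFat 2 s p (frontier G) ∧ ¬ AdmitsHardy 2 s p G := by
  obtain ⟨U, hU, hd, ⟨z, hz⟩, ⟨c, hc, hfat⟩, hgap⟩ := exists_fat_complement_isolated_gaps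
  refine ⟨square U, isOpen_square hU, fun h => ?_,
    uniformlyFat_frontier_square hp1 hs0 hs1 (by linarith) hU hd hc hfat,
    not_admitsHardy_square hp1 hs1 hsp0 hsp1 hU hd hgap⟩
  have : !₂[z, z] ∈ square U := h ▸ mem_univ _
  exact hz (by simpa using this 0)

end
end

section
/- Let 1<p<∞ and 0<s<1 be such that sp<n, with n ≥ 2. Assume that G′ ⊂ G ⊊ ℝⁿ are open sets such that the complement (G′)^c is (s,p)-uniformly fat, G admits the (s,p)-Hardy inequality, and the Lebesgue measure of G∖G′ is zero. Then G′ admits the (s,p)-Hardy inequality. -/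
open MeasureTheory Metric Set
open scoped ENNReal NNReal Topology

noncomputable section

lemma lintegral_norm_radial_le (n : ℕ) (hn : 0 < n) :
    ∃ V : ℝ, 0 < V ∧ ∀ f : ℝ → ℝ, Measurable f → (∀ r, 0 ≤ f r) →
      ∫⁻ x : Euc n, ENNReal.ofReal (f ‖x‖) ≤
        ENNReal.ofReal V * ∫⁻ r in Ioi (0 : ℝ), ENNReal.ofReal (r ^ (n - 1) * f r) := by
  have : Nonempty (Fin n) := ⟨⟨0, hn⟩⟩
  have hV : 0 < (n : ℝ) * volume.real (ball (0 : Euc n) 1) := by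
    have : 0 < volume.real (ball (0 : Euc n) 1) :=
      ENNReal.toReal_pos (measure_ball_pos _ _ one_pos).ne' measure_ball_lt_top.ne
    positivity
  refine ⟨_, hV, fun f hf hf0 => ?_⟩
  have hmeas : Measurable fun r : ℝ => r ^ (n - 1) * f r := by fun_prop
  have h0 : ∀ᵐ r ∂volume.restrict (Ioi (0 : ℝ)), 0 ≤ r ^ (n - 1) * f r := by
    filter_upwards [ae_restrict_mem measurableSet_Ioi] with r hr
    exact mul_nonneg (pow_nonneg (le_of_lt hr) _) (hf0 r)
  by_cases htop : ∫⁻ r in Ioi (0 : ℝ), ENNReal.ofReal (r ^ (n - 1) * f r) = ∞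
  · rw [htop, ENNReal.mul_top (ENNReal.ofReal_pos.2 hV).ne']
    exact le_top
  have hint : IntegrableOn (fun r : ℝ => r ^ (n - 1) * f r) (Ioi 0) :=
    ⟨hmeas.aestronglyMeasurable,
      (hasFiniteIntegral_iff_ofReal h0).2 (lt_top_iff_ne_top.2 htop)⟩
  have hint' : Integrable (fun x : Euc n => f ‖x‖) := by
    rw [integrable_fun_norm_addHaar]
    simpa using hint
  rw [← ofReal_integral_eq_lintegral_ofReal hint h0,
    ← ofReal_integral_eq_lintegral_ofReal hint' (.of_forall fun x => hf0 _),
    integral_fun_norm_addHaar, ← ENNReal.ofReal_mul hV.le]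
  simp [mul_assoc]

lemma lintegral_Ioi_rpow_neg (a b : ℝ) (ha : 0 < a) (hb : 0 < b) :
    ∫⁻ r in Ioi a, ENNReal.ofReal (r ^ (-1 - b)) = ENNReal.ofReal (a ^ (-b) / b) := by
  rw [← ofReal_integral_eq_lintegral_ofReal (integrableOn_Ioi_rpow_of_lt (by linarith) ha),
    integral_Ioi_rpow_of_lt (by linarith) ha]
  · congr 1
    rw [show -1 - b + 1 = -b by ring, div_neg, neg_div, neg_neg]
  · filter_upwards [ae_restrict_mem measurableSet_Ioi] with r hr
    exact Real.rpow_nonneg (ha.le.trans (le_of_lt hr)) _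

lemma lintegral_Ioc_rpow (a c : ℝ) (ha : 0 < a) (hc : 0 < c) :
    ∫⁻ r in Ioc 0 a, ENNReal.ofReal (r ^ (c - 1)) = ENNReal.ofReal (a ^ c / c) := by
  have hint : IntervalIntegrable (fun r : ℝ => r ^ (c - 1)) volume 0 a :=
    intervalIntegral.intervalIntegrable_rpow' (by linarith)
  rw [← ofReal_integral_eq_lintegral_ofReal
    ((intervalIntegrable_iff_integrableOn_Ioc_of_le ha.le).1 hint),
    ← intervalIntegral.integral_of_le ha.le, integral_rpow (Or.inl (by linarith))]
  · simp [Real.zero_rpow hc.ne']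
  · filter_upwards [ae_restrict_mem measurableSet_Ioc] with r hr
    exact Real.rpow_nonneg hr.1.le _

/-- The weight `(M + |x - y|)^{-n-β}` has total mass at most `V M^{-β} / β`. -/
lemma lintegral_add_dist_rpow_le (n : ℕ) (hn : 0 < n) :
    ∃ V : ℝ, 0 < V ∧ ∀ (y : Euc n) (M β : ℝ), 0 < M → 0 < β →
      ∫⁻ x : Euc n, ENNReal.ofReal ((M + dist x y) ^ (-(n : ℝ) - β)) ≤
        ENNReal.ofReal (V * (M ^ (-β) / β)) := by
  obtain ⟨V, hV, h⟩ := lintegral_norm_radial_le n hn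
  refine ⟨V, hV, fun y M β hM hβ => ?_⟩
  have e1 : ∫⁻ x : Euc n, ENNReal.ofReal ((M + dist x y) ^ (-(n : ℝ) - β)) =
      ∫⁻ x : Euc n, ENNReal.ofReal ((M + |‖x‖|) ^ (-(n : ℝ) - β)) := by
    simp_rw [dist_eq_norm, abs_norm]
    exact lintegral_sub_right_eq_self
      (fun x : Euc n => ENNReal.ofReal ((M + ‖x‖) ^ (-(n : ℝ) - β))) y
  rw [e1, ENNReal.ofReal_mul hV.le]
  refine (h (fun r => (M + |r|) ^ (-(n : ℝ) - β)) ?_ fun r => by positivity).trans ?_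
  · fun_prop
  gcongr
  calc _ ≤ ∫⁻ r in Ioi (0 : ℝ), ENNReal.ofReal ((r + M) ^ (-1 - β)) := by
        refine setLIntegral_mono (by fun_prop) fun r (hr : 0 < r) => ENNReal.ofReal_le_ofReal ?_
        rw [abs_of_pos hr, show -1 - β = ((n : ℝ) - 1) + (-(n : ℝ) - β) by ring,
          Real.rpow_add (by positivity), add_comm M]
        gcongr
        rw [← Real.rpow_natCast, Nat.cast_sub hn, Nat.cast_one]
        have : (1 : ℝ) ≤ n := by exact_mod_cast hn
        exact Real.rpow_le_rpow hr.le (by linarith) (by linarith)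
    _ = ∫⁻ r in Ioi M, ENNReal.ofReal (r ^ (-1 - β)) := by
        have := (measurePreserving_add_right (volume : Measure ℝ) M).setLIntegral_comp_preimage_emb
          (measurableEmbedding_addRight M) (fun r => ENNReal.ofReal (r ^ (-1 - β))) (Ioi M)
        simpa using this
    _ = _ := lintegral_Ioi_rpow_neg M β hM hβ
    _ ≤ _ := le_rfl

lemma log_one_add_le_rpow (t a : ℝ) (ht : 1 ≤ t) (ha : 0 < a) :
    Real.log (1 + t) ≤ 1 / a * (2 * t) ^ a := by
  have := Real.log_le_rpow_div (x := 2 * t) (by linarith) ha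
  have h2 := Real.log_le_log (x := 1 + t) (y := 2 * t) (by linarith) (by linarith)
  rw [one_div_mul_eq_div]
  exact h2.trans this

/-- The logarithmic kernel has mass comparable with `δ^{-sp}`. -/
lemma lintegral_log_kernel_le (n : ℕ) (hn : 0 < n) (s p : ℝ) (hs0 : 0 < s) (hs1 : s < 1)
    (hp : 0 < p) :
    ∃ K : ℝ, 0 < K ∧ ∀ (y : Euc n) (δ : ℝ), 0 < δ →
      ∫⁻ z : Euc n, ENNReal.ofReal
        (Real.log (1 + dist z y / δ) ^ p / dist z y ^ ((n : ℝ) + s * p)) ≤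
        ENNReal.ofReal (K * δ ^ (-(s * p))) := by
  obtain ⟨V, hV, h⟩ := lintegral_norm_radial_le n hn
  have hsp : 0 < s * p := by positivity
  have hps : 0 < p - s * p := by nlinarith
  set A : ℝ := (2 / s * 2 ^ (s / 2)) ^ p with hA
  have hA0 : 0 < A := by positivity
  refine ⟨V * (1 / (p - s * p) + A / (s * p / 2)), by positivity, fun y δ hδ => ?_⟩
  have e1 : ∫⁻ z : Euc n, ENNReal.ofReal
        (Real.log (1 + dist z y / δ) ^ p / dist z y ^ ((n : ℝ) + s * p)) =
      ∫⁻ x : Euc n, ENNReal.ofReal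
        (Real.log (1 + |‖x‖| / δ) ^ p / |‖x‖| ^ ((n : ℝ) + s * p)) := by
    simp_rw [dist_eq_norm, abs_norm]
    exact lintegral_sub_right_eq_self
      (fun x : Euc n => ENNReal.ofReal
        (Real.log (1 + ‖x‖ / δ) ^ p / ‖x‖ ^ ((n : ℝ) + s * p))) y
  have hlog : ∀ r : ℝ, 0 ≤ Real.log (1 + |r| / δ) := fun r =>
    Real.log_nonneg (by have : 0 ≤ |r| / δ := by positivity
                        linarith)
  rw [e1]
  refine (h (fun r => Real.log (1 + |r| / δ) ^ p / |r| ^ ((n : ℝ) + s * p)) ?_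
    fun r => div_nonneg (Real.rpow_nonneg (hlog r) _) (by positivity)).trans ?_
  · fun_prop
  rw [mul_assoc, ENNReal.ofReal_mul hV.le]
  gcongr
  have hpow : ∀ r : ℝ, 0 < r → r ^ (n - 1) / r ^ ((n : ℝ) + s * p) = r ^ (-1 - s * p) := by
    intro r hr
    rw [← Real.rpow_natCast, ← Real.rpow_sub hr, Nat.cast_sub hn, Nat.cast_one]
    congr 1; ring
  rw [← Ioc_union_Ioi_eq_Ioi hδ.le]
  refine (lintegral_union_le _ _ _).trans ?_
  rw [add_mul, ENNReal.ofReal_add (by positivity) (by positivity)]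
  gcongr
  · calc _ ≤ ∫⁻ r in Ioc 0 δ, ENNReal.ofReal (δ ^ (-p)) * ENNReal.ofReal (r ^ ((p - s * p) - 1)) := by
          refine setLIntegral_mono (by fun_prop) fun r hr => ?_
          have hr0 : 0 < r := hr.1
          rw [← ENNReal.ofReal_mul (by positivity)]
          refine ENNReal.ofReal_le_ofReal ?_
          have hl := hlog r
          rw [abs_of_pos hr0] at hl ⊢
          have h1 : Real.log (1 + r / δ) ≤ r / δ := by
            have := Real.log_le_sub_one_of_pos (x := 1 + r / δ) (by positivity)
            linarith
          calc _ = (r ^ (n - 1) / r ^ ((n : ℝ) + s * p)) * Real.log (1 + r / δ) ^ p := by ring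
            _ ≤ r ^ (-1 - s * p) * (r / δ) ^ p := by
                rw [hpow r hr0]; gcongr
            _ = _ := by
                rw [Real.div_rpow hr0.le hδ.le, Real.rpow_neg hδ.le,
                  show p - s * p - 1 = (-1 - s * p) + p by ring, Real.rpow_add hr0]
                ring
      _ = ENNReal.ofReal (1 / (p - s * p) * δ ^ (-(s * p))) := by
          rw [lintegral_const_mul _ (by fun_prop), lintegral_Ioc_rpow _ _ hδ hps,
            ← ENNReal.ofReal_mul (by positivity)]
          congr 1
          rw [mul_div_assoc', ← Real.rpow_add hδ]
          rw [show -p + (p - s * p) = -(s * p) by ring]; ring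
  · calc _ ≤ ∫⁻ r in Ioi δ, ENNReal.ofReal (A * δ ^ (-(s * p / 2))) *
            ENNReal.ofReal (r ^ (-1 - s * p / 2)) := by
          refine setLIntegral_mono (by fun_prop) fun r (hr : δ < r) => ?_
          have hr0 : 0 < r := hδ.trans hr
          rw [← ENNReal.ofReal_mul (by positivity)]
          refine ENNReal.ofReal_le_ofReal ?_
          have hl := hlog r
          rw [abs_of_pos hr0] at hl ⊢
          have h1 : Real.log (1 + r / δ) ≤ (2 / s * 2 ^ (s / 2)) * (r / δ) ^ (s / 2) := by
            have := log_one_add_le_rpow (r / δ) (s / 2) ((one_le_div hδ).2 hr.le) (by positivity)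
            rw [Real.mul_rpow (by positivity) (by positivity)] at this
            convert this using 1
            field_simp
          calc _ = (r ^ (n - 1) / r ^ ((n : ℝ) + s * p)) * Real.log (1 + r / δ) ^ p := by ring
            _ ≤ r ^ (-1 - s * p) * ((2 / s * 2 ^ (s / 2)) * (r / δ) ^ (s / 2)) ^ p := by
                rw [hpow r hr0]; gcongr
            _ = _ := by
                rw [Real.mul_rpow (by positivity) (by positivity), ← Real.rpow_mul (by positivity),
                  Real.div_rpow hr0.le hδ.le, Real.rpow_neg hδ.le,
                  show -1 - s * p / 2 = (-1 - s * p) + s / 2 * p by ring, Real.rpow_add hr0,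
                  show s / 2 * p = s * p / 2 by ring]
                ring
      _ = ENNReal.ofReal (A / (s * p / 2) * δ ^ (-(s * p))) := by
          rw [lintegral_const_mul _ (by fun_prop), lintegral_Ioi_rpow_neg _ _ hδ (by positivity),
            ← ENNReal.ofReal_mul (by positivity)]
          congr 1
          rw [show -(s * p) = -(s * p / 2) + -(s * p / 2) by ring, Real.rpow_add hδ]
          ring

/-- The `p`-Gagliardo kernel of `u`. -/
def gagliardoKernel (n : ℕ) (s p : ℝ) (u : Euc n → ℝ) (y z : Euc n) : ℝ≥0∞ :=
  ENNReal.ofReal (|u y - u z| ^ p / dist y z ^ ((n : ℝ) + s * p))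

lemma measurable_gagliardoKernel (n : ℕ) (s p : ℝ) {u : Euc n → ℝ} (hu : Continuous u) :
    Measurable (Function.uncurry (gagliardoKernel n s p u)) := by
  have h1 : Measurable fun q : Euc n × Euc n => |u q.1 - u q.2| ^ p :=
    ((hu.comp continuous_fst).sub (hu.comp continuous_snd)).abs.measurable.pow_const p
  have h2 : Measurable fun q : Euc n × Euc n => dist q.1 q.2 ^ ((n : ℝ) + s * p) :=
    continuous_dist.measurable.pow_const _
  exact (h1.div h2).ennreal_ofReal

lemma measurable_gagliardoKernel_right (n : ℕ) (s p : ℝ) {u : Euc n → ℝ} (hu : Continuous u)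
    (y : Euc n) : Measurable (gagliardoKernel n s p u y) :=
  (measurable_gagliardoKernel n s p hu).of_uncurry_left

lemma ofReal_abs_sub_rpow_le_gagliardoKernel (n : ℕ) (s p : ℝ) (hs : 0 ≤ s) (hp : 0 < p)
    (u : Euc n → ℝ) {y z : Euc n} {D : ℝ} (hD : dist y z ≤ D) :
    ENNReal.ofReal (|u y - u z| ^ p) ≤
      ENNReal.ofReal (D ^ ((n : ℝ) + s * p)) * gagliardoKernel n s p u y z := by
  have hD0 : 0 ≤ D := dist_nonneg.trans hD
  rw [gagliardoKernel, ← ENNReal.ofReal_mul (by positivity)]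
  refine ENNReal.ofReal_le_ofReal ?_
  rcases eq_or_ne y z with rfl | hyz
  · simp [Real.zero_rpow hp.ne']
  have hd : 0 < dist y z := dist_pos.2 hyz
  rw [mul_div_assoc', le_div_iff₀ (by positivity), mul_comm]
  gcongr

/-- The dyadic half-open annulus around `w`. -/
def annulus {n : ℕ} (w : Euc n) (r : ℝ) : Set (Euc n) := ball w r \ ball w (r / 2)

lemma measurableSet_annulus {n : ℕ} (w : Euc n) (r : ℝ) : MeasurableSet (annulus w r) :=
  measurableSet_ball.diff measurableSet_ball

lemma annulus_subset_ball {n : ℕ} (w : Euc n) (r : ℝ) : annulus w r ⊆ ball w r := sdiff_subset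

lemma volume_annulus (n : ℕ) (hn : 0 < n) :
    ∃ c : ℝ, 0 < c ∧ ∀ (w : Euc n) (r : ℝ), 0 < r →
      volume (annulus w r) = ENNReal.ofReal (c * r ^ n) := by
  have : Nonempty (Fin n) := ⟨⟨0, hn⟩⟩
  have hV : 0 < volume.real (ball (0 : Euc n) 1) :=
    ENNReal.toReal_pos (measure_ball_pos _ _ one_pos).ne' measure_ball_lt_top.ne
  have hV' : volume (ball (0 : Euc n) 1) = ENNReal.ofReal (volume.real (ball (0 : Euc n) 1)) := by
    rw [measureReal_def, ENNReal.ofReal_toReal measure_ball_lt_top.ne]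
  have hpow : (1 / 2 : ℝ) ^ n < 1 := pow_lt_one₀ (by norm_num) (by norm_num) hn.ne'
  refine ⟨(1 - (1 / 2) ^ n) * volume.real (ball (0 : Euc n) 1),
    mul_pos (by linarith) hV, fun w r hr => ?_⟩
  rw [annulus, measure_sdiff (ball_subset_ball (by linarith)) measurableSet_ball.nullMeasurableSet
    measure_ball_lt_top.ne, Measure.addHaar_ball _ w hr.le,
    Measure.addHaar_ball _ w (half_pos hr).le,
    hV', ← ENNReal.ofReal_mul (by positivity), ← ENNReal.ofReal_mul (by positivity),
    ← ENNReal.ofReal_sub _ (by positivity), finrank_euclideanSpace, Fintype.card_fin]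
  congr 1
  rw [div_eq_mul_one_div r 2, mul_pow]
  ring

lemma volume_annulus_ne_zero {n : ℕ} (hn : 0 < n) (w : Euc n) {r : ℝ} (hr : 0 < r) :
    volume (annulus w r) ≠ 0 := by
  obtain ⟨c, hc, h⟩ := volume_annulus n hn
  rw [h w r hr]
  exact (ENNReal.ofReal_pos.2 (by positivity)).ne'

lemma volume_annulus_ne_top {n : ℕ} (w : Euc n) (r : ℝ) : volume (annulus w r) ≠ ∞ :=
  ((measure_mono (annulus_subset_ball w r)).trans_lt measure_ball_lt_top).ne

lemma integrableOn_annulus {n : ℕ} {u : Euc n → ℝ} (hu : Continuous u) (w : Euc n) (r : ℝ) :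
    IntegrableOn u (annulus w r) :=
  (hu.continuousOn.integrableOn_compact (isCompact_closedBall w r)).mono_set
    ((annulus_subset_ball w r).trans ball_subset_closedBall)

lemma enorm_setAverage_sub_le {α : Type*} [MeasurableSpace α] {μ : Measure α} {A : Set α}
    (h0 : μ A ≠ 0) (htop : μ A ≠ ∞) {u : α → ℝ} (hu : IntegrableOn u A μ) (c : ℝ) :
    ‖(⨍ z in A, u z ∂μ) - c‖ₑ ≤ ⨍⁻ z in A, ‖u z - c‖ₑ ∂μ := by
  have : Fact (μ A < ∞) := ⟨lt_top_iff_ne_top.2 htop⟩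
  have : NeZero (μ.restrict A) := ⟨by simpa [Measure.restrict_eq_zero] using h0⟩
  have h : (⨍ z in A, u z ∂μ) - c = ⨍ z in A, (u z - c) ∂μ := by
    conv_lhs => rw [← setAverage_const h0 htop c]
    simp only [average]
    rw [integral_sub (Integrable.to_average hu) (integrable_const c)]
  rw [h]
  exact enorm_integral_le_lintegral_enorm _

lemma setLAverage_le_rpow_setLAverage {α : Type*} [MeasurableSpace α] {μ : Measure α} {A : Set α}
    (h0 : μ A ≠ 0) (htop : μ A ≠ ∞) {p : ℝ} (hp : 1 ≤ p) {g : α → ℝ} (hg : Measurable g) :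
    ⨍⁻ z in A, ‖g z‖ₑ ∂μ ≤ (⨍⁻ z in A, ‖g z‖ₑ ^ p ∂μ) ^ (1 / p) := by
  have : Fact (μ A < ∞) := ⟨lt_top_iff_ne_top.2 htop⟩
  have : NeZero (μ.restrict A) := ⟨by simpa [Measure.restrict_eq_zero] using h0⟩
  have := eLpNorm'_le_eLpNorm'_of_exponent_le one_pos hp
    ((μ.restrict A univ)⁻¹ • μ.restrict A) hg.aestronglyMeasurable
  simpa [eLpNorm', laverage] using this

/-- Oscillation of `u` between a point and an annulus at comparable distance. -/
lemma laverage_annulus_enorm_sub_le (n : ℕ) (hn : 0 < n) (s p : ℝ) (hs : 0 < s) (hp : 1 < p) :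
    ∃ C : ℝ, 0 < C ∧ ∀ u : Euc n → ℝ, Continuous u → ∀ (w y : Euc n) (r : ℝ), 0 < r →
      (∀ z ∈ annulus w r, dist y z ≤ 3 * r) →
      ⨍⁻ z in annulus w r, ‖u z - u y‖ₑ ∂volume ≤
        ENNReal.ofReal (C * r ^ s) * (∫⁻ z in annulus w r, gagliardoKernel n s p u y z) ^ (1 / p) := by
  obtain ⟨c, hc, hvol⟩ := volume_annulus n hn
  have hp0 : 0 < p := by linarith
  refine ⟨(3 ^ ((n : ℝ) + s * p) / c) ^ (1 / p), by positivity, fun u hu w y r hr hz => ?_⟩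
  refine (setLAverage_le_rpow_setLAverage (volume_annulus_ne_zero hn w hr)
    (volume_annulus_ne_top w r) hp.le (hu.measurable.sub_const (u y))).trans ?_
  have h1 : ⨍⁻ z in annulus w r, ‖u z - u y‖ₑ ^ p ∂volume ≤
      ENNReal.ofReal (3 ^ ((n : ℝ) + s * p) / c * r ^ (s * p)) *
        ∫⁻ z in annulus w r, gagliardoKernel n s p u y z := by
    rw [setLAverage_eq, hvol w r hr]
    refine ENNReal.div_le_of_le_mul ?_
    calc ∫⁻ z in annulus w r, ‖u z - u y‖ₑ ^ p
        ≤ ∫⁻ z in annulus w r, ENNReal.ofReal ((3 * r) ^ ((n : ℝ) + s * p)) *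
            gagliardoKernel n s p u y z := by
          refine setLIntegral_mono ((measurable_gagliardoKernel_right n s p hu y).const_mul _)
            fun z hzA => ?_
          refine le_trans (le_of_eq ?_)
            (ofReal_abs_sub_rpow_le_gagliardoKernel n s p hs.le hp0 u (hz z hzA))
          rw [Real.enorm_eq_ofReal_abs, ENNReal.ofReal_rpow_of_nonneg (abs_nonneg _) hp0.le,
            abs_sub_comm]
      _ = _ := by
          rw [lintegral_const_mul _ (measurable_gagliardoKernel_right n s p hu y), mul_right_comm,
            ← ENNReal.ofReal_mul (by positivity)]
          congr 2
          rw [Real.mul_rpow (by norm_num) hr.le, Real.rpow_add hr, Real.rpow_natCast]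
          field_simp
  calc _ ≤ (ENNReal.ofReal (3 ^ ((n : ℝ) + s * p) / c * r ^ (s * p)) *
        ∫⁻ z in annulus w r, gagliardoKernel n s p u y z) ^ (1 / p) := by gcongr
    _ = _ := by
        rw [ENNReal.mul_rpow_of_nonneg _ _ (by positivity),
          ENNReal.ofReal_rpow_of_nonneg (by positivity) (by positivity),
          Real.mul_rpow (by positivity) (by positivity), ← Real.rpow_mul hr.le]
        congr 4
        field_simp

/-- The fractional gradient `y ↦ (∫_B |u(y)-u(z)|^p |y-z|^{-n-sp} dz)^{1/p}` relative to `B`. -/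
def fracGrad (n : ℕ) (s p : ℝ) (B : Set (Euc n)) (u : Euc n → ℝ) (y : Euc n) : ℝ≥0∞ :=
  (∫⁻ z in B, gagliardoKernel n s p u y z) ^ (1 / p)

lemma measurable_fracGrad (n : ℕ) (s p : ℝ) (B : Set (Euc n)) {u : Euc n → ℝ}
    (hu : Continuous u) : Measurable (fracGrad n s p B u) :=
  (Measurable.lintegral_prod_right' (measurable_gagliardoKernel n s p hu)).pow_const _

lemma measurable_riesz_integrand (n : ℕ) (s : ℝ) {f : Euc n → ℝ≥0∞} (hf : Measurable f)
    (w : Euc n) : Measurable fun y => f y * ENNReal.ofReal (dist w y ^ (s - (n : ℝ))) :=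
  hf.mul ((measurable_const.dist measurable_id).pow_const _).ennreal_ofReal

/-- Consecutive annular averages differ by at most a piece of the Riesz potential of the
fractional gradient. -/
lemma enorm_annulus_average_sub_le (n : ℕ) (hn : 0 < n) (s p : ℝ) (hs : 0 < s) (hsn : s < n)
    (hp : 1 < p) :
    ∃ C : ℝ, 0 < C ∧ ∀ u : Euc n → ℝ, Continuous u → ∀ (w : Euc n) (r : ℝ), 0 < r →
      ∀ B : Set (Euc n), ball w r ⊆ B →
      ‖(⨍ z in annulus w (r / 2), u z) - ⨍ z in annulus w r, u z‖ₑ ≤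
        ENNReal.ofReal C * ∫⁻ y in annulus w (r / 2),
          fracGrad n s p B u y * ENNReal.ofReal (dist w y ^ (s - (n : ℝ))) := by
  obtain ⟨c, hc, hvol⟩ := volume_annulus n hn
  obtain ⟨C, hC, hJ⟩ := laverage_annulus_enorm_sub_le n hn s p hs hp
  refine ⟨C * 2 ^ n / c, by positivity, fun u hu w r hr B hB => ?_⟩
  have hr2 : 0 < r / 2 := half_pos hr
  refine (enorm_setAverage_sub_le (volume_annulus_ne_zero hn w hr2)
    (volume_annulus_ne_top w _) (integrableOn_annulus hu w _) _).trans ?_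
  rw [setLAverage_eq, hvol w _ hr2]
  refine ENNReal.div_le_of_le_mul ?_
  have hmeas := measurable_riesz_integrand n s (measurable_fracGrad n s p B hu) w
  rw [mul_right_comm, ← ENNReal.ofReal_mul (by positivity),
    ← lintegral_const_mul _ hmeas]
  refine setLIntegral_mono (hmeas.const_mul _) fun y hy => ?_
  have hyr : dist w y < r / 2 := by rw [dist_comm]; exact hy.1
  have h1 : ‖u y - ⨍ z in annulus w r, u z‖ₑ ≤ ⨍⁻ z in annulus w r, ‖u z - u y‖ₑ ∂volume := by
    rw [← enorm_neg, neg_sub]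
    exact enorm_setAverage_sub_le (volume_annulus_ne_zero hn w hr)
      (volume_annulus_ne_top w _) (integrableOn_annulus hu w _) _
  have h2 := hJ u hu w y r hr fun z hz => by
    have hz' : dist w z < r := by rw [dist_comm]; exact hz.1
    have := dist_triangle y w z
    rw [dist_comm y w] at this
    linarith
  refine h1.trans (h2.trans ?_)
  have h3 : (∫⁻ z in annulus w r, gagliardoKernel n s p u y z) ^ (1 / p) ≤
      fracGrad n s p B u y := by
    unfold fracGrad
    have : 0 < p := by linarith
    gcongr
    exact (annulus_subset_ball w r).trans hB
  have hd : 0 < dist w y := by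
    have : r / 2 / 2 ≤ dist y w := by simpa using hy.2
    rw [dist_comm]; linarith
  calc _ ≤ ENNReal.ofReal (C * r ^ s) * fracGrad n s p B u y := by gcongr
    _ ≤ ENNReal.ofReal (C * 2 ^ n / c * (c * (r / 2) ^ n) * dist w y ^ (s - (n : ℝ))) *
          fracGrad n s p B u y := by
        refine mul_le_mul_left (ENNReal.ofReal_le_ofReal ?_) _
        have h4 : r ^ (s - (n : ℝ)) ≤ dist w y ^ (s - (n : ℝ)) :=
          Real.rpow_le_rpow_of_nonpos hd (by linarith) (by linarith)
        calc C * r ^ s = C * r ^ n * r ^ (s - (n : ℝ)) := by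
              rw [mul_assoc, ← Real.rpow_natCast, ← Real.rpow_add hr]; congr 2; ring
          _ ≤ C * r ^ n * dist w y ^ (s - (n : ℝ)) := by gcongr
          _ = _ := by
              field_simp
              rw [← mul_pow, mul_div_cancel₀ r two_ne_zero]
    _ = _ := by
        rw [ENNReal.ofReal_mul (by positivity), mul_assoc, mul_comm (ENNReal.ofReal (dist _ _ ^ _))]

/-- A continuous function vanishing at `w` has annular averages controlled by the Riesz potential
of its fractional gradient. -/
lemma enorm_annulus_average_le (n : ℕ) (hn : 0 < n) (s p : ℝ) (hs : 0 < s) (hsn : s < n)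
    (hp : 1 < p) :
    ∃ C : ℝ, 0 < C ∧ ∀ u : Euc n → ℝ, Continuous u → ∀ (w : Euc n) (r : ℝ), 0 < r →
      u w = 0 → ∀ B : Set (Euc n), MeasurableSet B → ball w r ⊆ B →
      ‖⨍ z in annulus w r, u z‖ₑ ≤ ENNReal.ofReal C * ∫⁻ y in B,
          fracGrad n s p B u y * ENNReal.ofReal (dist w y ^ (s - (n : ℝ))) := by
  obtain ⟨C, hC, hstep⟩ := enorm_annulus_average_sub_le n hn s p hs hsn hp
  refine ⟨C, hC, fun u hu w r hr hw B hBm hB => ?_⟩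
  set g : Euc n → ℝ≥0∞ :=
    fun y => fracGrad n s p B u y * ENNReal.ofReal (dist w y ^ (s - (n : ℝ)))
  set a : ℕ → ℝ := fun k => ⨍ z in annulus w (r / 2 ^ k), u z
  have hrk : ∀ k : ℕ, 0 < r / 2 ^ k := fun k => by positivity
  have hle : ∀ k : ℕ, r / 2 ^ k ≤ r := fun k => div_le_self hr.le (one_le_pow₀ (by norm_num))
  have hsucc : ∀ k : ℕ, r / 2 ^ (k + 1) = r / 2 ^ k / 2 := fun k => by rw [pow_succ]; field_simp
  have hN : ∀ N : ℕ, ‖a 0‖ₑ ≤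
      ENNReal.ofReal C * (∫⁻ y in ball w (r / 2) \ ball w (r / 2 ^ (N + 1)), g y) + ‖a N‖ₑ := by
    intro N
    induction N with
    | zero => exact le_add_self
    | succ N ih =>
      have h1 : ‖a N‖ₑ ≤ ENNReal.ofReal C * (∫⁻ y in annulus w (r / 2 ^ (N + 1)), g y) +
          ‖a (N + 1)‖ₑ := by
        have h := hstep u hu w (r / 2 ^ N) (hrk N) B ((ball_subset_ball (hle N)).trans hB)
        rw [← hsucc] at h
        calc ‖a N‖ₑ = ‖a (N + 1) - (a (N + 1) - a N)‖ₑ := by rw [sub_sub_cancel]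
          _ ≤ ‖a (N + 1)‖ₑ + ‖a (N + 1) - a N‖ₑ := enorm_sub_le
          _ ≤ _ := by rw [add_comm]; gcongr
      have h2 : (∫⁻ y in ball w (r / 2) \ ball w (r / 2 ^ (N + 1)), g y) +
          (∫⁻ y in annulus w (r / 2 ^ (N + 1)), g y) ≤
          (∫⁻ y in ball w (r / 2) \ ball w (r / 2 ^ (N + 1 + 1)), g y) := by
        rw [← lintegral_union (measurableSet_annulus _ _)]
        · refine lintegral_mono_set ?_
          rw [annulus, ← hsucc]
          have hb1 : ball w (r / 2 ^ (N + 1)) ⊆ ball w (r / 2) := by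
            rw [hsucc]; exact ball_subset_ball (by linarith [hle N])
          have hb2 : ball w (r / 2 ^ (N + 1 + 1)) ⊆ ball w (r / 2 ^ (N + 1)) := by
            rw [hsucc (N + 1)]; exact ball_subset_ball (by linarith [hrk (N + 1)])
          rintro y (hy | hy)
          · exact ⟨hy.1, fun h => hy.2 (hb2 h)⟩
          · exact ⟨hb1 hy.1, hy.2⟩
        · exact disjoint_left.2 fun y hy hy' => hy.2 (annulus_subset_ball _ _ hy')
      calc ‖a 0‖ₑ ≤ _ := ih
        _ ≤ ENNReal.ofReal C * (∫⁻ y in ball w (r / 2) \ ball w (r / 2 ^ (N + 1)), g y) +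
            (ENNReal.ofReal C * (∫⁻ y in annulus w (r / 2 ^ (N + 1)), g y) + ‖a (N + 1)‖ₑ) := by
            gcongr
        _ = ENNReal.ofReal C * ((∫⁻ y in ball w (r / 2) \ ball w (r / 2 ^ (N + 1)), g y) +
            (∫⁻ y in annulus w (r / 2 ^ (N + 1)), g y)) + ‖a (N + 1)‖ₑ := by ring
        _ ≤ _ := by gcongr
  have hlim : ∀ ε : ℝ≥0∞, 0 < ε → ∃ N, ‖a N‖ₑ ≤ ε := by
    intro ε hε
    have hcont : ContinuousAt (fun y => ‖u y‖ₑ) w := hu.enorm.continuousAt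
    have hev : ∀ᶠ y in 𝓝 w, ‖u y‖ₑ < ε :=
      hcont.eventually_lt continuousAt_const (by simpa [hw] using hε)
    obtain ⟨η, hη, hball⟩ := Metric.eventually_nhds_iff_ball.1 hev
    obtain ⟨N, hNη⟩ : ∃ N : ℕ, r / 2 ^ N < η := by
      obtain ⟨N, hN⟩ := exists_pow_lt_of_lt_one (show 0 < η / r by positivity)
        (show (1 / 2 : ℝ) < 1 by norm_num)
      refine ⟨N, ?_⟩
      rw [lt_div_iff₀ hr, one_div, inv_pow] at hN
      rwa [div_eq_inv_mul]
    refine ⟨N, ?_⟩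
    have h0 := volume_annulus_ne_zero hn w (hrk N)
    have htop := volume_annulus_ne_top w (r / 2 ^ N)
    have := enorm_setAverage_sub_le h0 htop (integrableOn_annulus hu w _) 0
    simp only [sub_zero] at this
    refine this.trans ?_
    rw [setLAverage_eq]
    refine ENNReal.div_le_of_le_mul ?_
    calc _ ≤ ∫⁻ _ in annulus w (r / 2 ^ N), ε :=
          setLIntegral_mono measurable_const fun y hy =>
            (hball y (ball_subset_ball hNη.le hy.1)).le
      _ = _ := by simp
  have ha0 : ‖⨍ z in annulus w r, u z‖ₑ = ‖a 0‖ₑ := by simp [a]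
  rw [ha0]
  refine ENNReal.le_of_forall_pos_le_add fun ε hε _ => ?_
  obtain ⟨N, hNε⟩ := hlim ε (by exact_mod_cast hε)
  refine (hN N).trans ?_
  gcongr
  exact sdiff_subset.trans ((ball_subset_ball (by linarith)).trans hB)

/-- Extended-real-valued test functions may be used to bound the Riesz capacity. -/
lemma rieszCap_le_lintegral (n : ℕ) (s p : ℝ) (hp : 0 < p) {E : Set (Euc n)} {f : Euc n → ℝ≥0∞}
    (hf : Measurable f)
    (h : ∀ x ∈ E, 1 ≤ ∫⁻ y, f y * ENNReal.ofReal (dist x y ^ (s - (n : ℝ)))) :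
    rieszCap n s p E ≤ ∫⁻ x, f x ^ p := by
  by_cases htop : ∫⁻ x, f x ^ p = ∞
  · rw [htop]; exact le_top
  have hfin : ∀ᵐ x, f x < ∞ := by
    filter_upwards [ae_lt_top (hf.pow_const p) htop] with x hx
    exact (ENNReal.rpow_lt_top_iff_of_pos hp).1 hx
  refine (iInf₂_le (fun x => (f x).toReal) hf.ennreal_toReal).trans
    ((iInf₂_le (fun x => ENNReal.toReal_nonneg) fun x hx => ?_).trans (le_of_eq ?_))
  · refine (h x hx).trans (le_of_eq (lintegral_congr_ae ?_))
    filter_upwards [hfin] with y hy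
    rw [ENNReal.ofReal_toReal hy.ne]
  · refine lintegral_congr_ae ?_
    filter_upwards [hfin] with y hy
    rw [← ENNReal.ofReal_rpow_of_nonneg ENNReal.toReal_nonneg hp.le, ENNReal.ofReal_toReal hy.ne]

/-- Capacitary pointwise estimate for functions vanishing on a fat set. -/
lemma ofReal_abs_rpow_le_of_fat (n : ℕ) (hn : 0 < n) (s p : ℝ) (hs : 0 < s) (hsn : s < n)
    (hp : 1 < p) (σ : ℝ) (hσ : 0 < σ) :
    ∃ C : ℝ, 0 < C ∧ ∀ E : Set (Euc n),
      (∀ x ∈ E, ∀ r : ℝ, 0 < r →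
        ENNReal.ofReal (σ * r ^ ((n : ℝ) - s * p)) ≤ rieszCap n s p (ball x r ∩ E)) →
      ∀ u : Euc n → ℝ, Continuous u → (∀ w ∈ E, u w = 0) →
      ∀ x : Euc n, ∀ x₀ ∈ E, ∀ ρ : ℝ, 0 < ρ → dist x x₀ = ρ →
      ENNReal.ofReal (|u x| ^ p) ≤ ENNReal.ofReal C *
        (ENNReal.ofReal (ρ ^ (s * p)) * (∫⁻ y in ball x (3 * ρ), gagliardoKernel n s p u x y) +
          ENNReal.ofReal (ρ ^ (s * p - n)) *
            ∫⁻ y in ball x (3 * ρ), ∫⁻ z in ball x (3 * ρ), gagliardoKernel n s p u y z) := by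
  obtain ⟨C₁, hC₁, hJ⟩ := laverage_annulus_enorm_sub_le n hn s p hs hp
  obtain ⟨C₂, hC₂, hT⟩ := enorm_annulus_average_le n hn s p hs hsn hp
  have hp0 : 0 < p := by linarith
  refine ⟨(2 * C₁) ^ p + (2 * C₂) ^ p / σ, by positivity,
    fun E hE u hu hu0 x x₀ hx₀ ρ hρ hdist => ?_⟩
  set B := ball x (3 * ρ)
  have hBm : MeasurableSet B := measurableSet_ball
  set T : ℝ≥0∞ := ENNReal.ofReal (C₁ * ρ ^ s) * (∫⁻ y in B, gagliardoKernel n s p u x y) ^ (1 / p)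
    with hTdef
  set I : Euc n → ℝ≥0∞ := fun w => ∫⁻ y in B,
    fracGrad n s p B u y * ENNReal.ofReal (dist w y ^ (s - (n : ℝ))) with hI
  rcases eq_or_ne (u x) 0 with hux | hux
  · simp [hux, Real.zero_rpow hp0.ne']
  have hA : ENNReal.ofReal (|u x| ^ p) = ‖u x‖ₑ ^ p := by
    rw [Real.enorm_eq_ofReal_abs, ENNReal.ofReal_rpow_of_nonneg (abs_nonneg _) hp0.le]
  have hA0 : ‖u x‖ₑ ≠ 0 := by simpa using hux
  have hAtop : ‖u x‖ₑ ≠ ∞ := enorm_ne_top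
  have key : ∀ w ∈ ball x₀ ρ ∩ E, ‖u x‖ₑ ≤ T + ENNReal.ofReal C₂ * I w := by
    rintro w ⟨hw, hwE⟩
    have hsub : ball w ρ ⊆ B := by
      refine ball_subset_ball' ?_
      have := dist_triangle w x₀ x
      rw [dist_comm x₀ x, hdist] at this
      have hw' : dist w x₀ < ρ := hw
      linarith
    have h1 := enorm_setAverage_sub_le (volume_annulus_ne_zero hn w hρ)
      (volume_annulus_ne_top w ρ) (integrableOn_annulus hu w ρ) (u x)
    have h2 := hJ u hu w x ρ hρ fun z hz => by
      have : z ∈ B := hsub (annulus_subset_ball _ _ hz)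
      rw [dist_comm]
      exact (mem_ball.1 this).le
    have h3 := hT u hu w ρ hρ (hu0 w hwE) B measurableSet_ball hsub
    have h4 : (∫⁻ z in annulus w ρ, gagliardoKernel n s p u x z) ^ (1 / p) ≤
        (∫⁻ y in B, gagliardoKernel n s p u x y) ^ (1 / p) := by
      gcongr
      exact (annulus_subset_ball w ρ).trans hsub
    set av := ⨍ z in annulus w ρ, u z
    calc ‖u x‖ₑ = ‖av - (av - u x)‖ₑ := by rw [sub_sub_cancel]
      _ ≤ ‖av‖ₑ + ‖av - u x‖ₑ := enorm_sub_le
      _ ≤ ENNReal.ofReal C₂ * I w + T := by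
          refine add_le_add h3 (h1.trans (h2.trans ?_))
          rw [hTdef]
          gcongr
      _ = _ := add_comm _ _
  rw [hA, ENNReal.ofReal_add (by positivity) (by positivity)]
  rcases le_or_gt (‖u x‖ₑ) (2 * T) with hcase | hcase
  · calc ‖u x‖ₑ ^ p ≤ (2 * T) ^ p := by gcongr
      _ = ENNReal.ofReal ((2 * C₁) ^ p) *
            (ENNReal.ofReal (ρ ^ (s * p)) * ∫⁻ y in B, gagliardoKernel n s p u x y) := by
          rw [hTdef, ← mul_assoc, ENNReal.mul_rpow_of_nonneg _ _ hp0.le, ← ENNReal.rpow_mul,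
            one_div_mul_cancel hp0.ne', ENNReal.rpow_one, ← mul_assoc]
          congr 1
          rw [← ENNReal.ofReal_ofNat, ← ENNReal.ofReal_mul (by norm_num),
            ENNReal.ofReal_rpow_of_nonneg (by positivity) hp0.le,
            ← ENNReal.ofReal_mul (by positivity), ← mul_assoc,
            Real.mul_rpow (by positivity) (by positivity), ← Real.rpow_mul hρ.le]
      _ ≤ _ := by
          gcongr
          · exact le_self_add
          · exact le_self_add
  · have hI' : ∀ w ∈ ball x₀ ρ ∩ E, ‖u x‖ₑ ≤ ENNReal.ofReal (2 * C₂) * I w := by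
      intro w hw
      by_contra! hlt
      have h := key w hw
      have : 2 * ‖u x‖ₑ < 2 * ‖u x‖ₑ :=
        calc 2 * ‖u x‖ₑ ≤ 2 * (T + ENNReal.ofReal C₂ * I w) := by gcongr
          _ = 2 * T + ENNReal.ofReal (2 * C₂) * I w := by
              rw [ENNReal.ofReal_mul (by norm_num), ENNReal.ofReal_ofNat]; ring
          _ < ‖u x‖ₑ + ‖u x‖ₑ := ENNReal.add_lt_add hcase hlt
          _ = 2 * ‖u x‖ₑ := (two_mul _).symm
      exact lt_irrefl _ this
    set k : ℝ≥0∞ := ENNReal.ofReal (2 * C₂) * ‖u x‖ₑ⁻¹ with hk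
    have hfm := measurable_fracGrad n s p B hu
    have hcap := rieszCap_le_lintegral n s p hp0 (E := ball x₀ ρ ∩ E)
      (f := B.indicator fun y => k * fracGrad n s p B u y)
      ((hfm.const_mul k).indicator hBm) fun w hw => by
        have e1 : ∫⁻ y, B.indicator (fun y => k * fracGrad n s p B u y) y *
            ENNReal.ofReal (dist w y ^ (s - (n : ℝ))) = k * I w := by
          rw [hI, ← lintegral_const_mul _ (measurable_riesz_integrand n s hfm w),
            ← lintegral_indicator hBm]
          refine lintegral_congr fun y => ?_
          by_cases hy : y ∈ B <;> simp [hy, mul_assoc]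
        rw [e1, hk, mul_right_comm, ← div_eq_mul_inv]
        exact (ENNReal.le_div_iff_mul_le (Or.inl hA0) (Or.inl hAtop)).2 (by simpa using hI' w hw)
    have e2 : ∫⁻ y, (B.indicator (fun y => k * fracGrad n s p B u y) y) ^ p =
        k ^ p * ∫⁻ y in B, ∫⁻ z in B, gagliardoKernel n s p u y z := by
      have hm : Measurable fun y => ∫⁻ z in B, gagliardoKernel n s p u y z :=
        Measurable.lintegral_prod_right' (measurable_gagliardoKernel n s p hu)
      rw [← lintegral_const_mul _ hm, ← lintegral_indicator hBm]
      refine lintegral_congr fun y => ?_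
      by_cases hy : y ∈ B
      · simp only [hy, indicator_of_mem, fracGrad, ENNReal.mul_rpow_of_nonneg _ _ hp0.le,
          ← ENNReal.rpow_mul, one_div_mul_cancel hp0.ne', ENNReal.rpow_one]
      · simp [hy, hp0]
    have h5 := (hE x₀ hx₀ ρ hρ).trans hcap
    rw [e2, hk, ENNReal.mul_rpow_of_nonneg _ _ hp0.le] at h5
    set DD := ∫⁻ y in B, ∫⁻ z in B, gagliardoKernel n s p u y z
    have hinv : ‖u x‖ₑ⁻¹ ^ p * ‖u x‖ₑ ^ p = 1 := by
      rw [← ENNReal.mul_rpow_of_nonneg _ _ hp0.le, ENNReal.inv_mul_cancel hA0 hAtop,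
        ENNReal.one_rpow]
    calc ‖u x‖ₑ ^ p = ENNReal.ofReal (σ⁻¹ * ρ ^ (s * p - n)) *
          (ENNReal.ofReal (σ * ρ ^ ((n : ℝ) - s * p)) * ‖u x‖ₑ ^ p) := by
          rw [← mul_assoc, ← ENNReal.ofReal_mul (by positivity)]
          have : σ⁻¹ * ρ ^ (s * p - n) * (σ * ρ ^ ((n : ℝ) - s * p)) = 1 := by
            have h6 : ρ ^ (s * p - n) * ρ ^ ((n : ℝ) - s * p) = 1 := by
              rw [← Real.rpow_add hρ]; simp
            calc _ = (σ⁻¹ * σ) * (ρ ^ (s * p - n) * ρ ^ ((n : ℝ) - s * p)) := by ring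
              _ = 1 := by rw [h6, inv_mul_cancel₀ hσ.ne', one_mul]
          rw [this, ENNReal.ofReal_one, one_mul]
      _ ≤ ENNReal.ofReal (σ⁻¹ * ρ ^ (s * p - n)) *
          (ENNReal.ofReal (2 * C₂) ^ p * ‖u x‖ₑ⁻¹ ^ p * DD * ‖u x‖ₑ ^ p) := by gcongr
      _ = ENNReal.ofReal (σ⁻¹ * ρ ^ (s * p - n)) * (ENNReal.ofReal (2 * C₂) ^ p * DD) *
          (‖u x‖ₑ⁻¹ ^ p * ‖u x‖ₑ ^ p) := by ring
      _ = ENNReal.ofReal ((2 * C₂) ^ p / σ) * (ENNReal.ofReal (ρ ^ (s * p - n)) * DD) := by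
          rw [hinv, mul_one, ENNReal.ofReal_rpow_of_nonneg (by positivity) hp0.le, ← mul_assoc,
            ← ENNReal.ofReal_mul (by positivity), ← mul_assoc, ← ENNReal.ofReal_mul (by positivity)]
          congr 2
          field_simp
      _ ≤ _ := by
          gcongr
          · exact le_add_self
          · exact le_add_self

/-- Tonelli step: integrating out the pole of a translated radial weight. -/
lemma lintegral_lintegral_add_dist_rpow_le (n : ℕ) (hn : 0 < n) :
    ∃ V : ℝ, 0 < V ∧ ∀ A : Set (Euc n), MeasurableSet A → ∀ M : Euc n → Euc n → ℝ,
      Measurable (Function.uncurry M) → (∀ y ∈ A, ∀ z, 0 < M y z) →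
      ∀ F : Euc n → Euc n → ℝ≥0∞, Measurable (Function.uncurry F) → ∀ β : ℝ, 0 < β →
      ∫⁻ x, ∫⁻ y in A, ∫⁻ z in A,
          ENNReal.ofReal ((M y z + dist x y) ^ (-(n : ℝ) - β)) * F y z ≤
        ENNReal.ofReal (V / β) *
          ∫⁻ y in A, ∫⁻ z in A, ENNReal.ofReal (M y z ^ (-β)) * F y z := by
  obtain ⟨V, hV, hVint⟩ := lintegral_add_dist_rpow_le n hn
  refine ⟨V, hV, fun A hA M hMm hM F hFm β hβ => ?_⟩
  have h3m : Measurable fun q : (Euc n × Euc n) × Euc n =>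
      ENNReal.ofReal ((M q.1.2 q.2 + dist q.1.1 q.1.2) ^ (-(n : ℝ) - β)) * F q.1.2 q.2 := by
    have hq : Measurable fun q : (Euc n × Euc n) × Euc n => (q.1.2, q.2) := by fun_prop
    have hd : Measurable fun q : (Euc n × Euc n) × Euc n => dist q.1.1 q.1.2 := by fun_prop
    exact (((hMm.comp hq).add hd).pow_const _).ennreal_ofReal.mul (hFm.comp hq)
  calc _ = ∫⁻ y in A, ∫⁻ x, ∫⁻ z in A,
          ENNReal.ofReal ((M y z + dist x y) ^ (-(n : ℝ) - β)) * F y z :=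
          lintegral_lintegral_swap (Measurable.lintegral_prod_right' h3m).aemeasurable
    _ ≤ ∫⁻ y in A, ENNReal.ofReal (V / β) *
          ∫⁻ z in A, ENNReal.ofReal (M y z ^ (-β)) * F y z := by
        refine setLIntegral_mono' hA fun y hy => ?_
        have hsw : Measurable fun q : Euc n × Euc n =>
            ENNReal.ofReal ((M y q.2 + dist q.1 y) ^ (-(n : ℝ) - β)) * F y q.2 :=
          h3m.comp (show Measurable fun q : Euc n × Euc n => ((q.1, y), q.2) by fun_prop)
        rw [lintegral_lintegral_swap hsw.aemeasurable,
          ← lintegral_const_mul' _ _ ENNReal.ofReal_ne_top]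
        refine lintegral_mono fun z => ?_
        have hM0 := hM y hy z
        rw [lintegral_mul_const]
        · refine (mul_le_mul' (hVint y _ β hM0 hβ) le_rfl).trans_eq ?_
          rw [← mul_assoc, ← ENNReal.ofReal_mul (by positivity)]
          congr 2
          ring
        · have : Measurable fun x : Euc n => dist x y := by fun_prop
          exact ((this.const_add _).pow_const _).ennreal_ofReal
    _ = _ := lintegral_const_mul' _ _ ENNReal.ofReal_ne_top

/-- Pointwise capacitary estimate with the distance weight moved inside the integrals. -/
lemma ofReal_abs_rpow_mul_infDist_le_of_fat (n : ℕ) (hn : 0 < n) (s p : ℝ) (hs : 0 < s)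
    (hsn : s < n) (hp : 1 < p) (σ : ℝ) (hσ : 0 < σ) :
    ∃ C : ℝ, 0 < C ∧ ∀ E : Set (Euc n), IsClosed E → E.Nonempty →
      (∀ x ∈ E, ∀ r : ℝ, 0 < r →
        ENNReal.ofReal (σ * r ^ ((n : ℝ) - s * p)) ≤ rieszCap n s p (ball x r ∩ E)) →
      ∀ β : ℝ, 0 < β → β ≤ 1 →
      ∀ u : Euc n → ℝ, Continuous u → (∀ w ∈ E, u w = 0) →
      ∀ x ∉ E, volume (ball x (3 * infDist x E) \ Eᶜ) = 0 →
      ENNReal.ofReal (|u x| ^ p * infDist x E ^ (-(s * p) - β)) ≤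
        ENNReal.ofReal C *
          (ENNReal.ofReal 4 * (∫⁻ y in Eᶜ,
            ENNReal.ofReal (max (infDist x E) (infDist y E) ^ (-β)) *
              gagliardoKernel n s p u x y) +
          ENNReal.ofReal (7 ^ (n + 1)) * ∫⁻ y in Eᶜ, ∫⁻ z in Eᶜ,
            ENNReal.ofReal ((max (infDist y E) (infDist z E) + dist x y) ^ (-(n : ℝ) - β)) *
              gagliardoKernel n s p u y z) := by
  obtain ⟨C, hC, hpt⟩ := ofReal_abs_rpow_le_of_fat n hn s p hs hsn hp σ hσ
  refine ⟨C, hC, fun E hE hEne hfat β hβ hβ1 u hu hu0 x hx hball => ?_⟩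
  set M : Euc n → Euc n → ℝ := fun y z => max (infDist y E) (infDist z E)
  set F := gagliardoKernel n s p u
  have hlip : ∀ x y : Euc n, infDist y E ≤ infDist x E + dist y x := fun x y =>
    infDist_le_infDist_add_dist
  set T₁ : ℝ≥0∞ := ∫⁻ y in Eᶜ, ENNReal.ofReal (M x y ^ (-β)) * F x y with hT₁
  set T₂ : ℝ≥0∞ := ∫⁻ y in Eᶜ, ∫⁻ z in Eᶜ,
    ENNReal.ofReal ((M y z + dist x y) ^ (-(n : ℝ) - β)) * F y z with hT₂
  have hρ := (hE.notMem_iff_infDist_pos hEne).1 hx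
  obtain ⟨x₀, hx₀, hx₀d⟩ := hE.exists_infDist_eq_dist hEne x
  have h := hpt E hfat u hu hu0 x x₀ hx₀ _ hρ hx₀d.symm
  have hres : volume.restrict (ball x (3 * infDist x E)) ≤ volume.restrict Eᶜ :=
    Measure.restrict_mono_ae (ae_le_set.2 hball)
  set ρ := infDist x E
  have hnear : ∀ y ∈ ball x (3 * ρ), infDist y E ≤ 4 * ρ := fun y hy => by
    have := hlip x y
    have := mem_ball.1 hy
    linarith
  have h1 : ENNReal.ofReal (ρ ^ (-β)) * (∫⁻ y in ball x (3 * ρ), F x y) ≤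
      ENNReal.ofReal 4 * T₁ := by
    rw [← lintegral_const_mul' _ _ ENNReal.ofReal_ne_top,
      ← lintegral_const_mul' _ _ ENNReal.ofReal_ne_top]
    refine (setLIntegral_mono' measurableSet_ball fun y hy => ?_).trans
      (lintegral_mono' hres le_rfl)
    rw [← mul_assoc, ← ENNReal.ofReal_mul (by norm_num)]
    gcongr
    have hM0 : 0 < M x y := lt_max_of_lt_left hρ
    have hM4 : M x y ≤ 4 * ρ := max_le (by linarith) (hnear y hy)
    calc ρ ^ (-β) = 4 ^ β * (4 * ρ) ^ (-β) := by
          rw [Real.mul_rpow (by norm_num) hρ.le, ← mul_assoc, ← Real.rpow_add (by norm_num)]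
          simp
      _ ≤ 4 ^ (1 : ℝ) * M x y ^ (-β) := mul_le_mul
          (Real.rpow_le_rpow_of_exponent_le (by norm_num) hβ1)
          (Real.rpow_le_rpow_of_nonpos hM0 hM4 (by linarith)) (by positivity) (by positivity)
      _ = 4 * M x y ^ (-β) := by rw [Real.rpow_one]
  have h2 : ENNReal.ofReal (ρ ^ (-(n : ℝ) - β)) *
      (∫⁻ y in ball x (3 * ρ), ∫⁻ z in ball x (3 * ρ), F y z) ≤
      ENNReal.ofReal (7 ^ (n + 1)) * T₂ := by
    rw [← lintegral_const_mul' _ _ ENNReal.ofReal_ne_top,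
      ← lintegral_const_mul' _ _ ENNReal.ofReal_ne_top]
    refine (setLIntegral_mono' measurableSet_ball fun y hy => ?_).trans
      (lintegral_mono' hres le_rfl)
    rw [← lintegral_const_mul' _ _ ENNReal.ofReal_ne_top,
      ← lintegral_const_mul' _ _ ENNReal.ofReal_ne_top]
    refine (setLIntegral_mono' measurableSet_ball fun z hz => ?_).trans
      (lintegral_mono' hres le_rfl)
    rw [← mul_assoc, ← ENNReal.ofReal_mul (by positivity)]
    gcongr
    have hy' := mem_ball'.1 hy
    have hMd0 : 0 < M y z + dist x y := by
      have := hlip y x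
      have : infDist y E ≤ M y z := le_max_left _ _
      linarith
    have hMd : M y z + dist x y ≤ 7 * ρ := by
      have : M y z ≤ 4 * ρ := max_le (hnear y hy) (hnear z hz)
      linarith
    have hexp : -(n : ℝ) - β ≤ 0 := by
      have : (0 : ℝ) ≤ n := n.cast_nonneg
      linarith
    calc ρ ^ (-(n : ℝ) - β) = 7 ^ ((n : ℝ) + β) * (7 * ρ) ^ (-(n : ℝ) - β) := by
          rw [Real.mul_rpow (by norm_num) hρ.le, ← mul_assoc, ← Real.rpow_add (by norm_num)]
          simp
      _ ≤ 7 ^ ((n : ℝ) + 1) * (M y z + dist x y) ^ (-(n : ℝ) - β) := mul_le_mul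
          (Real.rpow_le_rpow_of_exponent_le (by norm_num) (by linarith))
          (Real.rpow_le_rpow_of_nonpos hMd0 hMd hexp) (by positivity) (by positivity)
      _ = 7 ^ (n + 1) * (M y z + dist x y) ^ (-(n : ℝ) - β) := by
          rw [← Real.rpow_natCast]; push_cast; rfl
  calc ENNReal.ofReal (|u x| ^ p * ρ ^ (-(s * p) - β))
      = ENNReal.ofReal (ρ ^ (-(s * p) - β)) * ENNReal.ofReal (|u x| ^ p) := by
        rw [← ENNReal.ofReal_mul (by positivity), mul_comm]
    _ ≤ _ := mul_le_mul' le_rfl h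
    _ = ENNReal.ofReal C * (ENNReal.ofReal (ρ ^ (-β)) * (∫⁻ y in ball x (3 * ρ), F x y) +
        ENNReal.ofReal (ρ ^ (-(n : ℝ) - β)) *
          ∫⁻ y in ball x (3 * ρ), ∫⁻ z in ball x (3 * ρ), F y z) := by
        rw [show ρ ^ (-β) = ρ ^ (-(s * p) - β) * ρ ^ (s * p) by
            rw [← Real.rpow_add hρ]; congr 1; ring,
          show ρ ^ (-(n : ℝ) - β) = ρ ^ (-(s * p) - β) * ρ ^ (s * p - n) by
            rw [← Real.rpow_add hρ]; congr 1; ring,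
          ENNReal.ofReal_mul (by positivity), ENNReal.ofReal_mul (by positivity)]
        ring
    _ ≤ _ := by gcongr

/-- Weighted integrated form of the capacitary estimate on the points whose enlarged balls
almost lie in the complement of the fat set. -/
lemma lintegral_weighted_le_of_fat (n : ℕ) (hn : 0 < n) (s p : ℝ) (hs : 0 < s) (hsn : s < n)
    (hp : 1 < p) (σ : ℝ) (hσ : 0 < σ) :
    ∃ C : ℝ, 0 < C ∧ ∀ E : Set (Euc n), IsClosed E → E.Nonempty →
      (∀ x ∈ E, ∀ r : ℝ, 0 < r →
        ENNReal.ofReal (σ * r ^ ((n : ℝ) - s * p)) ≤ rieszCap n s p (ball x r ∩ E)) →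
      ∀ S : Set (Euc n), MeasurableSet S → S ⊆ Eᶜ →
      (∀ x ∈ S, volume (ball x (3 * infDist x E) \ Eᶜ) = 0) →
      ∀ β : ℝ, 0 < β → β ≤ 1 →
      ∀ u : Euc n → ℝ, Continuous u → (∀ w ∈ E, u w = 0) →
      ∫⁻ x in S, ENNReal.ofReal (|u x| ^ p * infDist x E ^ (-(s * p) - β)) ≤
        ENNReal.ofReal (C / β) * ∫⁻ y in Eᶜ, ∫⁻ z in Eᶜ,
          ENNReal.ofReal (max (infDist y E) (infDist z E) ^ (-β)) *
            gagliardoKernel n s p u y z := by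
  obtain ⟨C, hC, hpt⟩ := ofReal_abs_rpow_mul_infDist_le_of_fat n hn s p hs hsn hp σ hσ
  obtain ⟨V, hV, hVint⟩ := lintegral_lintegral_add_dist_rpow_le n hn
  refine ⟨C * (4 + 7 ^ (n + 1) * V), by positivity,
    fun E hE hEne hfat S hS hSE hball β hβ hβ1 u hu hu0 => ?_⟩
  have hpoint := fun x (hx : x ∈ S) =>
    hpt E hE hEne hfat β hβ hβ1 u hu hu0 x (hSE hx) (hball x hx)
  have hδm : Measurable fun x : Euc n => infDist x E := (continuous_infDist_pt E).measurable
  have hFm : Measurable (Function.uncurry (gagliardoKernel n s p u)) :=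
    measurable_gagliardoKernel n s p hu
  have hMm : Measurable (Function.uncurry fun y z : Euc n => max (infDist y E) (infDist z E)) :=
    (hδm.comp measurable_fst).max (hδm.comp measurable_snd)
  have h2 := hVint Eᶜ hE.measurableSet.compl _ hMm
    (fun y hy z => lt_max_of_lt_left ((hE.notMem_iff_infDist_pos hEne).1 hy)) _ hFm β hβ
  have hT₁m := Measurable.lintegral_prod_right' (ν := volume.restrict Eᶜ)
    (((hMm.pow_const (-β)).ennreal_ofReal).mul hFm)
  simp only [Function.uncurry, Pi.mul_apply] at hT₁m
  generalize gagliardoKernel n s p u = F at *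
  set D := ∫⁻ y in Eᶜ, ∫⁻ z in Eᶜ,
    ENNReal.ofReal (max (infDist y E) (infDist z E) ^ (-β)) * F y z
  set T₁ : Euc n → ℝ≥0∞ := fun x =>
    ∫⁻ y in Eᶜ, ENNReal.ofReal (max (infDist x E) (infDist y E) ^ (-β)) * F x y
  set T₂ : Euc n → ℝ≥0∞ := fun x => ∫⁻ y in Eᶜ, ∫⁻ z in Eᶜ,
    ENNReal.ofReal ((max (infDist y E) (infDist z E) + dist x y) ^ (-(n : ℝ) - β)) * F y z
  have hint₁ : ∫⁻ x in S, T₁ x ≤ D := lintegral_mono_set hSE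
  have hint₂ : ∫⁻ x in S, T₂ x ≤ ENNReal.ofReal (V / β) * D :=
    (setLIntegral_le_lintegral _ _).trans h2
  calc ∫⁻ x in S, ENNReal.ofReal (|u x| ^ p * infDist x E ^ (-(s * p) - β))
      ≤ ∫⁻ x in S, ENNReal.ofReal C *
          (ENNReal.ofReal 4 * T₁ x + ENNReal.ofReal (7 ^ (n + 1)) * T₂ x) :=
        setLIntegral_mono' hS hpoint
    _ = ENNReal.ofReal C * (ENNReal.ofReal 4 * (∫⁻ x in S, T₁ x) +
          ENNReal.ofReal (7 ^ (n + 1)) * ∫⁻ x in S, T₂ x) := by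
        rw [lintegral_const_mul' _ _ ENNReal.ofReal_ne_top, lintegral_add_left (hT₁m.const_mul _),
          lintegral_const_mul' _ _ ENNReal.ofReal_ne_top,
          lintegral_const_mul' _ _ ENNReal.ofReal_ne_top]
    _ ≤ ENNReal.ofReal C * (ENNReal.ofReal (4 / β) * D +
          ENNReal.ofReal (7 ^ (n + 1)) * (ENNReal.ofReal (V / β) * D)) := by
        gcongr
        rw [le_div_iff₀ hβ]
        linarith
    _ = _ := by
        rw [← mul_assoc (ENNReal.ofReal (7 ^ (n + 1))), ← ENNReal.ofReal_mul (by positivity),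
          ← add_mul, ← ENNReal.ofReal_add (by positivity) (by positivity), ← mul_assoc,
          ← ENNReal.ofReal_mul (by positivity)]
        congr 2
        ring

lemma rpow_sub_rpow_le_mul_log {a b t γ : ℝ} (ha : 0 < a) (hab : a ≤ b) (ht : b - a ≤ t)
    (hγ : 0 < γ) : b ^ γ - a ^ γ ≤ b ^ γ * (γ * Real.log (1 + t / a)) := by
  have hb : 0 < b := ha.trans_le hab
  have h1 := Real.one_sub_inv_le_log_of_pos (x := (b / a) ^ γ) (by positivity)
  rw [Real.log_rpow (by positivity), Real.div_rpow hb.le ha.le, inv_div] at h1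
  have h2 : Real.log (b / a) ≤ Real.log (1 + t / a) := by
    refine Real.log_le_log (by positivity) ?_
    rw [div_le_iff₀ ha, add_mul, div_mul_cancel₀ _ ha.ne']
    linarith
  have hbγ : 0 < b ^ γ := by positivity
  calc b ^ γ - a ^ γ = b ^ γ * (1 - a ^ γ / b ^ γ) := by field_simp
    _ ≤ b ^ γ * (γ * Real.log (1 + t / a)) := by gcongr; exact h1.trans (by gcongr)

lemma abs_mul_rpow_sub_le {a b t γ : ℝ} (ha : 0 < a) (hb : 0 < b) (hab : |a - b| ≤ t)
    (hγ : 0 < γ) (v w : ℝ) :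
    |v * a ^ γ - w * b ^ γ| ≤ max a b ^ γ *
      (|v - w| + γ * (|v| * Real.log (1 + t / a)) + γ * (|w| * Real.log (1 + t / b))) := by
  wlog h : a ≤ b generalizing a b v w
  · have := this hb ha (by rwa [abs_sub_comm]) w v (le_of_not_ge h)
    rw [abs_sub_comm, max_comm, abs_sub_comm v w]
    linarith
  have ht : b - a ≤ t := by
    rw [abs_sub_comm] at hab
    exact (le_abs_self _).trans hab
  have ht0 : 0 ≤ t := (abs_nonneg _).trans hab
  have hbγ : 0 < b ^ γ := by positivity
  have hL : 0 ≤ Real.log (1 + t / b) :=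
    Real.log_nonneg (by have := div_nonneg ht0 hb.le; linarith)
  have hd : 0 ≤ b ^ γ - a ^ γ := sub_nonneg.2 (Real.rpow_le_rpow ha.le h hγ.le)
  rw [max_eq_right h]
  calc |v * a ^ γ - w * b ^ γ| = |(v - w) * b ^ γ - v * (b ^ γ - a ^ γ)| := by ring_nf
    _ ≤ |(v - w) * b ^ γ| + |v * (b ^ γ - a ^ γ)| := abs_sub _ _
    _ = |v - w| * b ^ γ + |v| * (b ^ γ - a ^ γ) := by
        rw [abs_mul, abs_mul, abs_of_pos hbγ, abs_of_nonneg hd]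
    _ ≤ |v - w| * b ^ γ + |v| * (b ^ γ * (γ * Real.log (1 + t / a))) := by
        gcongr
        exact rpow_sub_rpow_le_mul_log ha h ht hγ
    _ ≤ _ := by
        have : 0 ≤ b ^ γ * (γ * (|w| * Real.log (1 + t / b))) := by positivity
        linarith

lemma add_add_rpow_le {a b c p : ℝ} (ha : 0 ≤ a) (hb : 0 ≤ b) (hc : 0 ≤ c) (hp : 0 < p) :
    (a + b + c) ^ p ≤ 3 ^ p * (a ^ p + b ^ p + c ^ p) := by
  have hpa := Real.rpow_nonneg ha p
  have hpb := Real.rpow_nonneg hb p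
  have hpc := Real.rpow_nonneg hc p
  obtain ⟨m, hm0, hm, hmp⟩ : ∃ m, 0 ≤ m ∧ a + b + c ≤ 3 * m ∧ m ^ p ≤ a ^ p + b ^ p + c ^ p := by
    rcases le_total a b with h1 | h1 <;> rcases le_total b c with h2 | h2 <;>
      rcases le_total a c with h3 | h3
    all_goals first
      | exact ⟨a, ha, by linarith, by linarith⟩
      | exact ⟨b, hb, by linarith, by linarith⟩
      | exact ⟨c, hc, by linarith, by linarith⟩
  calc (a + b + c) ^ p ≤ (3 * m) ^ p := by gcongr
    _ = 3 ^ p * m ^ p := Real.mul_rpow (by norm_num) hm0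
    _ ≤ _ := by gcongr

/-- The logarithmic kernel measuring the oscillation of powers of the distance to a set. -/
def logKernel (n : ℕ) (s p : ℝ) (E : Set (Euc n)) (y z : Euc n) : ℝ≥0∞ :=
  ENNReal.ofReal (Real.log (1 + dist z y / infDist y E) ^ p / dist z y ^ ((n : ℝ) + s * p))

lemma measurable_logKernel (n : ℕ) (s p : ℝ) (E : Set (Euc n)) :
    Measurable (Function.uncurry (logKernel n s p E)) := by
  have hδm : Measurable fun x : Euc n => infDist x E := (continuous_infDist_pt E).measurable
  have hd : Measurable fun q : Euc n × Euc n => dist q.2 q.1 := by fun_prop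
  have hl : Measurable fun q : Euc n × Euc n => 1 + dist q.2 q.1 / infDist q.1 E :=
    (hd.div (hδm.comp measurable_fst)).const_add _
  exact (((Real.measurable_log.comp hl).pow_const p).div (hd.pow_const _)).ennreal_ofReal

lemma gagliardoKernel_mul_infDist_rpow_le (n : ℕ) (s p : ℝ) (hp : 0 < p)
    {E : Set (Euc n)} (v : Euc n → ℝ) {γ : ℝ} (hγ : 0 < γ) {y z : Euc n}
    (hy : 0 < infDist y E) (hz : 0 < infDist z E) :
    ENNReal.ofReal (max (infDist y E) (infDist z E) ^ (-(γ * p))) *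
        gagliardoKernel n s p (fun x => v x * infDist x E ^ γ) y z ≤
      ENNReal.ofReal (3 ^ p) * (gagliardoKernel n s p v y z +
        ENNReal.ofReal (γ ^ p) * (ENNReal.ofReal (|v y| ^ p) * logKernel n s p E y z) +
        ENNReal.ofReal (γ ^ p) * (ENNReal.ofReal (|v z| ^ p) * logKernel n s p E z y)) := by
  simp only [gagliardoKernel, logKernel]
  have hab : |infDist y E - infDist z E| ≤ dist y z := by
    rw [abs_sub_le_iff]
    constructor
    · linarith [infDist_le_infDist_add_dist (s := E) (x := y) (y := z)]
    · linarith [infDist_le_infDist_add_dist (s := E) (x := z) (y := y), dist_comm y z]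
  rw [dist_comm z y]
  set a := infDist y E
  set b := infDist z E
  set t := dist y z
  have ht : 0 ≤ t := dist_nonneg
  have hLa : 0 ≤ Real.log (1 + t / a) :=
    Real.log_nonneg (by have := div_nonneg ht hy.le; linarith)
  have hLb : 0 ≤ Real.log (1 + t / b) :=
    Real.log_nonneg (by have := div_nonneg ht hz.le; linarith)
  have hM : 0 < max a b := lt_max_of_lt_left hy
  have hN : 0 ≤ t ^ ((n : ℝ) + s * p) := by positivity
  rw [← ENNReal.ofReal_mul (by positivity), ← ENNReal.ofReal_mul (by positivity),
    ← ENNReal.ofReal_mul (by positivity), ← ENNReal.ofReal_mul (by positivity),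
    ← ENNReal.ofReal_mul (by positivity), ← ENNReal.ofReal_add (by positivity) (by positivity),
    ← ENNReal.ofReal_add (by positivity) (by positivity), ← ENNReal.ofReal_mul (by positivity)]
  refine ENNReal.ofReal_le_ofReal ?_
  have h1 : |v y * a ^ γ - v z * b ^ γ| ^ p ≤ max a b ^ (γ * p) * (3 ^ p * (|v y - v z| ^ p +
      γ ^ p * (|v y| ^ p * Real.log (1 + t / a) ^ p) +
      γ ^ p * (|v z| ^ p * Real.log (1 + t / b) ^ p))) := by
    calc |v y * a ^ γ - v z * b ^ γ| ^ p ≤ (max a b ^ γ * (|v y - v z| +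
          γ * (|v y| * Real.log (1 + t / a)) + γ * (|v z| * Real.log (1 + t / b)))) ^ p :=
          Real.rpow_le_rpow (abs_nonneg _) (abs_mul_rpow_sub_le hy hz hab hγ _ _) hp.le
      _ ≤ max a b ^ (γ * p) * (3 ^ p * (|v y - v z| ^ p +
          (γ * (|v y| * Real.log (1 + t / a))) ^ p +
          (γ * (|v z| * Real.log (1 + t / b))) ^ p)) := by
          rw [Real.mul_rpow (by positivity) (by positivity), ← Real.rpow_mul hM.le]
          gcongr
          exact add_add_rpow_le (by positivity) (by positivity) (by positivity) hp
      _ = _ := by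
          rw [Real.mul_rpow hγ.le (by positivity), Real.mul_rpow (abs_nonneg _) hLa,
            Real.mul_rpow hγ.le (by positivity), Real.mul_rpow (abs_nonneg _) hLb]
  calc max a b ^ (-(γ * p)) * (|v y * a ^ γ - v z * b ^ γ| ^ p / t ^ ((n : ℝ) + s * p))
      ≤ max a b ^ (-(γ * p)) * (max a b ^ (γ * p) * (3 ^ p * (|v y - v z| ^ p +
      γ ^ p * (|v y| ^ p * Real.log (1 + t / a) ^ p) +
      γ ^ p * (|v z| ^ p * Real.log (1 + t / b) ^ p))) / t ^ ((n : ℝ) + s * p)) := by gcongr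
    _ = (max a b ^ (-(γ * p)) * max a b ^ (γ * p)) * (3 ^ p * (|v y - v z| ^ p +
      γ ^ p * (|v y| ^ p * Real.log (1 + t / a) ^ p) +
      γ ^ p * (|v z| ^ p * Real.log (1 + t / b) ^ p)) / t ^ ((n : ℝ) + s * p)) := by ring
    _ = _ := by
        rw [← Real.rpow_add hM, neg_add_cancel, Real.rpow_zero, one_mul]
        ring

lemma lintegral_lintegral_add_symm {α : Type*} [MeasurableSpace α] {μ : Measure α} [SFinite μ]
    {F P : α → α → ℝ≥0∞} (hF : Measurable (Function.uncurry F))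
    (hP : Measurable (Function.uncurry P)) {a c : ℝ≥0∞} (ha : a ≠ ∞) (hc : c ≠ ∞) :
    ∫⁻ y, ∫⁻ z, a * (F y z + c * P y z + c * P z y) ∂μ ∂μ =
      a * ((∫⁻ y, ∫⁻ z, F y z ∂μ ∂μ) + 2 * c * ∫⁻ y, ∫⁻ z, P y z ∂μ ∂μ) := by
  have e : ∀ y, ∫⁻ z, a * (F y z + c * P y z + c * P z y) ∂μ =
      a * ((∫⁻ z, F y z ∂μ) + c * (∫⁻ z, P y z ∂μ) + c * ∫⁻ z, P z y ∂μ) := by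
    intro y
    have h1 : Measurable fun z => F y z := hF.of_uncurry_left
    have h2 : Measurable fun z => P y z := hP.of_uncurry_left
    have h3 : Measurable fun z => F y z + c * P y z := h1.add (h2.const_mul c)
    rw [lintegral_const_mul' _ _ ha, lintegral_add_left h3, lintegral_add_left h1, lintegral_const_mul' _ _ hc, lintegral_const_mul' _ _ hc]
  have h1 : Measurable fun y => ∫⁻ z, F y z ∂μ := Measurable.lintegral_prod_right' hF
  have h2 : Measurable fun y => ∫⁻ z, P y z ∂μ := Measurable.lintegral_prod_right' hP
  have hswap : ∫⁻ y, ∫⁻ z, P z y ∂μ ∂μ = ∫⁻ y, ∫⁻ z, P y z ∂μ ∂μ :=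
    lintegral_lintegral_swap (hP.comp measurable_swap).aemeasurable
  simp only [e]
  have h3 : Measurable fun y => (∫⁻ z, F y z ∂μ) + c * ∫⁻ z, P y z ∂μ :=
    h1.add (h2.const_mul c)
  rw [lintegral_const_mul' _ _ ha, lintegral_add_left h3, lintegral_add_left h1, lintegral_const_mul' _ _ hc, lintegral_const_mul' _ _ hc, hswap]
  ring

/-- Integrated form of the substitution `u = v δ^γ`. -/
lemma lintegral_gagliardoKernel_mul_infDist_rpow_le (n : ℕ) (hn : 0 < n) (s p : ℝ) (hs0 : 0 < s)
    (hs1 : s < 1) (hp : 0 < p) :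
    ∃ K : ℝ, 0 < K ∧ ∀ E : Set (Euc n), IsClosed E → E.Nonempty →
      ∀ v : Euc n → ℝ, Continuous v → ∀ γ : ℝ, 0 < γ →
      ∫⁻ y in Eᶜ, ∫⁻ z in Eᶜ, ENNReal.ofReal (max (infDist y E) (infDist z E) ^ (-(γ * p))) *
        gagliardoKernel n s p (fun x => v x * infDist x E ^ γ) y z ≤
      ENNReal.ofReal (3 ^ p) * ((∫⁻ y in Eᶜ, ∫⁻ z in Eᶜ, gagliardoKernel n s p v y z) +
        ENNReal.ofReal (K * γ ^ p) *
          ∫⁻ y in Eᶜ, ENNReal.ofReal (|v y| ^ p * infDist y E ^ (-(s * p)))) := by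
  obtain ⟨K, hK, hlog⟩ := lintegral_log_kernel_le n hn s p hs0 hs1 hp
  refine ⟨2 * K, by positivity, fun E hE hEne v hv γ hγ => ?_⟩
  have hA : MeasurableSet Eᶜ := hE.measurableSet.compl
  have hpos : ∀ x ∈ Eᶜ, 0 < infDist x E := fun x hx => (hE.notMem_iff_infDist_pos hEne).1 hx
  have hFm := measurable_gagliardoKernel n s p hv
  have hvm : Measurable fun y => ENNReal.ofReal (|v y| ^ p) :=
    (hv.abs.measurable.pow_const p).ennreal_ofReal
  have hLm : Measurable fun q : Euc n × Euc n =>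
      ENNReal.ofReal (|v q.1| ^ p) * logKernel n s p E q.1 q.2 :=
    (hvm.comp measurable_fst).mul (measurable_logKernel n s p E)
  set c := ENNReal.ofReal (γ ^ p)
  set H := ∫⁻ y in Eᶜ, ENNReal.ofReal (|v y| ^ p * infDist y E ^ (-(s * p)))
  set J := ∫⁻ y in Eᶜ, ∫⁻ z in Eᶜ, ENNReal.ofReal (|v y| ^ p) * logKernel n s p E y z
  have hJH : J ≤ ENNReal.ofReal K * H := by
    rw [← lintegral_const_mul' _ _ ENNReal.ofReal_ne_top]
    refine setLIntegral_mono' hA fun y hy => ?_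
    rw [lintegral_const_mul' _ _ ENNReal.ofReal_ne_top]
    calc _ ≤ ENNReal.ofReal (|v y| ^ p) * ENNReal.ofReal (K * infDist y E ^ (-(s * p))) := by
          gcongr
          exact (setLIntegral_le_lintegral _ _).trans (hlog y _ (hpos y hy))
      _ = _ := by
          rw [← ENNReal.ofReal_mul (by positivity), ← ENNReal.ofReal_mul hK.le]
          congr 1
          ring
  calc _ ≤ ∫⁻ y in Eᶜ, ∫⁻ z in Eᶜ, ENNReal.ofReal (3 ^ p) * (gagliardoKernel n s p v y z +
        c * (ENNReal.ofReal (|v y| ^ p) * logKernel n s p E y z) +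
        c * (ENNReal.ofReal (|v z| ^ p) * logKernel n s p E z y)) :=
        setLIntegral_mono' hA fun y hy => setLIntegral_mono' hA fun z hz =>
          gagliardoKernel_mul_infDist_rpow_le n s p hp v hγ (hpos y hy) (hpos z hz)
    _ = _ := lintegral_lintegral_add_symm (μ := volume.restrict Eᶜ) hFm
        (P := fun y z => ENNReal.ofReal (|v y| ^ p) * logKernel n s p E y z) hLm
        ENNReal.ofReal_ne_top ENNReal.ofReal_ne_top
    _ ≤ ENNReal.ofReal (3 ^ p) * ((∫⁻ y in Eᶜ, ∫⁻ z in Eᶜ, gagliardoKernel n s p v y z) +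
        2 * c * (ENNReal.ofReal K * H)) := by gcongr
    _ = _ := by
        rw [ENNReal.ofReal_mul (by positivity), ENNReal.ofReal_mul (by norm_num),
          ENNReal.ofReal_ofNat]
        ring

lemma infDist_frontier_eq_infDist_compl {n : ℕ} {U : Set (Euc n)} (hU : IsOpen U)
    (hU' : U ≠ univ) {x : Euc n} (hx : x ∈ U) : infDist x (frontier U) = infDist x Uᶜ := by
  obtain ⟨y, hy, hxy⟩ := exists_mem_frontier_infDist_compl_eq_dist hx hU'
  refine le_antisymm ((infDist_le_dist_of_mem hy).trans_eq hxy.symm)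
    (infDist_le_infDist_of_subset ?_ ⟨y, hy⟩)
  rw [← frontier_compl]
  exact hU.isClosed_compl.frontier_subset

lemma lintegral_abs_rpow_mul_infDist_lt_top {n : ℕ} {E : Set (Euc n)} (hE : IsClosed E)
    (hEne : E.Nonempty) {v : Euc n → ℝ} (hv : Continuous v) (hvc : HasCompactSupport v)
    (hvE : tsupport v ⊆ Eᶜ) {p : ℝ} (hp : 0 < p) (t : ℝ) :
    ∫⁻ x in Eᶜ, ENNReal.ofReal (|v x| ^ p * infDist x E ^ t) < ∞ := by
  have hcont : ContinuousOn (fun x => |v x| ^ p * infDist x E ^ t) (tsupport v) := by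
    refine (hv.abs.rpow_const fun _ => Or.inr hp.le).continuousOn.mul fun x hx => ?_
    exact ((continuous_infDist_pt E).continuousAt.rpow_const
      (Or.inl ((hE.notMem_iff_infDist_pos hEne).1 (hvE hx)).ne')).continuousWithinAt
  have hK : IsCompact (tsupport v) := hvc
  refine lt_of_le_of_lt ?_ (hcont.integrableOn_compact hK (μ := volume)).setLIntegral_lt_top
  rw [← lintegral_indicator (isClosed_tsupport v).measurableSet]
  refine (setLIntegral_le_lintegral _ _).trans (lintegral_mono fun x => ?_)
  by_cases hx : x ∈ tsupport v
  · simp [hx]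
  · simp [image_eq_zero_of_notMem_tsupport hx, hp.ne']

lemma exists_mul_rpow_le_half (Q a : ℝ) (hQ : 0 < Q) (ha : 0 < a) :
    ∃ β : ℝ, 0 < β ∧ β ≤ 1 ∧ Q * β ^ a ≤ 1 / 2 := by
  have h1 : (0 : ℝ) < 1 / (2 * Q + 1) := by positivity
  refine ⟨(1 / (2 * Q + 1)) ^ (1 / a), by positivity,
    Real.rpow_le_one h1.le ?_ (by positivity), ?_⟩
  · rw [div_le_one (by positivity)]; linarith
  · rw [← Real.rpow_mul h1.le, one_div_mul_cancel ha.ne', Real.rpow_one, mul_one_div,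
      div_le_div_iff₀ (by positivity) (by norm_num)]
    linarith

lemma ENNReal.le_two_mul_of_le_add_half {a H : ℝ≥0∞} (hH : H ≠ ∞)
    (h : H ≤ a + ENNReal.ofReal (1 / 2) * H) : H ≤ 2 * a := by
  rcases eq_or_ne a ∞ with rfl | ha
  · simp
  lift H to ℝ≥0 using hH
  lift a to ℝ≥0 using ha
  have e : ENNReal.ofReal (1 / 2) = ((1 / 2 : ℝ≥0) : ℝ≥0∞) := by
    rw [← ENNReal.ofReal_coe_nnreal]; norm_num
  rw [e] at h
  norm_cast at h ⊢
  rw [← NNReal.coe_le_coe] at h ⊢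
  push_cast at h ⊢
  linarith

/-- Let `1<p<∞`, `0<s<1` with `sp<n`, `n ≥ 2`. If `G' ⊆ G ⊊ ℝⁿ` are open,
`(G')ᶜ` is `(s,p)`-uniformly fat, `G` admits the `(s,p)`-Hardy inequality, and
`|G ∖ G'| = 0`, then `G'` admits the `(s,p)`-Hardy inequality. -/
theorem statement19 (n : ℕ) (hn : 2 ≤ n) (s p : ℝ) (hs0 : 0 < s) (hs1 : s < 1)
    (hp1 : 1 < p) (hspn : s * p < n)
    (G' G : Set (Euc n)) (hG'open : IsOpen G') (hGopen : IsOpen G)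
    (hsub : G' ⊆ G) (hGproper : G ≠ Set.univ)
    (hfat : UniformlyFat n s p G'ᶜ)
    (hHardy : AdmitsHardy n s p G)
    (hnull : volume (G \ G') = 0) :
    AdmitsHardy n s p G' := by
  by_cases hne : G'.Nonempty
  swap
  · rw [not_nonempty_iff_eq_empty.1 hne]
    exact ⟨1, one_pos, fun u _ _ _ => by simp⟩
  have hp0 : 0 < p := by linarith
  have hn0 : 0 < n := by omega
  have hsn : s < n := by
    have : (2 : ℝ) ≤ n := by exact_mod_cast hn
    linarith
  obtain ⟨σ, hσ, hfat⟩ := hfat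
  obtain ⟨c, hc, hHardy⟩ := hHardy
  obtain ⟨C, hC, hcap⟩ := lintegral_weighted_le_of_fat n hn0 s p hs0 hsn hp1 σ hσ
  obtain ⟨K, hK, hlog⟩ := lintegral_gagliardoKernel_mul_infDist_rpow_le n hn0 s p hs0 hs1 hp0
  obtain ⟨β, hβ, hβ1, hβQ⟩ := exists_mul_rpow_le_half (C * 3 ^ p * K / p ^ p) (p - 1)
    (by positivity) (by linarith)
  have hG'univ : G' ≠ univ := fun h => hGproper (univ_subset_iff.1 (h ▸ hsub))
  have hEcl : IsClosed G'ᶜ := hG'open.isClosed_compl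
  have hEne : G'ᶜ.Nonempty := nonempty_compl.2 hG'univ
  have hGne : Gᶜ.Nonempty := nonempty_compl.2 hGproper
  have hδpos : ∀ x ∈ G', 0 < infDist x G'ᶜ := fun x hx =>
    (hEcl.notMem_iff_infDist_pos hEne).1 (not_not.2 hx)
  have hdpos : ∀ x ∈ G', 0 < infDist x Gᶜ := fun x hx =>
    (hGopen.isClosed_compl.notMem_iff_infDist_pos hGne).1 (not_not.2 (hsub hx))
  have hres : volume.restrict G = volume.restrict G' :=
    Measure.restrict_congr_set (hsub.eventuallyLE.antisymm (ae_le_set.2 hnull)).symm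
  set γ := β / p with hγ
  have hγ0 : 0 < γ := by positivity
  have hγp : γ * p = β := div_mul_cancel₀ _ hp0.ne'
  refine ⟨2 * (3 ^ (s * p) * c + C / β * 3 ^ p), by positivity, fun v hvs hvc hvG' => ?_⟩
  have hv := hvs.continuous
  set W : ℝ≥0∞ := ∫⁻ x in G', ∫⁻ y in G',
    ENNReal.ofReal (|v x - v y| ^ p / dist x y ^ ((n : ℝ) + s * p))
  set h : Euc n → ℝ≥0∞ := fun x => ENNReal.ofReal (|v x| ^ p * infDist x G'ᶜ ^ (-(s * p)))
  have hleft : ∫⁻ x in G', ENNReal.ofReal (|v x| ^ p / infDist x (frontier G') ^ (s * p)) =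
      ∫⁻ x in G', h x := by
    refine setLIntegral_congr_fun hG'open.measurableSet fun x hx => ?_
    simp only [h]
    rw [infDist_frontier_eq_infDist_compl hG'open hG'univ hx, Real.rpow_neg infDist_nonneg,
      div_eq_mul_inv]
  rw [hleft]
  set S : Set (Euc n) := G' ∩ {x | 3 * infDist x G'ᶜ ≤ infDist x Gᶜ}
  have hSm : MeasurableSet S := hG'open.measurableSet.inter
    (isClosed_le (continuous_const.mul (continuous_infDist_pt _))
      (continuous_infDist_pt _)).measurableSet
  have hfar : ∫⁻ x in G' \ S, h x ≤ ENNReal.ofReal (3 ^ (s * p) * c) * W := by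
    calc ∫⁻ x in G' \ S, h x ≤ ∫⁻ x in G' \ S, ENNReal.ofReal (3 ^ (s * p)) *
          ENNReal.ofReal (|v x| ^ p / infDist x (frontier G) ^ (s * p)) := by
          refine setLIntegral_mono' (hG'open.measurableSet.diff hSm) fun x hx => ?_
          have hlt : infDist x Gᶜ < 3 * infDist x G'ᶜ := by
            by_contra! hle
            exact hx.2 ⟨hx.1, hle⟩
          have hδ := hδpos x hx.1
          have hd := hdpos x hx.1
          rw [infDist_frontier_eq_infDist_compl hGopen hGproper (hsub hx.1),
            ← ENNReal.ofReal_mul (by positivity), div_eq_mul_inv, ← Real.rpow_neg hd.le]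
          refine ENNReal.ofReal_le_ofReal ?_
          calc |v x| ^ p * infDist x G'ᶜ ^ (-(s * p))
              = |v x| ^ p * (3 ^ (s * p) * (3 * infDist x G'ᶜ) ^ (-(s * p))) := by
                rw [Real.mul_rpow (by norm_num) hδ.le, ← mul_assoc (3 ^ (s * p)),
                  ← Real.rpow_add (by norm_num), add_neg_cancel, Real.rpow_zero, one_mul]
            _ ≤ |v x| ^ p * (3 ^ (s * p) * infDist x Gᶜ ^ (-(s * p))) := by
                refine mul_le_mul_of_nonneg_left (mul_le_mul_of_nonneg_left
                  (Real.rpow_le_rpow_of_nonpos hd hlt.le ?_) (by positivity)) (by positivity)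
                exact neg_nonpos.2 (by positivity)
            _ = _ := by ring
      _ ≤ ENNReal.ofReal (3 ^ (s * p)) *
          ∫⁻ x in G, ENNReal.ofReal (|v x| ^ p / infDist x (frontier G) ^ (s * p)) := by
          rw [lintegral_const_mul' _ _ ENNReal.ofReal_ne_top]
          gcongr
          exact sdiff_subset.trans hsub
      _ ≤ ENNReal.ofReal (3 ^ (s * p)) * (ENNReal.ofReal c * W) := by
          gcongr
          have := hHardy v hvs hvc (hvG'.trans hsub)
          rwa [hres] at this ⊢
      _ = _ := by rw [← mul_assoc, ← ENNReal.ofReal_mul (by positivity)]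
  set u : Euc n → ℝ := fun x => v x * infDist x G'ᶜ ^ γ with hu
  have hucont : Continuous u :=
    hv.mul ((continuous_infDist_pt _).rpow_const fun _ => Or.inr hγ0.le)
  have hu0 : ∀ w ∈ G'ᶜ, u w = 0 := fun w hw => by
    simp [hu, infDist_zero_of_mem hw, Real.zero_rpow hγ0.ne']
  have hnear : ∫⁻ x in S, h x ≤ ENNReal.ofReal (C / β) * (ENNReal.ofReal (3 ^ p) *
      (W + ENNReal.ofReal (K * γ ^ p) * ∫⁻ x in G', h x)) := by
    have h1 := hcap G'ᶜ hEcl hEne hfat S hSm (by rw [compl_compl]; exact inter_subset_left)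
      (fun x hx => by
        rw [compl_compl]
        refine measure_mono_null (sdiff_subset_sdiff_left ?_) hnull
        exact (ball_subset_ball hx.2).trans ball_infDist_compl_subset) β hβ hβ1 u hucont hu0
    have h2 := hlog G'ᶜ hEcl hEne v hv γ hγ0
    rw [hγp] at h2
    rw [compl_compl] at h1 h2
    refine le_trans (le_of_eq ?_) (h1.trans (mul_le_mul' le_rfl h2))
    refine setLIntegral_congr_fun hSm fun x hx => ?_
    have hδ := hδpos x hx.1
    simp only [h, hu]
    rw [abs_mul, abs_of_nonneg (Real.rpow_nonneg hδ.le γ), Real.mul_rpow (abs_nonneg _)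
      (by positivity), ← Real.rpow_mul hδ.le, hγp, mul_assoc, ← Real.rpow_add hδ]
    congr 3
    ring
  have hfin : ∫⁻ x in G', h x ≠ ∞ := by
    have := lintegral_abs_rpow_mul_infDist_lt_top hEcl hEne hv hvc
      (by rwa [compl_compl]) hp0 (-(s * p))
    rw [compl_compl] at this
    exact this.ne
  rw [ENNReal.ofReal_mul (by norm_num), ENNReal.ofReal_ofNat, mul_assoc]
  refine ENNReal.le_two_mul_of_le_add_half hfin ?_
  calc ∫⁻ x in G', h x = (∫⁻ x in S, h x) + ∫⁻ x in G' \ S, h x := by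
        have := lintegral_inter_add_sdiff (μ := volume) h G' hSm
        rwa [inter_eq_self_of_subset_right inter_subset_left, eq_comm] at this
    _ ≤ ENNReal.ofReal (C / β) * (ENNReal.ofReal (3 ^ p) *
          (W + ENNReal.ofReal (K * γ ^ p) * ∫⁻ x in G', h x)) +
        ENNReal.ofReal (3 ^ (s * p) * c) * W := add_le_add hnear hfar
    _ = ENNReal.ofReal (3 ^ (s * p) * c + C / β * 3 ^ p) * W +
        ENNReal.ofReal (C / β * 3 ^ p * (K * γ ^ p)) * ∫⁻ x in G', h x := by
        rw [ENNReal.ofReal_add (by positivity) (by positivity),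
          ENNReal.ofReal_mul (p := C / β * 3 ^ p) (by positivity),
          ENNReal.ofReal_mul (p := C / β) (by positivity)]
        ring
    _ ≤ _ := by
        gcongr
        refine le_trans (le_of_eq ?_) hβQ
        rw [hγ, Real.div_rpow hβ.le hp0.le, Real.rpow_sub_one hβ.ne']
        field_simp

end
end
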